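/- Let (A, m) be a two-dimensional regular local ring with infinite residue field, M ≠ (0) a finitely generated torsion-free A-module, and F = M** (a free module of rank r > 0) with M ⊆ F via the biduality map. Then the following conditions are equivalent: (1) tilde(M) = bar(M); (2) tilde(M^n) = bar(M^n) for every n > 0; (3) bar(M^ℓ) = M^ℓ for some ℓ > 0; (4) there exists ℓ > 0 such that bar(M^n) = M^n for every n ≥ ℓ; (5) Proj R(M) is a normal scheme; (6) R(M)_P is a normal ring for every P ∈ Spec R(M) \ {𝔐}, where 𝔐 = m R(M) + R(M)_+ is the graded maximal ideal of R(M). -/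

import Mathlib

set_option maxHeartbeats 1000000
set_option synthInstance.maxHeartbeats 400000

open MvPolynomial IsLocalRing

/-- The embedding of the free module `A^r` onto the degree-one part of the
polynomial ring `Sym_A(A^r) = A[t_1, ..., t_r]`, sending `f` to `∑ i, f i • X i`. -/
noncomputable abbrev emb (A : Type) [CommRing A] (r : ℕ) :
    (Fin r → A) →ₗ[A] MvPolynomial (Fin r) A :=
  Fintype.linearCombination A MvPolynomial.X

/-- The image `F₁` of the free module `F = A^r` inside `S = Sym_A(F)`. -/
noncomputable def freeSub (A : Type) [CommRing A] (r : ℕ) :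
    Submodule A (MvPolynomial (Fin r) A) :=
  Submodule.map (emb A r) ⊤

/-- The image `M₁` of a submodule `M ⊆ F` inside `S = Sym_A(F)`. -/
noncomputable def sub1 (A : Type) [CommRing A] (r : ℕ) (M : Submodule A (Fin r → A)) :
    Submodule A (MvPolynomial (Fin r) A) :=
  M.map (emb A r)

/-- The Rees algebra `R(M)` of `M ⊆ F`, i.e. the `A`-subalgebra of `S = Sym_A(F)`
generated by the degree-one part `M₁`; its `n`-th homogeneous component is `M₁ ^ n`. -/
noncomputable abbrev reesAlg (A : Type) [CommRing A] (r : ℕ) (M : Submodule A (Fin r → A)) :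
    Subalgebra A (MvPolynomial (Fin r) A) :=
  Algebra.adjoin A (sub1 A r M : Set (MvPolynomial (Fin r) A))

/-- The Ratliff--Rush closure `⋃_{ℓ > 0} [N^{ℓ+1} :_{Fn} N^ℓ]` of `N` (inside `Fn`),
where all powers and quotients of submodules are taken inside `S = Sym_A(F)`. -/
noncomputable def ratliffRush (A : Type) [CommRing A] (r : ℕ)
    (Fn N : Submodule A (MvPolynomial (Fin r) A)) : Submodule A (MvPolynomial (Fin r) A) :=
  ⨆ ℓ : ℕ, (Fn ⊓ (N ^ (ℓ + 2) / N ^ (ℓ + 1)))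

/-- The positive part `R₊ = ker(constant term)` of a graded subalgebra `R₀ ⊆ S`. -/
noncomputable def posPart (A : Type) [CommRing A] (r : ℕ)
    (R0 : Subalgebra A (MvPolynomial (Fin r) A)) : Ideal ↥R0 :=
  RingHom.ker ((MvPolynomial.constantCoeff).comp R0.val.toRingHom)

/-- `widetilde{R₀} = ε⁻¹(H⁰_{R₀₊}(S/R₀))`, i.e., the set of `x ∈ S` annihilated into `R₀`
by a power of the irrelevant ideal `R₀₊`; a graded subring of `S` containing `R₀`. -/
noncomputable def rrAlg (A : Type) [CommRing A] (r : ℕ)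
    (R0 : Subalgebra A (MvPolynomial (Fin r) A)) : Subalgebra A (MvPolynomial (Fin r) A) where
  carrier := {x | ∃ m : ℕ, ∀ y ∈ (posPart A r R0) ^ m,
    (y : MvPolynomial (Fin r) A) * x ∈ R0}
  mul_mem' := by
    rintro x₁ x₂ ⟨m₁, h₁⟩ ⟨m₂, h₂⟩
    refine ⟨m₁ + m₂, fun y hy => ?_⟩
    rw [pow_add] at hy
    refine Submodule.mul_induction_on hy (fun p hp q hq => ?_) (fun a b ha hb => ?_)
    · have : ((p * q : ↥R0) : MvPolynomial (Fin r) A) * (x₁ * x₂)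
          = ((p : MvPolynomial (Fin r) A) * x₁) * ((q : MvPolynomial (Fin r) A) * x₂) := by
        push_cast; ring
      rw [this]
      exact mul_mem (h₁ p hp) (h₂ q hq)
    · have : ((a + b : ↥R0) : MvPolynomial (Fin r) A) * (x₁ * x₂)
          = (a : MvPolynomial (Fin r) A) * (x₁ * x₂)
            + (b : MvPolynomial (Fin r) A) * (x₁ * x₂) := by
        push_cast; ring
      rw [this]
      exact add_mem ha hb
  one_mem' := ⟨0, fun y _ => by rw [mul_one]; exact y.2⟩
  add_mem' := by
    rintro x₁ x₂ ⟨m₁, h₁⟩ ⟨m₂, h₂⟩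
    refine ⟨m₁ + m₂, fun y hy => ?_⟩
    rw [mul_add]
    exact add_mem (h₁ y (Ideal.pow_le_pow_right (Nat.le_add_right _ _) hy))
      (h₂ y (Ideal.pow_le_pow_right (Nat.le_add_left _ _) hy))
  zero_mem' := ⟨0, fun y _ => by simpa using R0.zero_mem⟩
  algebraMap_mem' := fun a =>
    ⟨0, fun y _ => mul_mem y.2 (R0.algebraMap_mem a)⟩

/-- The integral closure of the Rees algebra `R(M)` inside `S = Sym_A(F)`,
viewed as an `A`-subalgebra of `S`. -/
noncomputable def intClAlg (A : Type) [CommRing A] (r : ℕ) (M : Submodule A (Fin r → A)) :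
    Subalgebra A (MvPolynomial (Fin r) A) :=
  (integralClosure (↥(reesAlg A r M)) (MvPolynomial (Fin r) A)).restrictScalars A

/-- The integral closure `overline{M^n}`: the `n`-th homogeneous component of the
integral closure of `R(M)` in `S`. -/
noncomputable def barPow (A : Type) [CommRing A] (r : ℕ) (M : Submodule A (Fin r → A))
    (n : ℕ) : Submodule A (MvPolynomial (Fin r) A) :=
  (freeSub A r) ^ n ⊓ (Subalgebra.toSubmodule (intClAlg A r M))

/-- `M` is a faithful `A`-module. -/
def faithfulSub (A : Type) [CommRing A] (r : ℕ) (M : Submodule A (Fin r → A)) : Prop :=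
  ∀ a : A, (∀ x ∈ M, a • x = (0 : Fin r → A)) → a = 0

/-- The length of an `A`-module, as the Krull dimension of its lattice of submodules. -/
noncomputable def modLength (A : Type) [CommRing A] (N : Type) [AddCommGroup N]
    [Module A N] : WithBot ℕ∞ :=
  Order.krullDim (Submodule A N)

/-- The quotient module `P/N` of two submodules of `S`. -/
abbrev quotNP (A : Type) [CommRing A] (r : ℕ)
    (N P : Submodule A (MvPolynomial (Fin r) A)) :=
  ↥P ⧸ (N.comap P.subtype)

/-- The minimal number of generators of a submodule. -/
noncomputable def minGen (A : Type) [CommRing A] {V : Type} [AddCommGroup V] [Module A V]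
    (N : Submodule A V) : ℕ :=
  sInf {n : ℕ | ∃ f : Fin n → V, Submodule.span A (Set.range f) = N}

/-- A Noetherian local ring is Cohen--Macaulay if its depth equals its Krull dimension,
i.e. there is a regular sequence in the maximal ideal whose length is the dimension. -/
def IsCohenMacaulayLocalRing (R : Type) [CommRing R] [IsLocalRing R] : Prop :=
  ∃ rs : List R, (∀ x ∈ rs, x ∈ maximalIdeal R) ∧
    RingTheory.Sequence.IsRegular R rs ∧ (rs.length : WithBot ℕ∞) = ringKrullDim R

/-- A Noetherian local ring is Buchsbaum (in the sense of Stückrad--Vogel) if every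
system of parameters `x_1, …, x_d` is a weak sequence:
`(x_1, …, x_{i-1}) : x_i ⊆ (x_1, …, x_{i-1}) : 𝔪` for all `i`. -/
def IsBuchsbaumLocalRing (R : Type) [CommRing R] [IsLocalRing R] : Prop :=
  ∀ d : ℕ, ringKrullDim R = d →
    ∀ x : Fin d → R, (∀ i, x i ∈ maximalIdeal R) →
      maximalIdeal R ≤ (Ideal.span (Set.range x)).radical →
      ∀ i : Fin d,
        (Ideal.span (x '' {j | j < i})).colon (Ideal.span {x i}) ≤
          (Ideal.span (x '' {j | j < i})).colon (maximalIdeal R)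

/-- An ideal `P` of a graded subalgebra `R₀ ⊆ S` is graded (homogeneous) if it contains,
together with any element, all of its homogeneous components. -/
def IsGradedIdeal (A : Type) [CommRing A] (r : ℕ)
    (R0 : Subalgebra A (MvPolynomial (Fin r) A)) (P : Ideal ↥R0) : Prop :=
  ∀ x : ↥R0, x ∈ P → ∀ n : ℕ,
    ∀ h : MvPolynomial.homogeneousComponent n (x : MvPolynomial (Fin r) A) ∈ R0,
      (⟨_, h⟩ : ↥R0) ∈ P

/-- The graded maximal ideal `𝔐 = 𝔪 R(M) + R(M)₊` of the Rees algebra, i.e. the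
preimage of the maximal ideal under the degree-zero projection. -/
noncomputable abbrev gradedMax (A : Type) [CommRing A] [IsLocalRing A] (r : ℕ)
    (M : Submodule A (Fin r → A)) : Ideal ↥(reesAlg A r M) :=
  Ideal.comap ((MvPolynomial.constantCoeff).comp (reesAlg A r M).val.toRingHom)
    (maximalIdeal A)




theorem rrx_pir_of_max {B : Type*} [CommRing B] [IsLocalRing B] [IsNoetherianRing B] (y : B)
    (hy : maximalIdeal B = Ideal.span {y}) : IsPrincipalIdealRing B := by
  apply IsPrincipalIdealRing.of_prime
  intro P hP
  by_cases hyP : y ∈ P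
  · have : P = maximalIdeal B := le_antisymm (le_maximalIdeal hP.ne_top)
      (by rw [hy, Ideal.span_le]; simpa using hyP)
    exact ⟨y, by rw [this, hy]⟩
  · have : P = ⊥ := by
      apply Submodule.eq_bot_of_le_smul_of_le_jacobson_bot (maximalIdeal B) P
        (IsNoetherian.noetherian P) _ (IsLocalRing.maximalIdeal_le_jacobson ⊥)
      intro p hp
      have h1 : p ∈ maximalIdeal B := le_maximalIdeal hP.ne_top hp
      have h2 := h1
      rw [hy, Ideal.mem_span_singleton'] at h2
      obtain ⟨q, rfl⟩ := h2
      have hq : q ∈ P := (hP.mem_or_mem hp).resolve_right hyP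
      rw [mul_comm]
      apply Submodule.smul_mem_smul _ hq
      rw [hy]; exact Ideal.mem_span_singleton_self y
    rw [this]; exact bot_isPrincipal

theorem rrx_prime_principal {A : Type*} [CommRing A] [IsLocalRing A] [IsNoetherianRing A] (x y : A)
    (hxy : Ideal.span {x, y} = maximalIdeal A) (P : Ideal A) (hP : P.IsPrime) (hx : x ∉ P) :
    ∃ a, P = Ideal.span {a} := by
  have hxm : x ∈ maximalIdeal A := by rw [← hxy]; exact Ideal.subset_span (by simp)
  have hne : Ideal.span {x} ≠ ⊤ := by
    intro h; rw [Ideal.span_singleton_eq_top] at h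
    exact (mem_maximalIdeal x).1 hxm h
  have : Nontrivial (A ⧸ Ideal.span {x}) := Ideal.Quotient.nontrivial_iff.2 hne
  have : IsLocalRing (A ⧸ Ideal.span {x}) :=
    IsLocalRing.of_surjective' (Ideal.Quotient.mk (Ideal.span {x})) Ideal.Quotient.mk_surjective
  have hmax : maximalIdeal (A ⧸ Ideal.span {x}) =
      Ideal.span {Ideal.Quotient.mk (Ideal.span {x}) y} := by
    apply le_antisymm
    · intro b hb
      obtain ⟨a, rfl⟩ := Ideal.Quotient.mk_surjective b
      have ha : a ∈ maximalIdeal A := by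
        rw [mem_maximalIdeal]
        intro h
        exact (mem_maximalIdeal _).1 hb (h.map _)
      rw [← hxy, Ideal.mem_span_pair] at ha
      obtain ⟨c, d, rfl⟩ := ha
      rw [Ideal.mem_span_singleton']
      refine ⟨Ideal.Quotient.mk _ d, ?_⟩
      have : (Ideal.Quotient.mk (Ideal.span {x})) x = 0 :=
        Ideal.Quotient.eq_zero_iff_mem.2 (Ideal.mem_span_singleton_self x)
      simp [this]
    · rw [Ideal.span_le, Set.singleton_subset_iff]
      have hym : y ∈ maximalIdeal A := by rw [← hxy]; exact Ideal.subset_span (by simp)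
      intro h
      have : IsLocalHom (Ideal.Quotient.mk (Ideal.span {x})) :=
        IsLocalHom.of_surjective _ Ideal.Quotient.mk_surjective
      exact (mem_maximalIdeal y).1 hym (isUnit_of_map_unit _ _ h)
  have := rrx_pir_of_max _ hmax
  obtain ⟨g, hg⟩ := (IsPrincipalIdealRing.principal (P.map (Ideal.Quotient.mk (Ideal.span {x})))).principal
  have hgm : g ∈ P.map (Ideal.Quotient.mk (Ideal.span {x})) := by
    rw [hg]; exact Ideal.mem_span_singleton_self g
  rw [Ideal.mem_map_iff_of_surjective _ Ideal.Quotient.mk_surjective] at hgm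
  obtain ⟨a, haP, rfl⟩ := hgm
  refine ⟨a, le_antisymm ?_ ((Ideal.span_singleton_le_iff_mem P).2 haP)⟩
  apply Submodule.le_of_le_smul_of_le_jacobson_bot (IsNoetherian.noetherian P)
    (IsLocalRing.maximalIdeal_le_jacobson ⊥)
  intro p hp
  have h1 := Ideal.mem_map_of_mem (Ideal.Quotient.mk (Ideal.span {x})) hp
  rw [hg] at h1
  obtain ⟨c, hc⟩ := Ideal.mem_span_singleton'.1 h1
  obtain ⟨c, rfl⟩ := Ideal.Quotient.mk_surjective c
  rw [← map_mul, Ideal.Quotient.eq, Ideal.mem_span_singleton'] at hc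
  obtain ⟨d, hd⟩ := hc
  have hdP : d ∈ P := by
    refine (hP.mem_or_mem (?_ : d * x ∈ P)).resolve_right hx
    rw [hd]; exact P.sub_mem (P.mul_mem_left _ haP) hp
  have : p = c * a + x * (-d) := by linear_combination hd
  rw [this]
  exact Submodule.add_mem_sup (Ideal.mem_span_singleton'.2 ⟨c, rfl⟩)
    (Submodule.smul_mem_smul hxm (P.neg_mem hdP))

theorem rrx_prime_principal' {A : Type*} [CommRing A] [IsLocalRing A] [IsNoetherianRing A] (x y : A)
    (hxy : Ideal.span {x, y} = maximalIdeal A) (P : Ideal A) (hP : P.IsPrime)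
    (hne : P ≠ maximalIdeal A) : ∃ a, P = Ideal.span {a} := by
  by_cases hx : x ∈ P
  · by_cases hy : y ∈ P
    · exfalso; apply hne
      refine le_antisymm (le_maximalIdeal hP.ne_top) ?_
      rw [← hxy, Ideal.span_le]
      rintro z (rfl | rfl) <;> assumption
    · rw [Set.pair_comm] at hxy
      exact rrx_prime_principal y x hxy P hP hy
  · exact rrx_prime_principal x y hxy P hP hx

theorem rrx_regular {A : Type*} [CommRing A] [IsLocalRing A] [IsNoetherianRing A]
    (hdim : ringKrullDim A = 2)
    (hreg : ∃ x y : A, Ideal.span {x, y} = maximalIdeal A) :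
    ∃ _ : IsDomain A, IsIntegrallyClosed A ∧ ¬ (maximalIdeal A).IsPrincipal := by
  obtain ⟨x, y, hxy⟩ := hreg
  obtain ⟨s, hs⟩ := (Order.le_krullDim_iff (α := PrimeSpectrum A) (n := 2)).1 (le_of_eq hdim.symm)
  have h01 : s ⟨0, by omega⟩ < s ⟨1, by omega⟩ := s.strictMono (by simp [Fin.lt_def])
  have h12 : s ⟨1, by omega⟩ < s ⟨2, by omega⟩ := s.strictMono (by simp [Fin.lt_def])
  set p0 := s ⟨0, by omega⟩
  set p1 := s ⟨1, by omega⟩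
  set p2 := s ⟨2, by omega⟩
  have h01' : p0.asIdeal < p1.asIdeal := h01
  have h12' : p1.asIdeal < p2.asIdeal := h12
  have hp1 : p1.asIdeal ≠ maximalIdeal A := by
    intro h
    rw [h] at h12'
    exact absurd (le_maximalIdeal p2.isPrime.ne_top) (not_le_of_gt h12')
  obtain ⟨π, hπ⟩ := rrx_prime_principal' x y hxy _ p1.isPrime hp1
  have hπ0 : π ∉ p0.asIdeal := by
    intro h
    apply not_le_of_gt h01'
    rw [hπ]; exact (Ideal.span_singleton_le_iff_mem _).2 h
  have hπ1 : π ∈ p1.asIdeal := by rw [hπ]; exact Ideal.mem_span_singleton_self π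
  have hπm : π ∈ maximalIdeal A := le_maximalIdeal p1.isPrime.ne_top hπ1
  have hbot : p0.asIdeal = ⊥ := by
    apply Submodule.eq_bot_of_le_smul_of_le_jacobson_bot (maximalIdeal A) _
        (IsNoetherian.noetherian _) _ (IsLocalRing.maximalIdeal_le_jacobson ⊥)
    intro p hp
    have h1 := h01'.le hp
    rw [hπ, Ideal.mem_span_singleton'] at h1
    obtain ⟨q, rfl⟩ := h1
    have hq := (p0.isPrime.mem_or_mem hp).resolve_right hπ0
    rw [mul_comm]
    exact Submodule.smul_mem_smul hπm hq
  have hdom : IsDomain A := by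
    have := p0.isPrime
    rw [hbot] at this
    exact IsDomain.of_bot_isPrime A
  have hpr : ∀ a : A, Ideal.span {a} ≠ ⊥ → (Ideal.span {a}).IsPrime → Prime a := by
    intro a h0 h
    exact (Ideal.span_singleton_prime (by simpa using h0)).1 h
  refine ⟨hdom, ?_, ?_⟩
  · have : UniqueFactorizationMonoid A := by
      rw [UniqueFactorizationMonoid.iff_exists_prime_mem_of_isPrime]
      intro I hI hIp
      by_cases hIm : I = maximalIdeal A
      · refine ⟨π, hIm ▸ hπm, hpr π ?_ (hπ ▸ p1.isPrime)⟩
        rw [← hπ]; exact ne_bot_of_gt h01'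
      · obtain ⟨a, rfl⟩ := rrx_prime_principal' x y hxy I hIp hIm
        exact ⟨a, Ideal.mem_span_singleton_self a, hpr a hI hIp⟩
    infer_instance
  · rintro ⟨t, ht⟩
    change _ = Ideal.span {t} at ht
    have htp : t ∉ p1.asIdeal := by
      intro h
      apply hp1
      refine le_antisymm (le_maximalIdeal p1.isPrime.ne_top) ?_
      rw [ht]; exact (Ideal.span_singleton_le_iff_mem _).2 h
    have : p1.asIdeal = ⊥ := by
      apply Submodule.eq_bot_of_le_smul_of_le_jacobson_bot (maximalIdeal A) _
        (IsNoetherian.noetherian _) _ (IsLocalRing.maximalIdeal_le_jacobson ⊥)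
      intro p hp
      have h1 := le_maximalIdeal p1.isPrime.ne_top hp
      rw [ht, Ideal.mem_span_singleton'] at h1
      obtain ⟨q, rfl⟩ := h1
      have hq := (p1.isPrime.mem_or_mem hp).resolve_right htp
      rw [mul_comm]
      exact Submodule.smul_mem_smul (ht ▸ Ideal.mem_span_singleton_self t) hq
    exact ne_bot_of_gt h01' this



theorem rrx_intElem_of_range_le {R R' S : Type*} [CommRing R] [CommRing R'] [CommRing S]
    (f : R →+* S) (g : R' →+* S) (h : ∀ a, ∃ b, g b = f a) {x : S} (hx : f.IsIntegralElem x) :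
    g.IsIntegralElem x := by
  obtain ⟨p, hp, he⟩ := hx
  have hl : p.map f ∈ Polynomial.lifts g := by
    rw [Polynomial.lifts_iff_coeff_lifts]
    intro k
    rw [Polynomial.coeff_map]
    exact h _
  obtain ⟨q, hq, -, hm⟩ := Polynomial.lifts_and_natDegree_eq_and_monic hl (hp.map f)
  refine ⟨q, hm, ?_⟩
  rw [← Polynomial.eval_map, hq, Polynomial.eval_map, he]

theorem rrx_int_mono {S : Type*} [CommRing S] {R R' : Subring S} (h : R ≤ R') {x : S}
    (hx : IsIntegral R x) : IsIntegral R' x :=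
  rrx_intElem_of_range_le R.subtype R'.subtype (fun a => ⟨⟨a, h a.2⟩, rfl⟩) hx

theorem rrx_int_mem {S : Type*} [CommRing S] {R : Subring S} {x : S} (h : x ∈ R) :
    IsIntegral R x := by
  have := isIntegral_algebraMap (R := R) (A := S) (x := ⟨x, h⟩)
  exact this

/-- integral closure as a subring -/
def rrxIC {S : Type*} [CommRing S] (R : Subring S) : Subring S :=
  (integralClosure R S).toSubring

theorem rrx_mem_IC {S : Type*} [CommRing S] {R : Subring S} {x : S} :
    x ∈ rrxIC R ↔ IsIntegral R x := Iff.rfl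

theorem rrx_le_IC {S : Type*} [CommRing S] (R : Subring S) : R ≤ rrxIC R :=
  fun _ h => rrx_int_mem h

theorem rrx_IC_mono {S : Type*} [CommRing S] {R R' : Subring S} (h : R ≤ R') : rrxIC R ≤ rrxIC R' :=
  fun _ hx => rrx_int_mono h hx

theorem rrx_int_IC {S : Type*} [CommRing S] {R : Subring S} {x : S}
    (hx : IsIntegral (rrxIC R) x) : IsIntegral R x := by
  have h1 : IsIntegral (integralClosure R S) x := hx
  exact isIntegral_trans (R := R) (A := integralClosure R S) x h1

section abs
variable {K : Type*} [Field K] {P : Type*} [CommRing P] [Algebra K P]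

/-- image of a subring as an additive subgroup -/
def rrxLB (P : Type*) [CommRing P] [Algebra K P] (B : Subring K) : Submodule ℤ P :=
  AddSubgroup.toIntSubmodule (B.map (algebraMap K P)).toAddSubgroup

theorem rrx_mem_LB {B : Subring K} {z : P} :
    z ∈ rrxLB P B ↔ ∃ b ∈ B, algebraMap K P b = z := Iff.rfl

theorem rrx_LB_mem {B : Subring K} {b : K} (hb : b ∈ B) : algebraMap K P b ∈ rrxLB P B :=
  ⟨b, hb, rfl⟩

theorem rrx_LB_mono {B B' : Subring K} (h : B ≤ B') : rrxLB P B ≤ rrxLB P B' := by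
  rintro _ ⟨b, hb, rfl⟩; exact ⟨b, h hb, rfl⟩

theorem rrx_one_le_LB (B : Subring K) : 1 ≤ rrxLB P B := by
  rw [Submodule.one_le]; exact ⟨1, B.one_mem, map_one _⟩

theorem rrx_LB_mul (B : Subring K) : rrxLB P B * rrxLB P B ≤ rrxLB P B := by
  rw [Submodule.mul_le]
  rintro _ ⟨b, hb, rfl⟩ _ ⟨c, hc, rfl⟩
  exact ⟨b * c, B.mul_mem hb hc, map_mul _ _ _⟩

theorem rrx_LB_mul_eq (B : Subring K) : rrxLB P B * rrxLB P B = rrxLB P B :=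
  le_antisymm (rrx_LB_mul B) (by
    calc rrxLB P B = 1 * rrxLB P B := (one_mul _).symm
      _ ≤ _ := mul_le_mul_left (rrx_one_le_LB B) _)

theorem rrx_LB_pow {B : Subring K} {N E : Submodule ℤ P} (h : N ≤ rrxLB P B * E) (n : ℕ) :
    N ^ n ≤ rrxLB P B * E ^ n := by
  induction n with
  | zero => simpa using rrx_one_le_LB B
  | succ n ih =>
    calc N ^ (n+1) = N ^ n * N := pow_succ _ _
      _ ≤ (rrxLB P B * E ^ n) * (rrxLB P B * E) := mul_le_mul' ih h
      _ = (rrxLB P B * rrxLB P B) * E ^ (n+1) := by rw [pow_succ]; ring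
      _ = _ := by rw [rrx_LB_mul_eq]

/-- subring of P generated by B and the m's -/
def rrxRM {σ : Type*} (m : σ → P) (B : Subring K) : Subring P :=
  Subring.closure ((algebraMap K P) '' B ∪ Set.range m)

theorem rrx_RM_mono {σ : Type*} (m : σ → P) {B B' : Subring K} (h : B ≤ B') :
    rrxRM m B ≤ rrxRM m B' :=
  Subring.closure_mono (Set.union_subset_union_left _ (Set.image_mono h))

theorem rrx_RM_alg {σ : Type*} (m : σ → P) {B : Subring K} {b : K} (hb : b ∈ B) :
    algebraMap K P b ∈ rrxRM m B :=
  Subring.subset_closure (Or.inl ⟨b, hb, rfl⟩)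

theorem rrx_RM_m {σ : Type*} (m : σ → P) (B : Subring K) (j : σ) :
    m j ∈ rrxRM m B :=
  Subring.subset_closure (Or.inr ⟨j, rfl⟩)

/-- span of the m's -/
def rrxM {σ : Type*} (m : σ → P) : Submodule ℤ P := Submodule.span ℤ (Set.range m)

theorem rrx_m_mem {σ : Type*} (m : σ → P) (j : σ) : m j ∈ rrxM m :=
  Submodule.subset_span ⟨j, rfl⟩

theorem rrx_subring_le (R : Subring P) {N N' : Submodule ℤ P}
    (h : N ≤ AddSubgroup.toIntSubmodule R.toAddSubgroup)
    (h' : N' ≤ AddSubgroup.toIntSubmodule R.toAddSubgroup) :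
    N * N' ≤ AddSubgroup.toIntSubmodule R.toAddSubgroup := by
  rw [Submodule.mul_le]
  intro a ha b hb
  exact R.mul_mem (h ha) (h' hb)

theorem rrx_subring_pow (R : Subring P) {N : Submodule ℤ P}
    (h : N ≤ AddSubgroup.toIntSubmodule R.toAddSubgroup) (n : ℕ) :
    N ^ n ≤ AddSubgroup.toIntSubmodule R.toAddSubgroup := by
  induction n with
  | zero => rw [pow_zero, Submodule.one_le]; exact R.one_mem
  | succ n ih => rw [pow_succ]; exact rrx_subring_le R ih h

theorem rrx_M_le_RM {σ : Type*} (m : σ → P) (B : Subring K) :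
    rrxM m ≤ AddSubgroup.toIntSubmodule (rrxRM m B).toAddSubgroup := by
  rw [rrxM, Submodule.span_le]
  rintro _ ⟨j, rfl⟩
  exact rrx_RM_m m B j

theorem rrx_LB_le_RM {σ : Type*} (m : σ → P) (B : Subring K) :
    rrxLB P B ≤ AddSubgroup.toIntSubmodule (rrxRM m B).toAddSubgroup := by
  rintro _ ⟨b, hb, rfl⟩
  exact rrx_RM_alg m hb

/-- graded pieces of the integral closure -/
def rrxCl {σ : Type*} (m : σ → P) (B : Subring K) (n : ℕ) : Submodule ℤ P :=
  (rrxLB P (⊤ : Subring K) * rrxM m ^ n) ⊓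
    AddSubgroup.toIntSubmodule (rrxIC (rrxRM m B)).toAddSubgroup

theorem rrx_mem_Cl {σ : Type*} {m : σ → P} {B : Subring K} {n : ℕ} {z : P} :
    z ∈ rrxCl m B n ↔ z ∈ rrxLB P (⊤ : Subring K) * rrxM m ^ n ∧ IsIntegral (rrxRM m B) z :=
  Iff.rfl

theorem rrx_Cl_mono {σ : Type*} (m : σ → P) {B B' : Subring K} (h : B ≤ B') (n : ℕ) :
    rrxCl m B n ≤ rrxCl m B' n := fun _ hz =>
  ⟨hz.1, rrx_int_mono (rrx_RM_mono m h) hz.2⟩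

theorem rrx_RM_le_IC {σ : Type*} (m : σ → P) (B : Subring K) :
    AddSubgroup.toIntSubmodule (rrxRM m B).toAddSubgroup ≤
    AddSubgroup.toIntSubmodule (rrxIC (rrxRM m B)).toAddSubgroup := rrx_le_IC (rrxRM m B)

theorem rrx_M_mul_Cl {σ : Type*} (m : σ → P) (B : Subring K) (n : ℕ) :
    rrxM m * rrxCl m B n ≤ rrxCl m B (n+1) := by
  apply le_inf
  · calc rrxM m * rrxCl m B n ≤ rrxM m * (rrxLB P (⊤ : Subring K) * rrxM m ^ n) :=
        mul_le_mul_right inf_le_left _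
      _ = _ := by rw [pow_succ]; ring
      _ ≤ _ := le_rfl
  · exact rrx_subring_le _ ((rrx_M_le_RM m B).trans (rrx_RM_le_IC m B)) inf_le_right

theorem rrx_LB_mul_Cl {σ : Type*} (m : σ → P) (B : Subring K) (n : ℕ) :
    rrxLB P B * rrxCl m B n ≤ rrxCl m B n := by
  apply le_inf
  · calc rrxLB P B * rrxCl m B n ≤ rrxLB P ⊤ * (rrxLB P (⊤ : Subring K) * rrxM m ^ n) :=
        mul_le_mul' (rrx_LB_mono le_top) inf_le_left
      _ = _ := by rw [← mul_assoc, rrx_LB_mul_eq]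
      _ ≤ _ := le_rfl
  · exact rrx_subring_le _ ((rrx_LB_le_RM m B).trans (rrx_RM_le_IC m B)) inf_le_right

theorem rrx_LB_M_le_Cl {σ : Type*} (m : σ → P) (B : Subring K) (n : ℕ) :
    rrxLB P B * rrxM m ^ n ≤ rrxCl m B n := by
  apply le_inf
  · exact mul_le_mul_left (rrx_LB_mono le_top) _
  · exact rrx_subring_le _ ((rrx_LB_le_RM m B).trans (rrx_RM_le_IC m B))
      (rrx_subring_pow _ ((rrx_M_le_RM m B).trans (rrx_RM_le_IC m B)) n)

/-- evaluation of polynomials with coefficients in B -/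
noncomputable def rrxPsi {r : ℕ} (e : Fin r → P) (B : Subring K) : MvPolynomial (Fin r) B →+* P :=
  (MvPolynomial.aeval (R := K) e).toRingHom.comp (MvPolynomial.map B.subtype)

theorem rrx_Psi_C {r : ℕ} (e : Fin r → P) (B : Subring K) (b : B) :
    rrxPsi e B (C b) = algebraMap K P b := by simp [rrxPsi]

theorem rrx_Psi_X {r : ℕ} (e : Fin r → P) (B : Subring K) (i : Fin r) :
    rrxPsi e B (X i) = e i := by simp [rrxPsi]

/-- image of homogeneous polynomials -/
noncomputable def rrxHn {r : ℕ} (e : Fin r → P) (B : Subring K) (n : ℕ) : Submodule ℤ P :=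
  AddSubgroup.toIntSubmodule
    (((homogeneousSubmodule (Fin r) B n).toAddSubgroup).map (rrxPsi e B).toAddMonoidHom)

theorem rrx_mem_Hn {r : ℕ} {e : Fin r → P} {B : Subring K} {n : ℕ} {z : P} :
    z ∈ rrxHn e B n ↔ ∃ q : MvPolynomial (Fin r) B, q.IsHomogeneous n ∧ rrxPsi e B q = z :=
  Iff.rfl

theorem rrx_Hn_mul {r : ℕ} (e : Fin r → P) (B : Subring K) (a b : ℕ) :
    rrxHn e B a * rrxHn e B b ≤ rrxHn e B (a+b) := by
  rw [Submodule.mul_le]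
  rintro _ ⟨p, hp, rfl⟩ _ ⟨q, hq, rfl⟩
  exact ⟨p * q, IsHomogeneous.mul hp hq, map_mul (rrxPsi e B) _ _⟩

theorem rrx_Hn_eq {r : ℕ} (e : Fin r → P) (B : Subring K) (n : ℕ) :
    rrxHn e B n = rrxLB P B * rrxM e ^ n := by
  apply le_antisymm
  · rintro _ ⟨q, hq, rfl⟩
    change rrxPsi e B q ∈ _
    rw [q.as_sum, map_sum]
    apply Submodule.sum_mem
    intro d hd
    have hd' : d.degree = n := by
      by_contra h
      exact (mem_support_iff.1 hd) (IsHomogeneous.coeff_eq_zero hq h)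
    rw [monomial_eq, map_mul, rrx_Psi_C]
    apply Submodule.mul_mem_mul (rrx_LB_mem (coeff d q).2)
    rw [Finsupp.prod, map_prod, ← hd', show d.degree = ∑ i ∈ d.support, d i from rfl]
    clear hd hd'
    induction d.support using Finset.induction_on with
    | empty =>
      rw [Finset.prod_empty, Finset.sum_empty, pow_zero]
      exact Submodule.one_le.1 le_rfl
    | insert i s hi ih =>
      rw [Finset.prod_insert hi, Finset.sum_insert hi, pow_add]
      refine Submodule.mul_mem_mul ?_ ih
      rw [map_pow, rrx_Psi_X]
      exact Submodule.pow_mem_pow _ (rrx_m_mem e i) _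
  · have h0 : rrxLB P B ≤ rrxHn e B 0 := by
      rintro _ ⟨b, hb, rfl⟩
      exact ⟨C ⟨b, hb⟩, isHomogeneous_C _ _, rrx_Psi_C _ _ _⟩
    have h1 : rrxM e ≤ rrxHn e B 1 := by
      rw [rrxM, Submodule.span_le]
      rintro _ ⟨i, rfl⟩
      exact ⟨X i, isHomogeneous_X _ _, rrx_Psi_X _ _ _⟩
    induction n with
    | zero => simpa using h0
    | succ n ih =>
      rw [pow_succ, ← mul_assoc]
      exact (mul_le_mul' ih h1).trans (rrx_Hn_mul e B n 1)

/-- elements of K E^n integral over B[e] -/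
theorem rrx_free_int {r : ℕ} (e : Fin r → P) (he : AlgebraicIndependent K e) (B : Subring K)
    (hB : ∀ z : K, IsIntegral B z → z ∈ B) (n : ℕ) (z : P)
    (hz : z ∈ rrxLB P (⊤ : Subring K) * rrxM e ^ n) (hi : IsIntegral (rrxRM e B) z) :
    z ∈ rrxLB P B * rrxM e ^ n := by
  rw [← rrx_Hn_eq] at hz ⊢
  obtain ⟨q0, hq0, rfl⟩ := hz
  change IsIntegral (rrxRM e B) (rrxPsi e ⊤ q0) at hi
  change rrxPsi e ⊤ q0 ∈ _
  set q := MvPolynomial.map (Subring.subtype ⊤) q0 with hq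
  have hqh : q.IsHomogeneous n := IsHomogeneous.map hq0 _
  have hPq : rrxPsi e ⊤ q0 = aeval (R := K) e q := rfl
  rw [hPq] at hi ⊢
  have h1 : (rrxPsi e B).IsIntegralElem (aeval (R := K) e q) := by
    refine rrx_intElem_of_range_le (rrxRM e B).subtype (rrxPsi e B) ?_ hi
    rintro ⟨a, ha⟩
    change a ∈ (rrxPsi e B).range
    revert ha
    revert a
    change rrxRM e B ≤ (rrxPsi e B).range
    rw [rrxRM, Subring.closure_le]
    rintro _ (⟨b, hb, rfl⟩ | ⟨j, rfl⟩)
    · exact ⟨C ⟨b, hb⟩, rrx_Psi_C _ _ _⟩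
    · exact ⟨X j, rrx_Psi_X _ _ _⟩
  have h2 : (MvPolynomial.map (σ := Fin r) B.subtype).IsIntegralElem q := by
    obtain ⟨p, hp, hpe⟩ := h1
    refine ⟨p, hp, ?_⟩
    rw [rrxPsi] at hpe
    have := Polynomial.hom_eval₂ p (MvPolynomial.map (σ := Fin r) B.subtype)
      (aeval (R := K) e).toRingHom q
    erw [hpe] at this
    exact (injective_iff_map_eq_zero _).1 he _ this
  let _ := MvPolynomial.algebraMvPolynomial (R := B) (S := K) (σ := Fin r)
  have h3 : IsIntegral (MvPolynomial (Fin r) B) q := by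
    refine rrx_intElem_of_range_le (MvPolynomial.map (σ := Fin r) B.subtype) _ ?_ h2
    intro a
    refine ⟨a, ?_⟩
    rw [MvPolynomial.algebraMap_def]; rfl
  have h4 := MvPolynomial.isIntegral_iff_isIntegral_coeff.1 h3
  have h5 : q ∈ Set.range (MvPolynomial.map (σ := Fin r) B.subtype) := by
    rw [MvPolynomial.mem_range_map_iff_coeffs_subset]
    intro c hc
    rw [Finset.mem_coe, MvPolynomial.mem_coeffs_iff] at hc
    obtain ⟨d, -, rfl⟩ := hc
    exact ⟨⟨_, hB _ (h4 d)⟩, rfl⟩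
  obtain ⟨q1, hq1⟩ := h5
  refine ⟨q1, ?_, ?_⟩
  · have : (MvPolynomial.map B.subtype q1).IsHomogeneous n := by rw [hq1]; exact hqh
    exact IsHomogeneous.of_map B.subtype_injective this
  · change aeval e (MvPolynomial.map B.subtype q1) = _
    rw [hq1]

theorem rrx_free_inter {r : ℕ} (e : Fin r → P) (he : AlgebraicIndependent K e)
    (B B' D : Subring K) (hD : ∀ z ∈ B, z ∈ B' → z ∈ D) (n : ℕ) (z : P)
    (hz : z ∈ rrxLB P B * rrxM e ^ n) (hz' : z ∈ rrxLB P B' * rrxM e ^ n) :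
    z ∈ rrxLB P D * rrxM e ^ n := by
  rw [← rrx_Hn_eq] at hz hz' ⊢
  obtain ⟨q, hq, rfl⟩ := hz
  obtain ⟨q', hq', h⟩ := hz'
  have h1 : MvPolynomial.map B'.subtype q' = MvPolynomial.map B.subtype q := he h
  have h5 : MvPolynomial.map B.subtype q ∈ Set.range (MvPolynomial.map (σ := Fin r) D.subtype) := by
    rw [MvPolynomial.mem_range_map_iff_coeffs_subset]
    intro c hc
    rw [Finset.mem_coe, MvPolynomial.mem_coeffs_iff] at hc
    obtain ⟨d, -, rfl⟩ := hc
    refine ⟨⟨_, hD _ ?_ ?_⟩, rfl⟩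
    · exact (coeff d q).2
    · have h2 := congrArg (fun p => coeff d p) h1
      simp only [coeff_map] at h2
      have h3 : B.subtype (coeff d q) ∈ B' := by rw [← h2]; exact (coeff d q').2
      exact h3
  obtain ⟨q1, hq1⟩ := h5
  refine ⟨q1, ?_, ?_⟩
  · have : (MvPolynomial.map D.subtype q1).IsHomogeneous n := by
      rw [hq1]; exact IsHomogeneous.map hq _
    exact IsHomogeneous.of_map D.subtype_injective this
  · change aeval e (MvPolynomial.map D.subtype q1) = _
    rw [hq1]; rfl

end abs



theorem rrx_common_den {S : Type*} [CommRing S] (R : Subring S) (S0 : Submonoid S)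
    (hS0 : ∀ s ∈ S0, s ∈ R) {α : Type*} (t : Finset α) (c : α → S)
    (h : ∀ i ∈ t, ∃ s ∈ S0, s * c i ∈ R) : ∃ s ∈ S0, ∀ i ∈ t, s * c i ∈ R := by
  classical
  induction t using Finset.induction_on with
  | empty => exact ⟨1, S0.one_mem, by simp⟩
  | insert a t ha ih =>
    obtain ⟨s, hs, h1⟩ := ih (fun i hi => h i (Finset.mem_insert_of_mem hi))
    obtain ⟨s', hs', h2⟩ := h a (Finset.mem_insert_self a t)
    refine ⟨s * s', S0.mul_mem hs hs', ?_⟩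
    intro i hi
    rcases Finset.mem_insert.1 hi with rfl | hi
    · rw [mul_assoc]; exact R.mul_mem (hS0 _ hs) h2
    · rw [mul_right_comm, mul_comm]; exact R.mul_mem (hS0 _ hs') (h1 i hi)

theorem rrx_den {S : Type*} [CommRing S] (R R' : Subring S) (S0 : Submonoid S)
    (hS0 : ∀ s ∈ S0, s ∈ R) (h : ∀ c ∈ R', ∃ s ∈ S0, s * c ∈ R) {w : S}
    (hw : IsIntegral R' w) : ∃ s ∈ S0, IsIntegral R (s * w) := by
  obtain ⟨p, hp, he⟩ := hw
  obtain ⟨s, hs, hsc⟩ := rrx_common_den R S0 hS0 (Finset.range p.natDegree)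
    (fun i => (p.coeff i : S)) (fun i _ => h _ (p.coeff i).2)
  refine ⟨s, hs, ?_⟩
  set q := (p.map R'.subtype) with hq
  have hqm : q.Monic := hp.map _
  have hqe : Polynomial.eval₂ (RingHom.id S) w q = 0 := by
    rw [hq, Polynomial.eval₂_map]; exact he
  have hl : q.scaleRoots s ∈ Polynomial.lifts R.subtype := by
    rw [Polynomial.lifts_iff_coeff_lifts]
    intro k
    change _ ∈ R.subtype.range
    rw [Subring.range_subtype, Polynomial.coeff_scaleRoots]
    rcases lt_trichotomy k q.natDegree with hk | hk | hk
    · obtain ⟨j, hj⟩ : ∃ j, q.natDegree - k = j + 1 := ⟨q.natDegree - k - 1, by omega⟩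
      rw [hj, pow_succ', ← mul_assoc, mul_comm (q.coeff k)]
      refine R.mul_mem ?_ (R.pow_mem (hS0 _ hs) _)
      have := hsc k (Finset.mem_range.2 (lt_of_lt_of_le hk Polynomial.natDegree_map_le))
      rw [hq, Polynomial.coeff_map]; exact this
    · rw [hk, Polynomial.Monic.coeff_natDegree hqm]; simp
    · rw [Polynomial.coeff_eq_zero_of_natDegree_lt hk]; simp
  obtain ⟨q', hq', -, hm⟩ := Polynomial.lifts_and_natDegree_eq_and_monic hl
    ((Polynomial.monic_scaleRoots_iff s).2 hqm)
  refine ⟨q', hm, ?_⟩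
  change Polynomial.eval₂ R.subtype _ _ = 0
  rw [← Polynomial.eval_map, hq']
  have := Polynomial.scaleRoots_eval₂_eq_zero (RingHom.id S) (s := s) hqe
  simpa [Polynomial.eval₂_id] using this

theorem rrx_val {L : Type*} [Field L] (R R1 R2 : Subring L) (T : L) (p : Polynomial L)
    (hp : p.Monic) (hpR : ∀ i, p.coeff i ∈ R)
    (h1 : R1 ≤ Subring.closure ((R : Set L) ∪ {T}))
    (h2 : R2 ≤ Subring.closure ((R : Set L) ∪
      {w | ∃ j ≤ p.natDegree, w = T ^ j / p.eval T}))
    {z : L} (hz1 : IsIntegral R1 z) (hz2 : IsIntegral R2 z) : IsIntegral R z := by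
  have key : z ∈ (integralClosure (Subring.closure (R : Set L)) L).toSubring := by
    rw [← iInf_valuationSubring_superset, Subring.mem_iInf]
    rintro ⟨V, hV⟩
    have hRV : ∀ a ∈ R, a ∈ V := fun a ha => hV ha
    have hintV : ∀ R' : Subring L, R' ≤ V.toSubring → IsIntegral R' z → z ∈ V := by
      intro R' hR' hz
      have h3 : IsIntegral V.toSubring z := rrx_int_mono hR' hz
      have h4 : IsIntegral V z := h3
      obtain ⟨y, hy⟩ := IsIntegrallyClosed.isIntegral_iff.1 h4
      rw [← hy]; exact y.2
    by_cases hT : T ∈ V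
    · refine hintV R1 (h1.trans ?_) hz1
      rw [Subring.closure_le]
      rintro a (ha | rfl)
      · exact hRV a ha
      · exact hT
    · refine hintV R2 (h2.trans ?_) hz2
      have hvT : 1 < V.valuation T := by
        rw [← not_le, V.valuation_le_one_iff]; exact hT
      have hpT : V.valuation (p.eval T) = V.valuation T ^ p.natDegree := by
        have h5 : p.eval T = T ^ p.natDegree + ∑ i ∈ Finset.range p.natDegree, p.coeff i * T ^ i := by
          conv_lhs => rw [hp.as_sum]
          simp [Polynomial.eval_finsetSum]
        rw [h5, Valuation.map_add_eq_of_lt_left, map_pow]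
        rw [map_pow]
        apply Valuation.map_sum_lt
        · exact pow_ne_zero _ (ne_of_gt (lt_trans zero_lt_one hvT))
        · intro i hi
          rw [map_mul, map_pow]
          have h6 : V.valuation (p.coeff i) ≤ 1 := (V.valuation_le_one_iff _).2 (hRV _ (hpR i))
          calc V.valuation (p.coeff i) * V.valuation T ^ i ≤ 1 * V.valuation T ^ i :=
                mul_le_mul_left h6 _
            _ = V.valuation T ^ i := one_mul _
            _ < _ := pow_lt_pow_right₀ hvT (Finset.mem_range.1 hi)
      rw [Subring.closure_le]
      rintro a (ha | ⟨j, hj, rfl⟩)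
      · exact hRV a ha
      · change _ ∈ V
        rw [← V.valuation_le_one_iff, map_div₀, hpT, map_pow]
        apply div_le_one_of_le₀ _ zero_le
        exact pow_le_pow_right₀ hvT.le hj
  rw [Subring.closure_eq] at key
  exact key

/-- abstract data -/
structure RrxD (K P : Type*) [Field K] [CommRing P] [Algebra K P] (r : ℕ) (σ : Type*)
    [DecidableEq (Fin r)] where
  m : σ → P
  δ : (Fin r → σ) → K
  hC : ∀ (ι : Fin r → σ) (j : σ), δ ι • m j = ∑ k, δ (Function.update ι k j) • m (ι k)
  hI : ∀ ι : Fin r → σ, δ ι ≠ 0 → AlgebraicIndependent K (m ∘ ι)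

section free
variable {K : Type*} [Field K] {P : Type*} [CommRing P] [Algebra K P] {r : ℕ} {σ : Type*}
  (G : RrxD K P r σ)

theorem rrx_E_le_M (ι : Fin r → σ) : rrxM (G.m ∘ ι) ≤ rrxM G.m := by
  rw [rrxM, Submodule.span_le]
  rintro _ ⟨i, rfl⟩
  exact rrx_m_mem _ _

theorem rrx_m_eq (ι : Fin r → σ) (h0 : G.δ ι ≠ 0) (j : σ) :
    G.m j = ∑ k, algebraMap K P (G.δ (Function.update ι k j) / G.δ ι) * G.m (ι k) := by
  have := G.hC ι j
  have h2 : (G.δ ι)⁻¹ • (G.δ ι • G.m j) = G.m j := by rw [smul_smul, inv_mul_cancel₀ h0, one_smul]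
  rw [← h2, this, Finset.smul_sum]
  refine Finset.sum_congr rfl fun k _ => ?_
  rw [smul_smul, Algebra.smul_def, div_eq_inv_mul]

theorem rrx_M_le_E (B : Subring K) (ι : Fin r → σ) (h0 : G.δ ι ≠ 0)
    (h : ∀ ι', G.δ ι' / G.δ ι ∈ B) : rrxM G.m ≤ rrxLB P B * rrxM (G.m ∘ ι) := by
  rw [rrxM, Submodule.span_le]
  rintro _ ⟨j, rfl⟩
  rw [SetLike.mem_coe, rrx_m_eq G ι h0 j]
  exact Submodule.sum_mem _ fun k _ =>
    Submodule.mul_mem_mul (rrx_LB_mem (h _)) (rrx_m_mem (G.m ∘ ι) k)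

theorem rrx_RM_eq (B : Subring K) (ι : Fin r → σ) (h0 : G.δ ι ≠ 0)
    (h : ∀ ι', G.δ ι' / G.δ ι ∈ B) : rrxRM G.m B ≤ rrxRM (G.m ∘ ι) B := by
  rw [rrxRM, Subring.closure_le]
  rintro _ (⟨b, hb, rfl⟩ | ⟨j, rfl⟩)
  · exact rrx_RM_alg _ hb
  · rw [SetLike.mem_coe, rrx_m_eq G ι h0 j]
    exact Subring.sum_mem _ fun k _ =>
      Subring.mul_mem _ (rrx_RM_alg _ (h _)) (rrx_RM_m (G.m ∘ ι) B k)

theorem rrx_free_Cl (B : Subring K) (hB : ∀ z : K, IsIntegral B z → z ∈ B)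
    (ι : Fin r → σ) (h0 : G.δ ι ≠ 0)
    (h : ∀ ι', G.δ ι' / G.δ ι ∈ B) (n : ℕ) :
    rrxCl G.m B n ≤ rrxLB P B * rrxM (G.m ∘ ι) ^ n := by
  rintro z ⟨hz1, hz2⟩
  refine rrx_free_int (G.m ∘ ι) (G.hI ι h0) B hB n z ?_ (rrx_int_mono (rrx_RM_eq G B ι h0 h) hz2)
  have h1 := (rrx_M_le_E G B ι h0 h).trans (mul_le_mul_left (rrx_LB_mono le_top) _)
  have h2 := rrx_LB_pow h1 n
  have h3 := mul_le_mul_right h2 (rrxLB P (⊤ : Subring K))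
  rw [← mul_assoc, rrx_LB_mul_eq] at h3
  exact h3 hz1

theorem rrx_E_Cl (B : Subring K) (ι : Fin r → σ) (n : ℕ) :
    rrxLB P B * rrxM (G.m ∘ ι) ^ n ≤ rrxCl G.m B n :=
  (mul_le_mul_right (pow_le_pow_left' (rrx_E_le_M G ι) n) _).trans (rrx_LB_M_le_Cl G.m B n)

theorem rrx_free_step (B : Subring K) (ι : Fin r → σ) (n : ℕ) :
    rrxLB P B * rrxM (G.m ∘ ι) ^ (n+1) ≤ rrxM G.m * rrxCl G.m B n := by
  calc rrxLB P B * rrxM (G.m ∘ ι) ^ (n+1)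
      = rrxM (G.m ∘ ι) * (rrxLB P B * rrxM (G.m ∘ ι) ^ n) := by rw [pow_succ]; ring
    _ ≤ _ := mul_le_mul' (rrx_E_le_M G ι) (rrx_E_Cl G B ι n)

theorem rrx_free_K (B : Subring K) (hB : ∀ z : K, IsIntegral B z → z ∈ B)
    (ι : Fin r → σ) (h0 : G.δ ι ≠ 0)
    (h : ∀ ι', G.δ ι' / G.δ ι ∈ B) (n : ℕ) :
    rrxCl G.m B (n+1) ≤ rrxM G.m * rrxCl G.m B n :=
  (rrx_free_Cl G B hB ι h0 h (n+1)).trans (rrx_free_step G B ι n)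

end free



section ringD
variable {K : Type*} [Field K]

/-- evaluation at T -/
noncomputable def rrxEv (D : Subring K) (T : K) : Polynomial D →+* K :=
  Polynomial.eval₂RingHom D.subtype T

/-- D[T] -/
noncomputable def rrxD1 (D : Subring K) (T : K) : Subring K := (rrxEv D T).range

@[simp] theorem rrxEv_C (D : Subring K) (T : K) (a : D) : rrxEv D T (Polynomial.C a) = a := by
  simp [rrxEv]

@[simp] theorem rrxEv_X (D : Subring K) (T : K) : rrxEv D T Polynomial.X = T := by
  simp [rrxEv]

theorem rrxEv_mem (D : Subring K) (T : K) (q : Polynomial D) : rrxEv D T q ∈ rrxD1 D T := ⟨q, rfl⟩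

theorem rrx_D_le_D1 (D : Subring K) (T : K) : D ≤ rrxD1 D T :=
  fun a ha => ⟨Polynomial.C ⟨a, ha⟩, by simp⟩

theorem rrx_T_mem_D1 (D : Subring K) (T : K) : T ∈ rrxD1 D T := ⟨Polynomial.X, by simp⟩

theorem rrxEv_sum (D : Subring K) (T : K) (q : Polynomial D) (n : ℕ) (hn : q.natDegree < n) :
    rrxEv D T q = ∑ i ∈ Finset.range n, (q.coeff i : K) * T ^ i := by
  simp only [rrxEv, Polynomial.coe_eval₂RingHom]
  rw [Polynomial.eval₂_eq_sum_range' _ hn]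
  rfl

theorem rrx_D1_le (D R : Subring K) (T : K) (hD : D ≤ R) (hT : T ∈ R) : rrxD1 D T ≤ R := by
  rintro _ ⟨q, rfl⟩
  rw [rrxEv_sum D T q _ (Nat.lt_succ_self _)]
  exact Subring.sum_mem _ fun i _ => R.mul_mem (hD (q.coeff i).2) (R.pow_mem hT i)

theorem rrx_ne_zero_of_np (D : Subring K) [IsLocalRing D]
    (x y : D) (hxy : Ideal.span {x, y} = maximalIdeal D)
    (hnp : ¬ (maximalIdeal D).IsPrincipal) : (x : K) ≠ 0 := by
  intro h
  apply hnp
  have hx : x = 0 := Subtype.ext h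
  exact ⟨y, by rw [← hxy, hx, Ideal.span_insert, Ideal.span_singleton_zero, bot_sup_eq]⟩

theorem rrx_regseq (D : Subring K) [IsLocalRing D] (hDi : ∀ z : K, IsIntegral D z → z ∈ D)
    (x y : D) (hxy : Ideal.span {x, y} = maximalIdeal D)
    (hnp : ¬ (maximalIdeal D).IsPrincipal) (a b : D) (hab : a * y = b * x) : x ∣ a := by
  have hx0 := rrx_ne_zero_of_np D x y hxy hnp
  have hxm : x ∈ maximalIdeal D := by rw [← hxy]; exact Ideal.subset_span (by simp)
  have hym : y ∈ maximalIdeal D := by rw [← hxy]; exact Ideal.subset_span (by simp)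
  by_cases ha : IsUnit a
  · exfalso; apply hnp
    obtain ⟨u, rfl⟩ := ha
    have hy : y = (↑u⁻¹ * b) * x := by
      rw [mul_assoc, ← hab, ← mul_assoc, Units.inv_mul, one_mul]
    refine ⟨x, le_antisymm ?_ ((Ideal.span_singleton_le_iff_mem _).2 hxm)⟩
    rw [← hxy, Ideal.span_le]
    rintro z (rfl | rfl)
    · exact Ideal.mem_span_singleton_self z
    · rw [hy]; exact Ideal.mul_mem_left _ _ (Ideal.mem_span_singleton_self x)
  by_cases hb : IsUnit b
  · exfalso; apply hnp
    obtain ⟨u, rfl⟩ := hb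
    have hy : x = (↑u⁻¹ * a) * y := by
      rw [mul_assoc, hab, ← mul_assoc, Units.inv_mul, one_mul]
    refine ⟨y, le_antisymm ?_ ((Ideal.span_singleton_le_iff_mem _).2 hym)⟩
    rw [← hxy, Ideal.span_le]
    rintro z (rfl | rfl)
    · rw [hy]; exact Ideal.mul_mem_left _ _ (Ideal.mem_span_singleton_self y)
    · exact Ideal.mem_span_singleton_self z
  have ham : a ∈ maximalIdeal D := (mem_maximalIdeal a).2 ha
  have hbm : b ∈ maximalIdeal D := (mem_maximalIdeal b).2 hb
  set g : K := a / x with hg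
  have hgx : g * x = a := by rw [hg]; field_simp
  have hgy : g * y = b := by
    have : (a : K) * y = b * x := by exact_mod_cast congrArg Subtype.val hab
    rw [hg]; field_simp; rw [this, mul_comm]
  have key : IsIntegral D g := by
    have hmem : ∀ c ∈ maximalIdeal D, (c : K) ∈ Submodule.span D {(x : K), (y : K)} := by
      intro c hc
      rw [← hxy, Ideal.mem_span_pair] at hc
      obtain ⟨α, β, rfl⟩ := hc
      rw [Submodule.mem_span_pair]
      exact ⟨α, β, rfl⟩
    refine isIntegral_of_smul_mem_submodule (M := K) (Submodule.span D {(x : K), (y : K)}) ?_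
      (Submodule.fg_span (by simp)) g ?_
    · rw [Submodule.ne_bot_iff]
      exact ⟨x, Submodule.subset_span (by simp), hx0⟩
    · intro n hn
      rw [Submodule.mem_span_pair] at hn
      obtain ⟨α, β, rfl⟩ := hn
      have : g • (α • (x : K) + β • (y : K)) = ((α * a + β * b : D) : K) := by
        have h1 : α • (x : K) = α * x := rfl
        have h2 : β • (y : K) = β * y := rfl
        rw [h1, h2, smul_eq_mul]
        push_cast
        rw [← hgx, ← hgy]; ring
      rw [this]
      exact hmem _ (Ideal.add_mem _ (Ideal.mul_mem_left _ _ ham) (Ideal.mul_mem_left _ _ hbm))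
  refine ⟨⟨g, hDi g key⟩, ?_⟩
  apply Subtype.ext
  push_cast
  rw [← hgx, mul_comm]

theorem rrx_regseq_pow (D : Subring K) [IsLocalRing D] (hDi : ∀ z : K, IsIntegral D z → z ∈ D)
    (x y : D) (hxy : Ideal.span {x, y} = maximalIdeal D)
    (hnp : ¬ (maximalIdeal D).IsPrincipal) (n : ℕ) (a : D) (hab : x ∣ a * y ^ n) : x ∣ a := by
  induction n with
  | zero => simpa using hab
  | succ n ih =>
    apply ih
    obtain ⟨b, hb⟩ := hab
    exact rrx_regseq D hDi x y hxy hnp (a * y ^ n) b (by rw [mul_assoc, ← pow_succ, hb, mul_comm])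

/-- polynomials vanishing at y/x have coefficients in the maximal ideal -/
theorem rrx_ker_red (D : Subring K) [IsLocalRing D] (hDi : ∀ z : K, IsIntegral D z → z ∈ D)
    (x y : D) (hxy : Ideal.span {x, y} = maximalIdeal D)
    (hnp : ¬ (maximalIdeal D).IsPrincipal) (n : ℕ) : ∀ (W : Polynomial D), W.natDegree < n →
    rrxEv D ((y : K) / x) W = 0 → W.map (residue D) = 0 := by
  have hx0 := rrx_ne_zero_of_np D x y hxy hnp
  have hxm : x ∈ maximalIdeal D := by rw [← hxy]; exact Ideal.subset_span (by simp)
  have hym : y ∈ maximalIdeal D := by rw [← hxy]; exact Ideal.subset_span (by simp)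
  have hrx : residue D x = 0 := (residue_eq_zero_iff x).2 hxm
  have hry : residue D y = 0 := (residue_eq_zero_iff y).2 hym
  set T : K := (y : K) / x with hT
  have hTx : T * x = y := by rw [hT]; field_simp
  induction n with
  | zero => intro W h; omega
  | succ n ih =>
    intro W hW h0
    rcases Nat.eq_zero_or_pos n with rfl | hn
    · have hc := Polynomial.eq_C_of_natDegree_eq_zero (p := W) (by omega)
      rw [hc, rrxEv_C] at h0
      have : W.coeff 0 = 0 := Subtype.ext h0
      rw [hc, this]; simp
    have hdvd : x ∣ W.coeff n := by
      apply rrx_regseq_pow D hDi x y hxy hnp n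
      refine ⟨- ∑ i ∈ Finset.range n, W.coeff i * y ^ i * x ^ (n - 1 - i), ?_⟩
      apply Subtype.ext
      have h1 := rrxEv_sum D T W (n+1) hW
      rw [h0, Finset.sum_range_succ] at h1
      push_cast
      have h2 : ∀ i ∈ Finset.range n, (x : K) * ((W.coeff i : K) * (y : K) ^ i * (x : K) ^ (n - 1 - i))
          = ((W.coeff i : K) * T ^ i) * x ^ n := by
        intro i hi
        rw [Finset.mem_range] at hi
        obtain ⟨j, rfl⟩ : ∃ j, n = i + j + 1 := ⟨n - i - 1, by omega⟩
        rw [show i + j + 1 - 1 - i = j by omega, ← hTx]; ring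
      rw [mul_neg, Finset.mul_sum, Finset.sum_congr rfl h2, ← Finset.sum_mul]
      rw [← hTx]
      linear_combination (-(x:K) ^ n) * h1
    obtain ⟨c, hc⟩ := hdvd
    set W' := W - Polynomial.C (W.coeff n) * Polynomial.X ^ n +
      Polynomial.C (c * y) * Polynomial.X ^ (n-1) with hW'
    have hdeg : W'.natDegree < n := by
      have : W'.natDegree ≤ n - 1 := by
        rw [Polynomial.natDegree_le_iff_coeff_eq_zero]
        intro N hN
        rw [hW', Polynomial.coeff_add, Polynomial.coeff_sub, Polynomial.coeff_C_mul,
          Polynomial.coeff_C_mul, Polynomial.coeff_X_pow, Polynomial.coeff_X_pow,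
          if_neg (show N ≠ n - 1 by omega)]
        by_cases hNn : N = n
        · subst hNn; simp
        · rw [if_neg hNn, Polynomial.coeff_eq_zero_of_natDegree_lt (by omega)]; simp
      omega
    have hev : rrxEv D T W' = 0 := by
      rw [hW', map_add, map_sub, h0, map_mul, map_mul, map_pow, map_pow, rrxEv_C, rrxEv_C, rrxEv_X, hc]
      obtain ⟨j, rfl⟩ : ∃ j, n = j + 1 := ⟨n - 1, by omega⟩
      push_cast
      rw [← hTx]; ring
    have := ih W' hdeg hev
    rw [hW', Polynomial.map_add, Polynomial.map_sub, Polynomial.map_mul, Polynomial.map_mul,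
      Polynomial.map_C, Polynomial.map_C, hc, map_mul (residue D) x c, map_mul (residue D) c y, hrx, hry] at this
    simpa using this
end ringD



section ringD
variable {K : Type*} [Field K]

/-- bundled hypotheses on D, x, y -/
structure RrxG (D : Subring K) [IsLocalRing D] (x y : D) : Prop where
  hDi : ∀ z : K, IsIntegral D z → z ∈ D
  hxy : Ideal.span {x, y} = maximalIdeal D
  hnp : ¬ (maximalIdeal D).IsPrincipal

variable {D : Subring K} [IsLocalRing D] {x y : D}

theorem RrxG.symm (G : RrxG D x y) : RrxG D y x :=
  ⟨G.hDi, by rw [Set.pair_comm]; exact G.hxy, G.hnp⟩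

theorem RrxG.x0 (G : RrxG D x y) : (x : K) ≠ 0 := rrx_ne_zero_of_np D x y G.hxy G.hnp

theorem RrxG.xm (G : RrxG D x y) : x ∈ maximalIdeal D := by
  rw [← G.hxy]; exact Ideal.subset_span (by simp)

theorem RrxG.ym (G : RrxG D x y) : y ∈ maximalIdeal D := G.symm.xm

theorem RrxG.Tx (G : RrxG D x y) : (y : K) / x * x = y := by
  have := G.x0
  field_simp

theorem RrxG.red (G : RrxG D x y) (W : Polynomial D) (h : rrxEv D ((y : K) / x) W = 0) :
    W.map (residue D) = 0 :=
  rrx_ker_red D G.hDi x y G.hxy G.hnp _ W (Nat.lt_succ_self _) h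

theorem RrxG.dvd_of_red (G : RrxG D x y) (W : Polynomial D) (h : W.map (residue D) = 0) :
    ∃ q : Polynomial D, q.natDegree ≤ W.natDegree + 1 ∧
      rrxEv D ((y : K) / x) W = x * rrxEv D ((y : K) / x) q := by
  have hc : ∀ i, ∃ α β : D, W.coeff i = α * x + β * y := by
    intro i
    have h1 : W.coeff i ∈ maximalIdeal D := by
      rw [← residue_eq_zero_iff, ← Polynomial.coeff_map, h, Polynomial.coeff_zero]
    rw [← G.hxy, Ideal.mem_span_pair] at h1
    obtain ⟨α, β, h⟩ := h1
    exact ⟨α, β, h.symm⟩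
  choose α β hαβ using hc
  refine ⟨∑ i ∈ Finset.range (W.natDegree + 1), (Polynomial.C (α i) + Polynomial.C (β i) *
    Polynomial.X) * Polynomial.X ^ i, ?_, ?_⟩
  · apply Polynomial.natDegree_sum_le_of_forall_le
    intro i hi
    rw [Finset.mem_range] at hi
    refine Polynomial.natDegree_mul_le.trans ?_
    have h1 : (Polynomial.C (α i) + Polynomial.C (β i) * Polynomial.X).natDegree ≤ 1 := by
      compute_degree
    have h2 : ((Polynomial.X : Polynomial D) ^ i).natDegree ≤ i := Polynomial.natDegree_X_pow_le i
    omega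
  · rw [rrxEv_sum D _ W _ (Nat.lt_succ_self _), map_sum, Finset.mul_sum]
    refine Finset.sum_congr rfl fun i _ => ?_
    rw [map_mul, map_add, map_mul, map_pow, rrxEv_C, rrxEv_C, rrxEv_X, hαβ]
    push_cast
    have := G.Tx
    linear_combination (-(β i : K) * ((y : K) / x) ^ i) * this

theorem RrxG.red_of_dvd (G : RrxG D x y) (W : Polynomial D) (w : K)
    (hw : w ∈ rrxD1 D ((y : K) / x)) (h : rrxEv D ((y : K) / x) W = x * w) :
    W.map (residue D) = 0 := by
  obtain ⟨q, rfl⟩ := hw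
  have := G.red (W - Polynomial.C x * q) (by rw [map_sub, map_mul, rrxEv_C, h, sub_self])
  rw [Polynomial.map_sub, Polynomial.map_mul, Polynomial.map_C, (residue_eq_zero_iff x).2 G.xm] at this
  simpa using this

/-- x is prime in D1 (power version) -/
theorem RrxG.pow_dvd (G : RrxG D x y) (g w : K) (hg : g ∈ rrxD1 D ((y : K) / x))
    (hw : w ∈ rrxD1 D ((y : K) / x)) (n : ℕ) (h : g ^ n = x * w) :
    ∃ w' ∈ rrxD1 D ((y : K) / x), g = x * w' := by
  obtain ⟨q, rfl⟩ := hg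
  have h1 := G.red_of_dvd (q ^ n) w hw (by rw [map_pow, h])
  rw [Polynomial.map_pow] at h1
  obtain ⟨q', -, hq'⟩ := G.dvd_of_red q (eq_zero_of_pow_eq_zero h1)
  exact ⟨_, rrxEv_mem _ _ q', hq'⟩

theorem RrxG.pow_mul_mem (G : RrxG D x y) (c : K) (hc : c ∈ rrxD1 D ((y : K) / x)) :
    ∃ n : ℕ, (x : K) ^ n * c ∈ D := by
  obtain ⟨q, rfl⟩ := hc
  refine ⟨q.natDegree, ?_⟩
  rw [rrxEv_sum D _ q _ (Nat.lt_succ_self _), Finset.mul_sum]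
  refine Subring.sum_mem _ fun i hi => ?_
  rw [Finset.mem_range] at hi
  obtain ⟨j, hj⟩ : ∃ j, q.natDegree = i + j := ⟨q.natDegree - i, by omega⟩
  have : (x : K) ^ q.natDegree * ((q.coeff i : K) * ((y : K) / x) ^ i) =
      q.coeff i * y ^ i * x ^ j := by
    have := G.x0
    rw [hj, div_pow]; field_simp; ring
  rw [this]
  exact D.mul_mem (D.mul_mem (q.coeff i).2 (D.pow_mem y.2 _)) (D.pow_mem x.2 _)

theorem RrxG.D1_step (G : RrxG D x y) (f : K) (hf : IsIntegral (rrxD1 D ((y : K) / x)) f)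
    (hx : (x : K) * f ∈ rrxD1 D ((y : K) / x)) : f ∈ rrxD1 D ((y : K) / x) := by
  set D1 := rrxD1 D ((y : K) / x) with hD1
  obtain ⟨p, hp, he⟩ := hf
  have hx1 : (x : K) ∈ D1 := rrx_D_le_D1 D _ x.2
  have h1 : f ^ p.natDegree + ∑ i ∈ Finset.range p.natDegree, (p.coeff i : K) * f ^ i = 0 := by
    rw [hp.as_sum] at he
    simp only [Polynomial.eval₂_add, Polynomial.eval₂_X_pow, Polynomial.eval₂_finsetSum,
      Polynomial.eval₂_mul, Polynomial.eval₂_C] at he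
    exact he
  obtain ⟨w', hw', hfw⟩ := G.pow_dvd (x * f) (-∑ i ∈ Finset.range p.natDegree,
      (p.coeff i : K) * (x * f) ^ i * x ^ (p.natDegree - 1 - i)) hx
    (D1.neg_mem (Subring.sum_mem _ fun i _ => D1.mul_mem (D1.mul_mem (p.coeff i).2
      (D1.pow_mem hx i)) (D1.pow_mem hx1 _))) p.natDegree (by
    have h2 : ∀ i ∈ Finset.range p.natDegree, (x : K) * ((p.coeff i : K) * (x * f) ^ i *
        x ^ (p.natDegree - 1 - i)) = x ^ p.natDegree * ((p.coeff i : K) * f ^ i) := by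
      intro i hi
      rw [Finset.mem_range] at hi
      obtain ⟨j, hj⟩ : ∃ j, p.natDegree = i + j + 1 := ⟨p.natDegree - i - 1, by omega⟩
      rw [hj, show i + j + 1 - 1 - i = j by omega]; ring
    rw [mul_neg, Finset.mul_sum, Finset.sum_congr rfl h2, ← Finset.mul_sum]
    linear_combination ((x:K) ^ p.natDegree) * h1)
  have : f = w' := mul_left_cancel₀ G.x0 hfw
  rw [this]; exact hw'

theorem RrxG.D1_int (G : RrxG D x y) (f : K) (hf : IsIntegral (rrxD1 D ((y : K) / x)) f) :
    f ∈ rrxD1 D ((y : K) / x) := by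
  obtain ⟨s, ⟨n, rfl⟩, hs⟩ := rrx_den D (rrxD1 D ((y : K) / x)) (Submonoid.powers (x : K))
    (by rintro _ ⟨n, rfl⟩; exact D.pow_mem x.2 n)
    (fun c hc => by
      obtain ⟨n, hn⟩ := G.pow_mul_mem c hc
      exact ⟨x ^ n, ⟨n, rfl⟩, hn⟩) hf
  have h1 : (x : K) ^ n * f ∈ rrxD1 D ((y : K) / x) := rrx_D_le_D1 D _ (G.hDi _ hs)
  clear hs
  induction n with
  | zero => simpa using h1
  | succ n ih =>
    apply ih
    apply G.D1_step
    · exact (rrx_int_mem ((rrxD1 D ((y : K) / x)).pow_mem (rrx_D_le_D1 D _ x.2) n)).mul hf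
    · rw [← mul_assoc, ← pow_succ']; exact h1

/-- elements of powers of the maximal ideal -/
theorem RrxG.mem_pow (G : RrxG D x y) (e : ℕ) (c : D) : c ∈ maximalIdeal D ^ e ↔
    ∃ q : Polynomial D, q.natDegree ≤ e ∧ (c : K) = x ^ e * rrxEv D ((y : K) / x) q := by
  constructor
  · revert c
    induction e with
    | zero =>
      intro c _
      exact ⟨Polynomial.C c, by simp, by simp⟩
    | succ e ih =>
      intro c hc
      rw [pow_succ] at hc
      refine Submodule.mul_induction_on hc ?_ ?_
      · intro a ha b hb
        obtain ⟨q, hq, hqe⟩ := ih a ha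
        rw [← G.hxy, Ideal.mem_span_pair] at hb
        obtain ⟨α, β, rfl⟩ := hb
        refine ⟨q * (Polynomial.C α + Polynomial.C β * Polynomial.X), ?_, ?_⟩
        · refine Polynomial.natDegree_mul_le.trans (add_le_add hq ?_)
          compute_degree
        · push_cast
          rw [hqe, map_mul, map_add, map_mul, rrxEv_C, rrxEv_C, rrxEv_X]
          have := G.Tx
          linear_combination (-(x:K) ^ e * rrxEv D ((y : K) / x) q * β) * this
      · rintro a b ⟨q, hq, hqe⟩ ⟨q', hq', hqe'⟩
        refine ⟨q + q', Polynomial.natDegree_add_le_of_degree_le hq hq', ?_⟩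
        push_cast
        rw [hqe, hqe', map_add]; ring
  · rintro ⟨q, hq, hqe⟩
    have : c = ∑ i ∈ Finset.range (e+1), q.coeff i * (y ^ i * x ^ (e - i)) := by
      apply Subtype.ext
      rw [hqe, rrxEv_sum D _ q (e+1) (by omega), Finset.mul_sum]
      push_cast
      refine Finset.sum_congr rfl fun i hi => ?_
      rw [Finset.mem_range] at hi
      obtain ⟨j, rfl⟩ : ∃ j, e = i + j := ⟨e - i, by omega⟩
      have := G.x0
      rw [show i + j - i = j by omega, div_pow]; field_simp; ring
    rw [this]
    refine Ideal.sum_mem _ fun i hi => Ideal.mul_mem_left _ _ ?_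
    rw [Finset.mem_range] at hi
    have h3 : e = i + (e - i) := by omega
    have h4 := Ideal.mul_mem_mul (Ideal.pow_mem_pow G.ym i) (Ideal.pow_mem_pow G.xm (e - i))
    rwa [← pow_add, ← h3] at h4

/-- if c = x^e q(T) with q of degree ≤ e and zero reduction then c ∈ 𝔪^(e+1) -/
theorem RrxG.mem_pow_succ (G : RrxG D x y) (e : ℕ) (c : D) (q : Polynomial D) (hq : q.natDegree ≤ e)
    (hc : (c : K) = x ^ e * rrxEv D ((y : K) / x) q) (h : q.map (residue D) = 0) :
    c ∈ maximalIdeal D ^ (e+1) := by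
  rw [G.mem_pow]
  obtain ⟨q', hq', h'⟩ := G.dvd_of_red q h
  refine ⟨q', by omega, ?_⟩
  rw [hc, h']; ring

/-- maximal ideals of D1 containing x are generated by two elements -/
theorem RrxG.two_gen (G : RrxG D x y) (n : Ideal (rrxD1 D ((y : K) / x)))
    (hx : (⟨x, rrx_D_le_D1 D _ x.2⟩ : rrxD1 D ((y : K) / x)) ∈ n) :
    ∃ g : rrxD1 D ((y : K) / x), n = Ideal.span {⟨x, rrx_D_le_D1 D _ x.2⟩, g} := by
  set φ : Polynomial D →+* rrxD1 D ((y : K) / x) := (rrxEv D ((y : K) / x)).rangeRestrict with hφ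
  have hφs : Function.Surjective φ := (rrxEv D ((y : K) / x)).rangeRestrict_surjective
  set J := n.comap φ
  set ρ := Polynomial.mapRingHom (residue D)
  have hρs : Function.Surjective ρ := Polynomial.map_surjective _ residue_surjective
  obtain ⟨g0, hg0⟩ := (IsPrincipalIdealRing.principal (J.map ρ)).principal
  have hg0m : g0 ∈ J.map ρ := by rw [hg0]; exact Ideal.mem_span_singleton_self g0
  rw [Ideal.mem_map_iff_of_surjective _ hρs] at hg0m
  obtain ⟨g, hgJ, rfl⟩ := hg0m
  refine ⟨φ g, le_antisymm ?_ ?_⟩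
  · intro w hw
    obtain ⟨q, rfl⟩ := hφs w
    have hq : ρ q ∈ J.map ρ := Ideal.mem_map_of_mem _ hw
    rw [hg0] at hq
    obtain ⟨c, hc⟩ := Ideal.mem_span_singleton'.1 hq
    obtain ⟨c, rfl⟩ := hρs c
    have h0 : (q - c * g).map (residue D) = 0 := by
      change ρ (q - c * g) = 0
      rw [map_sub, map_mul, hc, sub_self]
    obtain ⟨q', -, hq'⟩ := G.dvd_of_red _ h0
    rw [Ideal.mem_span_pair]
    refine ⟨φ q', φ c, ?_⟩
    apply Subtype.ext
    change rrxEv D ((y : K) / x) q' * x + rrxEv D ((y : K) / x) c * rrxEv D ((y : K) / x) g = rrxEv D ((y : K) / x) q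
    rw [map_sub, map_mul] at hq'
    linear_combination -hq'
  · rw [Ideal.span_le]
    rintro z (rfl | rfl)
    · exact hx
    · exact hgJ
end ringD



section ringD
variable {K : Type*} [Field K]
variable {D : Subring K} [IsLocalRing D] {x y : D}

theorem RrxG.change (G : RrxG D x y) (Λ : Set K) (hΛi : Λ.Infinite) (hΛ : ∀ a ∈ Λ, a ∈ D)
    (hΛ' : ∀ a ∈ Λ, ∀ b ∈ Λ, a ≠ b → (a - b)⁻¹ ∈ D) (d : ℕ) (h : D) (hd : h ∈ maximalIdeal D ^ d)
    (hd' : h ∉ maximalIdeal D ^ (d+1)) :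
    ∃ x' : D, RrxG D x' y ∧ ∃ p : Polynomial D, p.Monic ∧ p.natDegree = d ∧ ∃ u : Dˣ,
      (h : K) = ((u : D) : K) * x' ^ d * rrxEv D ((y : K) / x') p := by
  obtain ⟨q, hq, hqe⟩ := (G.symm.mem_pow d h).1 hd
  have hq0 : q.map (residue D) ≠ 0 := fun h0 => hd' (G.symm.mem_pow_succ d h q hq hqe h0)
  -- choose λ
  obtain ⟨l, hl, hlu⟩ : ∃ l : D, (l : K) ∈ Λ ∧ IsUnit (q.eval l) := by
    by_contra hcon
    push Not at hcon
    let f : Λ → ResidueField D := fun a => residue D ⟨a, hΛ a a.2⟩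
    have hf : Function.Injective f := by
      intro a b hab
      by_contra hne
      have hne' : (a : K) ≠ b := fun h => hne (Subtype.ext h)
      have h1 : residue D (⟨a, hΛ a a.2⟩ - ⟨b, hΛ b b.2⟩) = 0 := by
        rw [map_sub, sub_eq_zero]; exact hab
      rw [residue_eq_zero_iff, mem_maximalIdeal] at h1
      apply h1
      refine IsUnit.of_mul_eq_one ⟨_, hΛ' a a.2 b b.2 hne'⟩ ?_
      apply Subtype.ext
      exact mul_inv_cancel₀ (sub_ne_zero.2 hne')
    have hinf : Infinite Λ := hΛi.to_subtype
    have hfin : (Set.range f).Finite := by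
      refine Set.Finite.subset ((q.map (residue D)).rootSet_finite (ResidueField D)) ?_
      rintro _ ⟨a, rfl⟩
      rw [Polynomial.mem_rootSet]
      refine ⟨hq0, ?_⟩
      rw [Polynomial.coe_aeval_eq_eval, Polynomial.eval_map, Polynomial.eval₂_at_apply,
        residue_eq_zero_iff, mem_maximalIdeal]
      exact hcon _ a.2
    exact (Set.infinite_range_of_injective hf) hfin
  have hspan : Ideal.span {x - l * y, y} = maximalIdeal D := by
    rw [← G.hxy]
    apply le_antisymm
    · rw [Ideal.span_le]
      rintro z (rfl | rfl)
      · exact Ideal.sub_mem _ (Ideal.subset_span (by simp))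
          (Ideal.mul_mem_left _ _ (Ideal.subset_span (by simp)))
      · exact Ideal.subset_span (by simp)
    · rw [Ideal.span_le]
      rintro z (rfl | rfl)
      · rw [SetLike.mem_coe, Ideal.mem_span_pair]
        exact ⟨1, l, by ring⟩
      · exact Ideal.subset_span (by simp)
  have G' : RrxG D (x - l * y) y := ⟨G.hDi, hspan, G.hnp⟩
  refine ⟨x - l * y, G', ?_⟩
  obtain ⟨u, hu⟩ := hlu
  set x' := x - l * y with hx'
  set q2 := Polynomial.taylor l q with hq2
  have hq2c : q2.coeff 0 = u := by rw [hq2, Polynomial.taylor_coeff_zero, hu]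
  have hq2d : q2.natDegree ≤ d := by rw [hq2, Polynomial.natDegree_taylor]; exact hq
  set q3 := Polynomial.reflect d q2 with hq3
  have hq3c : q3.coeff d = u := by
    rw [hq3, Polynomial.coeff_reflect, Polynomial.revAt_le le_rfl, Nat.sub_self, hq2c]
  have hq3d : q3.natDegree ≤ d := by
    rw [Polynomial.natDegree_le_iff_coeff_eq_zero]
    intro N hN
    rw [hq3, Polynomial.coeff_reflect, Polynomial.revAt_eq_self_of_lt hN,
      Polynomial.coeff_eq_zero_of_natDegree_lt (by omega)]
  have hy0 : (y : K) ≠ 0 := G.symm.x0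
  have hx0 : (x' : K) ≠ 0 := G'.x0
  -- evaluation
  have hev1 : rrxEv D ((x : K) / y) q = rrxEv D ((x' : K) / y) q2 := by
    rw [hq2, Polynomial.taylor_apply, rrxEv, rrxEv, Polynomial.coe_eval₂RingHom,
      Polynomial.coe_eval₂RingHom, Polynomial.eval₂_comp]
    congr 1
    simp [hx']
    field_simp
    ring
  have hev2 : rrxEv D ((x' : K) / y) q2 = rrxEv D ((y : K) / x') q3 * ((x' : K) / y) ^ d := by
    have hne : (x' : K) / y ≠ 0 := div_ne_zero hx0 hy0
    let _ : Invertible ((x' : K) / y) := invertibleOfNonzero hne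
    have := Polynomial.eval₂_reflect_mul_pow D.subtype ((x' : K) / y) d q2 hq2d
    rw [invOf_eq_inv, inv_div] at this
    exact this.symm
  refine ⟨Polynomial.C (↑u⁻¹ : D) * q3, ?_, ?_, u, ?_⟩
  · apply Polynomial.monic_of_natDegree_le_of_coeff_eq_one d
    · exact (Polynomial.natDegree_C_mul_le _ _).trans hq3d
    · rw [Polynomial.coeff_C_mul, hq3c, Units.inv_mul]
  · apply Polynomial.natDegree_eq_of_le_of_coeff_ne_zero
    · exact (Polynomial.natDegree_C_mul_le _ _).trans hq3d
    · rw [Polynomial.coeff_C_mul, hq3c, Units.inv_mul]; exact one_ne_zero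
  · rw [map_mul, rrxEv_C, hqe, hev1, hev2]
    have h1 : ((u : D) : K) * ((↑u⁻¹ : D) : K) = 1 := by
      rw [← Subring.coe_mul, Units.mul_inv, Subring.coe_one]
    have h2 : ((x' : K) / y) ^ d * y ^ d = x' ^ d := by
      rw [← mul_pow, div_mul_cancel₀ _ hy0]
    linear_combination (rrxEv D ((y : K) / x') q3) * h2 -
      (x' : K) ^ d * (rrxEv D ((y : K) / x') q3) * h1

/-- D[T][1/p(T)] -/
noncomputable def rrxD12 (D : Subring K) (T : K) (p : Polynomial D) : Subring K where
  carrier := {w | ∃ k : ℕ, rrxEv D T p ^ k * w ∈ rrxD1 D T}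
  mul_mem' := by
    rintro a b ⟨k, hk⟩ ⟨l, hl⟩
    refine ⟨k + l, ?_⟩
    have := (rrxD1 D T).mul_mem hk hl
    rwa [show rrxEv D T p ^ k * a * (rrxEv D T p ^ l * b) = rrxEv D T p ^ (k + l) * (a * b) by
      ring] at this
  one_mem' := ⟨0, by simp⟩
  add_mem' := by
    rintro a b ⟨k, hk⟩ ⟨l, hl⟩
    refine ⟨k + l, ?_⟩
    have h1 := (rrxD1 D T).mul_mem ((rrxD1 D T).pow_mem (rrxEv_mem D T p) l) hk
    have h2 := (rrxD1 D T).mul_mem ((rrxD1 D T).pow_mem (rrxEv_mem D T p) k) hl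
    have := (rrxD1 D T).add_mem h1 h2
    rwa [show rrxEv D T p ^ l * (rrxEv D T p ^ k * a) + rrxEv D T p ^ k * (rrxEv D T p ^ l * b)
      = rrxEv D T p ^ (k + l) * (a + b) by ring] at this
  zero_mem' := ⟨0, by simp⟩
  neg_mem' := by
    rintro a ⟨k, hk⟩
    exact ⟨k, by rw [mul_neg]; exact (rrxD1 D T).neg_mem hk⟩

/-- D[T^j/p(T)] -/
noncomputable def rrxC (D : Subring K) (T : K) (p : Polynomial D) : Subring K :=
  Subring.closure ((D : Set K) ∪ {w | ∃ j ≤ p.natDegree, w = T ^ j / rrxEv D T p})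

theorem rrx_D_le_C (D : Subring K) (T : K) (p : Polynomial D) : D ≤ rrxC D T p :=
  fun _ ha => Subring.subset_closure (Or.inl ha)

theorem rrx_D1_le_D12 (D : Subring K) (T : K) (p : Polynomial D) : rrxD1 D T ≤ rrxD12 D T p :=
  fun _ ha => ⟨0, by simpa using ha⟩

theorem rrx_C_le_D12 (D : Subring K) (T : K) (p : Polynomial D) (hp : rrxEv D T p ≠ 0) :
    rrxC D T p ≤ rrxD12 D T p := by
  rw [rrxC, Subring.closure_le]
  rintro a (ha | ⟨j, hj, rfl⟩)
  · exact rrx_D1_le_D12 D T p (rrx_D_le_D1 D T ha)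
  · refine ⟨1, ?_⟩
    rw [pow_one, mul_div_cancel₀ _ hp]
    exact (rrxD1 D T).pow_mem (rrx_T_mem_D1 D T) j

theorem rrx_div_mem_C (D : Subring K) (T : K) (p : Polynomial D) (q : Polynomial D)
    (hq : q.natDegree ≤ p.natDegree) : rrxEv D T q / rrxEv D T p ∈ rrxC D T p := by
  rw [rrxEv_sum D T q (p.natDegree + 1) (by omega), Finset.sum_div]
  refine Subring.sum_mem _ fun i hi => ?_
  rw [Finset.mem_range] at hi
  rw [mul_div_assoc]
  exact Subring.mul_mem _ (rrx_D_le_C D T p (q.coeff i).2)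
    (Subring.subset_closure (Or.inr ⟨i, by omega, rfl⟩))

theorem RrxG.D12_int (G : RrxG D x y) (p : Polynomial D) (f : K)
    (hf : IsIntegral (rrxD12 D ((y : K) / x) p) f) : f ∈ rrxD12 D ((y : K) / x) p := by
  obtain ⟨s, ⟨n, rfl⟩, hs⟩ := rrx_den (rrxD1 D ((y : K) / x)) (rrxD12 D ((y : K) / x) p)
    (Submonoid.powers (rrxEv D ((y : K) / x) p))
    (by rintro _ ⟨n, rfl⟩; exact Subring.pow_mem _ (rrxEv_mem _ _ p) n)
    (fun c hc => by
      obtain ⟨n, hn⟩ := hc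
      exact ⟨_, ⟨n, rfl⟩, hn⟩) hf
  exact ⟨n, G.D1_int _ hs⟩

theorem rrx_D12_add (D : Subring K) (T : K) (p : Polynomial D) (hp : p.Monic)
    (hp0 : rrxEv D T p ≠ 0) (w : K) (hw : w ∈ rrxD12 D T p) :
    ∃ a ∈ rrxD1 D T, ∃ b ∈ rrxC D T p, w = a + b := by
  obtain ⟨k, q, hk⟩ := hw
  induction k generalizing w q with
  | zero =>
    refine ⟨w, ⟨q, by rw [hk, pow_zero, one_mul]⟩, 0, Subring.zero_mem _, by simp⟩
  | succ k ih =>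
    set s := q /ₘ p
    set t := q %ₘ p with ht
    have hqst : t + p * s = q := Polynomial.modByMonic_add_div q p
    have ht' : t.natDegree ≤ p.natDegree := Polynomial.natDegree_modByMonic_le q hp
    obtain ⟨a, ha, b, hb, hab⟩ := ih (rrxEv D T s / rrxEv D T p ^ k) s (by
      rw [mul_div_cancel₀ _ (pow_ne_zero _ hp0)])
    have h1 : (1 : K) / rrxEv D T p ∈ rrxC D T p := by
      have := rrx_div_mem_C D T p 1 (by simp)
      simpa using this
    refine ⟨a, ha, b + rrxEv D T t / rrxEv D T p * (1 / rrxEv D T p) ^ k,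
      Subring.add_mem _ hb (Subring.mul_mem _ (rrx_div_mem_C D T p t ht') (Subring.pow_mem _ h1 k)),
      ?_⟩
    rw [← add_assoc, ← hab]
    have h2 : rrxEv D T p ^ (k+1) * w = rrxEv D T t + rrxEv D T p * rrxEv D T s := by
      rw [← hk, ← hqst, map_add, map_mul]
    have h3 : w = (rrxEv D T t + rrxEv D T p * rrxEv D T s) / rrxEv D T p ^ (k+1) := by
      rw [← h2, mul_div_cancel_left₀ _ (pow_ne_zero _ hp0)]
    rw [h3, pow_succ, one_div, inv_pow]
    field_simp
    ring

theorem RrxG.inter (G : RrxG D x y) (p : Polynomial D) (hp : p.Monic) (z : K)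
    (h1 : z ∈ rrxD1 D ((y : K) / x)) (h2 : z ∈ rrxIC (rrxC D ((y : K) / x) p)) : z ∈ D := by
  apply G.hDi
  have hev : (p.map D.subtype).eval ((y : K) / x) = rrxEv D ((y : K) / x) p := by
    rw [Polynomial.eval_map]; rfl
  refine rrx_val D (rrxD1 D ((y : K) / x)) (rrxC D ((y : K) / x) p) ((y : K) / x)
    (p.map D.subtype) (hp.map _) ?_ ?_ ?_ (rrx_int_mem h1) h2
  · intro i; rw [Polynomial.coeff_map]; exact (p.coeff i).2
  · exact rrx_D1_le _ _ _ (fun a ha => Subring.subset_closure (Or.inl ha))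
      (Subring.subset_closure (Or.inr rfl))
  · rw [hev, hp.natDegree_map]; exact le_rfl
end ringD



theorem rrx_int_map {S L : Type*} [CommRing S] [CommRing L] (φ : S →+* L) (R : Subring S) {z : S}
    (hz : IsIntegral R z) : IsIntegral (R.map φ) (φ z) := by
  have h1 : ((φ.comp R.subtype)).IsIntegralElem (φ z) := by
    obtain ⟨p, hp, he⟩ := hz
    refine ⟨p, hp, ?_⟩
    have := congrArg φ he
    rw [map_zero, Polynomial.hom_eval₂] at this
    exact this
  exact rrx_intElem_of_range_le (φ.comp R.subtype) (R.map φ).subtype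
    (fun a => ⟨⟨φ a, ⟨a, a.2, rfl⟩⟩, rfl⟩) h1

theorem rrx_int_of_map {S L : Type*} [CommRing S] [CommRing L] (φ : S →+* L)
    (hφ : Function.Injective φ) (R : Subring S) {z : S}
    (hz : IsIntegral (R.map φ) (φ z)) : IsIntegral R z := by
  have h1 : ((φ.comp R.subtype)).IsIntegralElem (φ z) :=
    rrx_intElem_of_range_le (R.map φ).subtype (φ.comp R.subtype)
      (by rintro ⟨_, a, ha, rfl⟩; exact ⟨⟨a, ha⟩, rfl⟩) hz
  obtain ⟨p, hp, he⟩ := h1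
  refine ⟨p, hp, hφ ?_⟩
  rw [map_zero, Polynomial.hom_eval₂]
  exact he

section concl
variable {K : Type*} [Field K] {P : Type*} [CommRing P] [IsDomain P] [Algebra K P] {r : ℕ}
  {σ : Type*}

theorem rrx_RM_map_le (m : σ → P) (B : Subring K) {L : Type*} [CommRing L] (φ : P →+* L)
    (Q : Subring L) (h1 : ∀ b ∈ B, φ (algebraMap K P b) ∈ Q) (h2 : ∀ j, φ (m j) ∈ Q) :
    (rrxRM m B).map φ ≤ Q := by
  rw [Subring.map_le_iff_le_comap, rrxRM, Subring.closure_le]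
  rintro _ (⟨b, hb, rfl⟩ | ⟨j, rfl⟩)
  · exact h1 b hb
  · exact h2 j

theorem rrx_Cl_val (m : σ → P) (D : Subring K) (T : K) (p : Polynomial D) (hp : p.Monic)
    (n : ℕ) (z : P) (h1 : z ∈ rrxCl m (rrxD1 D T) n) (h2 : z ∈ rrxCl m (rrxC D T p) n) :
    z ∈ rrxCl m D n := by
  refine ⟨h1.1, ?_⟩
  let L := FractionRing P
  let φ : P →+* L := algebraMap P L
  have hφ : Function.Injective φ := IsFractionRing.injective P L
  let ψ : K →+* L := φ.comp (algebraMap K P)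
  apply rrx_int_of_map φ hφ
  have hDR : ∀ b ∈ D, ψ b ∈ (rrxRM m D).map φ := fun b hb => ⟨_, rrx_RM_alg m hb, rfl⟩
  have hmR : ∀ j, φ (m j) ∈ (rrxRM m D).map φ := fun j => ⟨_, rrx_RM_m m D j, rfl⟩
  have hev : (p.map (ψ.comp D.subtype)).eval (ψ T) = ψ (rrxEv D T p) := by
    rw [Polynomial.eval_map, rrxEv, Polynomial.coe_eval₂RingHom, Polynomial.hom_eval₂]
  refine rrx_val ((rrxRM m D).map φ) ((rrxRM m (rrxD1 D T)).map φ) ((rrxRM m (rrxC D T p)).map φ)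
    (ψ T) (p.map (ψ.comp D.subtype)) (hp.map _) ?_ ?_ ?_ (rrx_int_map φ _ h1.2)
    (rrx_int_map φ _ h2.2)
  · intro i; rw [Polynomial.coeff_map]; exact hDR _ (p.coeff i).2
  · refine rrx_RM_map_le m _ φ _ ?_ (fun j => Subring.subset_closure (Or.inl (hmR j)))
    intro b hb
    change b ∈ (Subring.closure _).comap ψ
    revert b
    refine rrx_D1_le D _ T (fun a ha => Subring.subset_closure (Or.inl (hDR a ha)))
      (Subring.subset_closure (Or.inr rfl))
  · refine rrx_RM_map_le m _ φ _ ?_ (fun j => Subring.subset_closure (Or.inl (hmR j)))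
    intro b hb
    change b ∈ (Subring.closure _).comap ψ
    revert b
    change rrxC D T p ≤ _
    rw [rrxC, Subring.closure_le]
    rintro a (ha | ⟨j, hj, rfl⟩)
    · exact Subring.subset_closure (Or.inl (hDR a ha))
    · refine Subring.subset_closure (Or.inr ⟨j, by rwa [hp.natDegree_map], ?_⟩)
      rw [hev, map_div₀, map_pow]

variable {D : Subring K} [IsLocalRing D] {x y : D}

theorem RrxG.ev_ne (Gd : RrxG D x y) (p : Polynomial D) (hp : p.Monic) :
    rrxEv D ((y : K) / x) p ≠ 0 := by
  intro h
  have := Gd.red p h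
  exact (hp.map (residue D)).ne_zero this

theorem RrxG.ClD1 (Gd : RrxG D x y) (G : RrxD K P r σ) (p : Polynomial D) (hp : p.Monic)
    (ι : Fin r → σ) (h0 : G.δ ι ≠ 0) (h : ∀ ι', G.δ ι' / G.δ ι ∈ rrxC D ((y : K) / x) p) (n : ℕ) :
    rrxCl G.m (rrxD1 D ((y : K) / x)) n ≤
      rrxLB P (rrxD1 D ((y : K) / x)) * rrxM (G.m ∘ ι) ^ n ⊔ rrxCl G.m D n := by
  intro w hw
  have hp0 := Gd.ev_ne p hp
  have h1 := rrx_Cl_mono G.m (rrx_D1_le_D12 D ((y : K) / x) p) n hw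
  have h2 := rrx_free_Cl G _ (Gd.D12_int p) ι h0
    (fun ι' => rrx_C_le_D12 D _ p hp0 (h ι')) n h1
  have h3 : rrxLB P (rrxD12 D ((y : K) / x) p) ≤
      rrxLB P (rrxD1 D ((y : K) / x)) ⊔ rrxLB P (rrxC D ((y : K) / x) p) := by
    rintro _ ⟨c, hc, rfl⟩
    obtain ⟨a, ha, b, hb, rfl⟩ := rrx_D12_add D _ p hp hp0 c hc
    change algebraMap K P (a + b) ∈ _
    rw [map_add]
    exact Submodule.add_mem_sup (rrx_LB_mem ha) (rrx_LB_mem hb)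
  have h4 := mul_le_mul_left h3 (rrxM (G.m ∘ ι) ^ n) h2
  rw [Submodule.sup_mul] at h4
  obtain ⟨a, ha, b, hb, hab⟩ := Submodule.mem_sup.1 h4
  rw [← hab]
  refine Submodule.add_mem_sup ha (rrx_Cl_val G.m D ((y : K) / x) p hp n b ?_ ?_)
  · rw [show b = w - a by rw [← hab]; ring]
    exact Submodule.sub_mem _ hw (rrx_E_Cl G _ ι n ha)
  · exact rrx_E_Cl G _ ι n hb

theorem RrxG.concl (Gd : RrxG D x y) (G : RrxD K P r σ) (p : Polynomial D) (hp : p.Monic)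
    (ι : Fin r → σ) (h0 : G.δ ι ≠ 0) (h : ∀ ι', G.δ ι' / G.δ ι ∈ rrxC D ((y : K) / x) p) (k : ℕ)
    (hD1 : rrxCl G.m (rrxD1 D ((y : K) / x)) (k+2) ≤
      rrxM G.m * rrxCl G.m (rrxD1 D ((y : K) / x)) (k+1)) :
    rrxCl G.m D (k+2) ≤ rrxM G.m * rrxCl G.m D (k+1) := by
  intro z hz
  set D1 := rrxD1 D ((y : K) / x) with hD1d
  set E := rrxM (G.m ∘ ι)
  have hA := Gd.ClD1 G p hp ι h0 h (k+1)
  have hEM : E ≤ rrxM G.m := rrx_E_le_M G ι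
  have key : rrxCl G.m D (k+2) ≤ rrxLB P D1 * E ^ (k+2) ⊔ rrxM G.m * rrxCl G.m D (k+1) := by
    refine (rrx_Cl_mono G.m (rrx_D_le_D1 D _) (k+2)).trans (hD1.trans ?_)
    refine (mul_le_mul_right hA _).trans ?_
    rw [Submodule.mul_sup]
    refine sup_le ?_ le_sup_right
    calc rrxM G.m * (rrxLB P D1 * E ^ (k+1)) = E * (rrxLB P D1 * (rrxM G.m * E ^ k)) := by
          rw [pow_succ]; ring
      _ ≤ E * (rrxLB P D1 * (rrxM G.m ^ (k+1))) := by
          rw [pow_succ' (rrxM G.m)]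
          exact mul_le_mul_right (mul_le_mul_right (mul_le_mul_right (pow_le_pow_left' hEM k) _) _) _
      _ ≤ E * rrxCl G.m D1 (k+1) := mul_le_mul_right (rrx_LB_M_le_Cl _ _ _) _
      _ ≤ E * (rrxLB P D1 * E ^ (k+1) ⊔ rrxCl G.m D (k+1)) := mul_le_mul_right hA _
      _ = rrxLB P D1 * E ^ (k+2) ⊔ E * rrxCl G.m D (k+1) := by
          rw [Submodule.mul_sup]; congr 1; rw [pow_succ E (k+1)]; ring
      _ ≤ _ := sup_le_sup_left (mul_le_mul_left hEM _) _
  obtain ⟨q, hq, g, hg, hqg⟩ := Submodule.mem_sup.1 (key hz)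
  rw [← hqg]
  refine Submodule.add_mem _ ?_ hg
  have hq2 : q ∈ rrxCl G.m D (k+2) := by
    rw [show q = z - g by rw [← hqg]; ring]
    exact Submodule.sub_mem _ hz (rrx_M_mul_Cl G.m D (k+1) hg)
  have hq3 := rrx_Cl_mono G.m ((rrx_D_le_C D ((y : K) / x) p).trans (rrx_le_IC _)) (k+2) hq2
  have hq4 := rrx_free_Cl G (rrxIC (rrxC D ((y : K) / x) p)) (fun z hz => rrx_int_IC hz) ι h0
    (fun ι' => rrx_le_IC _ (h ι')) (k+2) hq3
  exact rrx_free_step G D ι (k+1)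
    (rrx_free_inter (G.m ∘ ι) (G.hI ι h0) _ _ D (fun z h1 h2 => Gd.inter p hp z h1 h2) _ q hq hq4)
end concl



section locglob
variable {K : Type*} [Field K]

theorem rrx_mem_ofPrime (D1 : Subring K) (N : Ideal D1) [N.IsPrime] (c : K)
    (hc : c ∈ (LocalSubring.ofPrime D1 N).toSubring) : ∃ s : D1, s ∉ N ∧ (s : K) * c ∈ D1 := by
  obtain ⟨⟨a, s⟩, hs⟩ := IsLocalization.surj N.primeCompl
    (⟨c, hc⟩ : (LocalSubring.ofPrime D1 N).toSubring)
  refine ⟨s, s.2, ?_⟩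
  have h := congrArg (fun t : (LocalSubring.ofPrime D1 N).toSubring => (t : K)) hs
  have h2 : c * (s : K) = a := h
  rw [mul_comm, h2]; exact a.2

theorem rrx_inv_ofPrime (D1 : Subring K) (N : Ideal D1) [N.IsPrime] (s : D1) (hs : s ∉ N) :
    (s : K)⁻¹ ∈ (LocalSubring.ofPrime D1 N).toSubring := by
  obtain ⟨u, hu⟩ := IsLocalization.map_units (LocalSubring.ofPrime D1 N).toSubring
    (⟨s, hs⟩ : N.primeCompl)
  have h1 : ((u : (LocalSubring.ofPrime D1 N).toSubring) : K) = s := by rw [hu]; rfl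
  have h2 : ((u : (LocalSubring.ofPrime D1 N).toSubring) : K) *
      ((↑u⁻¹ : (LocalSubring.ofPrime D1 N).toSubring) : K) = 1 := by
    rw [← Subring.coe_mul, Units.mul_inv, Subring.coe_one]
  rw [h1] at h2
  rw [← eq_inv_of_mul_eq_one_right h2]
  exact Subtype.property _

variable {P : Type*} [CommRing P] [Algebra K P] {r : ℕ} {σ : Type*}

theorem rrx_RM_den (m : σ → P) (D1 D' : Subring K) (S0 : Submonoid K) (hS0 : ∀ s ∈ S0, s ∈ D1)
    (h : ∀ c ∈ D', ∃ s ∈ S0, s * c ∈ D1) (w : P) (hw : w ∈ rrxRM m D') :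
    ∃ s ∈ S0, algebraMap K P s * w ∈ rrxRM m D1 := by
  have hmem : ∀ s ∈ S0, algebraMap K P s ∈ rrxRM m D1 := fun s hs => rrx_RM_alg m (hS0 s hs)
  induction hw using Subring.closure_induction with
  | mem w hw =>
    rcases hw with ⟨b, hb, rfl⟩ | ⟨j, rfl⟩
    · obtain ⟨s, hs, hsb⟩ := h b hb
      exact ⟨s, hs, by rw [← map_mul]; exact rrx_RM_alg m hsb⟩
    · exact ⟨1, S0.one_mem, by simpa using rrx_RM_m m D1 j⟩
  | zero => exact ⟨1, S0.one_mem, by simpa using Subring.zero_mem _⟩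
  | one => exact ⟨1, S0.one_mem, by simpa using Subring.one_mem _⟩
  | add a b _ _ ha hb =>
    obtain ⟨s, hs, h1⟩ := ha
    obtain ⟨t, ht, h2⟩ := hb
    refine ⟨s * t, S0.mul_mem hs ht, ?_⟩
    rw [map_mul, show algebraMap K P s * algebraMap K P t * (a + b) =
      algebraMap K P t * (algebraMap K P s * a) + algebraMap K P s * (algebraMap K P t * b) by ring]
    exact Subring.add_mem _ (Subring.mul_mem _ (hmem t ht) h1) (Subring.mul_mem _ (hmem s hs) h2)
  | neg a _ ha =>
    obtain ⟨s, hs, h1⟩ := ha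
    exact ⟨s, hs, by rw [mul_neg]; exact Subring.neg_mem _ h1⟩
  | mul a b _ _ ha hb =>
    obtain ⟨s, hs, h1⟩ := ha
    obtain ⟨t, ht, h2⟩ := hb
    refine ⟨s * t, S0.mul_mem hs ht, ?_⟩
    rw [map_mul, show algebraMap K P s * algebraMap K P t * (a * b) =
      (algebraMap K P s * a) * (algebraMap K P t * b) by ring]
    exact Subring.mul_mem _ h1 h2

theorem rrx_LB_Top_mul (m : σ → P) (n : ℕ) (s : K) (w : P)
    (hw : w ∈ rrxLB P (⊤ : Subring K) * rrxM m ^ n) :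
    algebraMap K P s * w ∈ rrxLB P (⊤ : Subring K) * rrxM m ^ n := by
  have h1 := Submodule.mul_mem_mul (rrx_LB_mem (P := P) (Subring.mem_top s)) hw
  rwa [← mul_assoc, rrx_LB_mul_eq] at h1

theorem rrx_local_global (m : σ → P) (D1 : Subring K) (n : ℕ)
    (H : ∀ (N : Ideal D1) [N.IsMaximal],
      rrxCl m (LocalSubring.ofPrime D1 N).toSubring (n+1) ≤
        rrxM m * rrxCl m (LocalSubring.ofPrime D1 N).toSubring n) :
    rrxCl m D1 (n+1) ≤ rrxM m * rrxCl m D1 n := by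
  have hLB : ∀ s ∈ D1, ∀ w ∈ rrxM m * rrxCl m D1 n,
      algebraMap K P s * w ∈ rrxM m * rrxCl m D1 n := by
    intro s hs w hw
    have h1 := Submodule.mul_mem_mul (rrx_LB_mem (P := P) hs) hw
    rw [mul_left_comm] at h1
    exact mul_le_mul_right (rrx_LB_mul_Cl m D1 n) _ h1
  intro z hz
  let J : Ideal D1 :=
    { carrier := {s | algebraMap K P s * z ∈ rrxM m * rrxCl m D1 n}
      add_mem' := by
        intro a b ha hb
        simp only [Set.mem_ofPred_eq] at ha hb ⊢
        rw [Subring.coe_add, map_add, add_mul]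
        exact Submodule.add_mem _ ha hb
      zero_mem' := by simp
      smul_mem' := by
        intro c a ha
        simp only [Set.mem_ofPred_eq] at ha ⊢
        rw [smul_eq_mul, Subring.coe_mul, map_mul, mul_assoc]
        exact hLB c c.2 _ ha }
  by_cases hJ : J = ⊤
  · have : (1 : D1) ∈ J := by rw [hJ]; trivial
    have h2 : algebraMap K P ((1 : D1) : K) * z ∈ rrxM m * rrxCl m D1 n := this
    simpa using h2
  · exfalso
    obtain ⟨N, hN, hJN⟩ := Ideal.exists_le_maximal J hJ
    have hz' := H N (rrx_Cl_mono m (LocalSubring.le_ofPrime D1 N) (n+1) hz)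
    let S0 : Submonoid K := N.primeCompl.map D1.subtype.toMonoidHom
    have hS0 : ∀ s ∈ S0, s ∈ D1 := by rintro _ ⟨s, hs, rfl⟩; exact s.2
    have hden : ∀ c ∈ (LocalSubring.ofPrime D1 N).toSubring, ∃ s ∈ S0, s * c ∈ D1 := by
      intro c hc
      obtain ⟨s, hs, h1⟩ := rrx_mem_ofPrime D1 N c hc
      exact ⟨s, ⟨s, hs, rfl⟩, h1⟩
    have key : ∃ s ∈ S0, algebraMap K P s * z ∈ rrxM m * rrxCl m D1 n := by
      refine Submodule.mul_induction_on hz' ?_ ?_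
      · intro a ha b hb
        obtain ⟨_, ⟨s, hs, rfl⟩, hsb⟩ := rrx_den (rrxRM m D1)
          (rrxRM m (LocalSubring.ofPrime D1 N).toSubring) (S0.map (algebraMap K P).toMonoidHom)
          (by rintro _ ⟨s, hs, rfl⟩; exact rrx_RM_alg m (hS0 s hs))
          (fun c hc => by
            obtain ⟨s, hs, h1⟩ := rrx_RM_den m D1 _ S0 hS0 hden c hc
            exact ⟨_, ⟨s, hs, rfl⟩, h1⟩) hb.2
        refine ⟨s, hs, ?_⟩
        rw [mul_left_comm]
        exact Submodule.mul_mem_mul ha ⟨rrx_LB_Top_mul m n s b hb.1, hsb⟩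
      · rintro a b ⟨s, hs, h1⟩ ⟨t, ht, h2⟩
        refine ⟨s * t, S0.mul_mem hs ht, ?_⟩
        rw [map_mul, show algebraMap K P s * algebraMap K P t * (a + b) =
          algebraMap K P t * (algebraMap K P s * a) + algebraMap K P s * (algebraMap K P t * b) by
          ring]
        exact Submodule.add_mem _ (hLB t (hS0 t ht) _ h1) (hLB s (hS0 s hs) _ h2)
    obtain ⟨_, ⟨s, hs, rfl⟩, h1⟩ := key
    exact hs (hJN h1)

/-- the ideal of minors divided by f -/
def rrxI (G : RrxD K P r σ) (D : Subring K) (f : K) : Ideal D :=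
  Ideal.span {a : D | ∃ ι, (a : K) * f = G.δ ι}

theorem rrx_principal_case (G : RrxD K P r σ) (D : Subring K) [IsLocalRing D]
    (hDi : ∀ z : K, IsIntegral D z → z ∈ D) (f : K) (hf : f ≠ 0)
    (hG : ∀ ι, ∃ a : D, (a : K) * f = G.δ ι) (ι0 : Fin r → σ) (h0 : G.δ ι0 ≠ 0)
    (hp : (rrxI G D f).IsPrincipal) (n : ℕ) :
    rrxCl G.m D (n+1) ≤ rrxM G.m * rrxCl G.m D n := by
  obtain ⟨q, hq⟩ := hp
  rw [Ideal.submodule_span_eq] at hq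
  choose a ha using hG
  have hb : ∀ ι, ∃ b : D, a ι = b * q := by
    intro ι
    have : a ι ∈ rrxI G D f := Ideal.subset_span ⟨ι, ha ι⟩
    rw [hq, Ideal.mem_span_singleton'] at this
    obtain ⟨b, hb⟩ := this
    exact ⟨b, hb.symm⟩
  choose b hb using hb
  have hq0 : q ≠ 0 := by
    rintro rfl
    apply h0
    rw [← ha, hb]; simp
  obtain ⟨ι, hι⟩ : ∃ ι, IsUnit (b ι) := by
    by_contra hcon
    push Not at hcon
    have h1 : rrxI G D f ≤ maximalIdeal D * Ideal.span {q} := by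
      rw [rrxI, Ideal.span_le]
      rintro c ⟨ι, hc⟩
      have : c = a ι := Subtype.ext (mul_right_cancel₀ hf (hc.trans (ha ι).symm))
      rw [this, hb]
      exact Ideal.mul_mem_mul (hcon ι) (Ideal.mem_span_singleton_self q)
    have h2 : q ∈ maximalIdeal D * Ideal.span {q} := h1 (by rw [hq]; exact Ideal.mem_span_singleton_self q)
    rw [Ideal.mem_mul_span_singleton] at h2
    obtain ⟨z, hz, hzq⟩ := h2
    have : z = 1 := mul_right_cancel₀ hq0 (by rw [hzq, one_mul])
    rw [this] at hz
    exact (Ideal.ne_top_iff_one _).1 (Ideal.IsPrime.ne_top inferInstance) hz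
  obtain ⟨u, hu⟩ := hι
  have hu0 : (b ι : K) ≠ 0 := by
    intro h
    have : b ι = 0 := Subtype.ext h
    rw [this] at hu
    exact u.ne_zero hu
  have hqK : (q : K) ≠ 0 := fun h => hq0 (Subtype.ext h)
  refine rrx_free_K G D hDi ι ?_ ?_ n
  · rw [← ha, hb, Subring.coe_mul]
    exact mul_ne_zero (mul_ne_zero hu0 hqK) hf
  · intro ι'
    have h3 : G.δ ι' / G.δ ι = (b ι' : K) * ((↑u⁻¹ : D) : K) := by
      have h4 : (b ι : K) * ((↑u⁻¹ : D) : K) = 1 := by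
        rw [← hu, ← Subring.coe_mul, Units.mul_inv, Subring.coe_one]
      rw [← ha, ← ha, hb, hb, Subring.coe_mul, Subring.coe_mul, div_eq_iff
        (mul_ne_zero (mul_ne_zero hu0 hqK) hf)]
      linear_combination -(b ι' : K) * q * f * h4
    rw [h3]
    exact D.mul_mem (Subtype.property _) (Subtype.property _)

end locglob



section main
variable {K : Type*} [Field K] {P : Type*} [CommRing P] [IsDomain P] [Algebra K P] {r : ℕ}
  {σ : Type*}

/-- the transform ideal -/
def rrxPhi (D D' : Subring K) [IsLocalRing D] (hDD : D ≤ D') (x : K) (d : ℕ) (J : Ideal D') :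
    Ideal D where
  carrier := {c | c ∈ maximalIdeal D ^ d ∧ ∃ j ∈ J, (c : K) = x ^ d * (j : K)}
  add_mem' := by
    rintro a b ⟨ha, j, hj, h1⟩ ⟨hb, l, hl, h2⟩
    exact ⟨Ideal.add_mem _ ha hb, j + l, J.add_mem hj hl, by
      rw [Subring.coe_add, h1, h2, Subring.coe_add, mul_add]⟩
  zero_mem' := ⟨Ideal.zero_mem _, 0, J.zero_mem, by simp⟩
  smul_mem' := by
    rintro c a ⟨ha, j, hj, h1⟩
    refine ⟨Ideal.mul_mem_left _ _ ha, ⟨c, hDD c.2⟩ * j, J.mul_mem_left _ hj, ?_⟩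
    rw [smul_eq_mul, Subring.coe_mul, h1, Subring.coe_mul]
    ring

theorem rrx_pow_mem {D : Type*} [CommRing D] [IsLocalRing D] (I : Ideal D) (lam : Ideal D → ℕ)
    (hlam : ∀ J1 J2, I ≤ J1 → J1 < J2 → lam J2 < lam J1) (x : D) (hx : x ∈ maximalIdeal D) :
    ∃ k, x ^ k ∈ I := by
  by_contra hcon
  push Not at hcon
  have hlt : ∀ k, I ⊔ Ideal.span {x ^ (k+1)} < I ⊔ Ideal.span {x ^ k} := by
    intro k
    refine lt_of_le_of_ne (sup_le_sup_left ?_ _) ?_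
    · rw [Ideal.span_singleton_le_span_singleton]; exact ⟨x, pow_succ x k⟩
    · intro heq
      have h1 : x ^ k ∈ I ⊔ Ideal.span {x ^ (k+1)} := by
        rw [heq]; exact Ideal.mem_sup_right (Ideal.mem_span_singleton_self _)
      obtain ⟨i, hi, j, hj, hij⟩ := Submodule.mem_sup.1 h1
      obtain ⟨c, rfl⟩ := Ideal.mem_span_singleton'.1 hj
      have h2 : IsUnit (1 - c * x) := by
        by_contra hnu
        have h3 : (1 - c * x) ∈ maximalIdeal D := hnu
        have h4 := Ideal.add_mem _ h3 (Ideal.mul_mem_left _ c hx)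
        rw [sub_add_cancel] at h4
        exact (Ideal.ne_top_iff_one _).1 (Ideal.IsPrime.ne_top inferInstance) h4
      obtain ⟨u, hu⟩ := h2
      apply hcon k
      have h5 : x ^ k * u ∈ I := by
        rw [hu]
        have : x ^ k * (1 - c * x) = i := by
          rw [pow_succ] at hij
          linear_combination -hij
        rw [this]; exact hi
      have h6 := I.mul_mem_right (↑u⁻¹ : D) h5
      rwa [mul_assoc, Units.mul_inv, mul_one] at h6
  have hge : ∀ k, k ≤ lam (I ⊔ Ideal.span {x ^ k}) := by
    intro k
    induction k with
    | zero => exact Nat.zero_le _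
    | succ k ih => exact lt_of_le_of_lt ih (hlam _ _ le_sup_left (hlt k))
  have h7 : lam (I ⊔ Ideal.span {x ^ (lam I + 1)}) ≤ lam I := by
    rcases eq_or_lt_of_le (le_sup_left (a := I) (b := Ideal.span {x ^ (lam I + 1)})) with h | h
    · rw [← h]
    · exact (hlam _ _ le_rfl h).le
  have := hge (lam I + 1)
  omega

theorem rrx_exists_d {D : Type*} [CommRing D] [IsDomain D] [IsLocalRing D] [IsNoetherianRing D]
    (I : Ideal D) (hI : I ≠ ⊥) (hI' : I ≠ ⊤) :
    ∃ d, 0 < d ∧ I ≤ maximalIdeal D ^ d ∧ ¬ I ≤ maximalIdeal D ^ (d+1) := by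
  classical
  have h1 : ∃ e, ¬ I ≤ maximalIdeal D ^ e := by
    by_contra hcon
    push Not at hcon
    apply hI
    rw [eq_bot_iff, ← Ideal.iInf_pow_eq_bot_of_isLocalRing (maximalIdeal D)
      (Ideal.IsPrime.ne_top inferInstance)]
    exact le_iInf hcon
  set e := Nat.find h1
  have he : ¬ I ≤ maximalIdeal D ^ e := Nat.find_spec h1
  have he1 : 1 < e := by
    by_contra hlt
    have : e = 0 ∨ e = 1 := by omega
    rcases this with h | h
    · rw [h] at he; apply he; simp
    · rw [h] at he; apply he; rw [pow_one]; exact le_maximalIdeal hI'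
  refine ⟨e - 1, by omega, ?_, ?_⟩
  · have := Nat.find_min h1 (show e - 1 < e by omega)
    exact not_not.1 this
  · rw [show e - 1 + 1 = e by omega]; exact he

theorem rrx_main (G : RrxD K P r σ) (ι0 : Fin r → σ) (h0 : G.δ ι0 ≠ 0) (Λ : Set K)
    (hΛi : Λ.Infinite) (k : ℕ) :
    ∀ (N : ℕ) (D : Subring K) (_ : IsLocalRing D) (_ : IsNoetherianRing D)
      (_ : ∀ z : K, IsIntegral D z → z ∈ D) (_ : ∀ a ∈ Λ, a ∈ D)
      (_ : ∀ a ∈ Λ, ∀ b ∈ Λ, a ≠ b → (a - b)⁻¹ ∈ D)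
      (x y : D) (_ : Ideal.span {x, y} = maximalIdeal D) (f : K) (_ : f ≠ 0)
      (_ : ∀ ι, ∃ a : D, (a : K) * f = G.δ ι)
      (lam : Ideal D → ℕ) (_ : ∀ J1 J2, rrxI G D f ≤ J1 → J1 < J2 → lam J2 < lam J1)
      (_ : lam (rrxI G D f) < N),
      rrxCl G.m D (k+2) ≤ rrxM G.m * rrxCl G.m D (k+1) := by
  intro N
  induction N with
  | zero => intro D _ _ _ _ _ x y _ f _ _ lam _ h; omega
  | succ N ih =>
  intro D _ _ hDi hΛ hΛ' x y hxy f hf hG lam hlam hN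
  by_cases hpr : (rrxI G D f).IsPrincipal
  · exact rrx_principal_case G D hDi f hf hG ι0 h0 hpr (k+1)
  have hItop : rrxI G D f ≠ ⊤ := fun h => hpr (by rw [h]; exact ⟨1, by simp⟩)
  have hIbot : rrxI G D f ≠ ⊥ := fun h => hpr (by rw [h]; exact ⟨0, by simp⟩)
  have hnp : ¬ (maximalIdeal D).IsPrincipal := by
    rintro ⟨q, hq⟩
    have := rrx_pir_of_max q hq
    exact hpr (IsPrincipalIdealRing.principal _)
  obtain ⟨d, hd0, hd, hd'⟩ := rrx_exists_d _ hIbot hItop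
  obtain ⟨h, ⟨ι1, hι1⟩, hh⟩ : ∃ h : D, (∃ ι, (h : K) * f = G.δ ι) ∧ h ∉ maximalIdeal D ^ (d+1) := by
    by_contra hcon
    push Not at hcon
    apply hd'
    rw [rrxI, Ideal.span_le]
    rintro a ⟨ι, ha⟩
    exact hcon a ⟨ι, ha⟩
  have hhI : h ∈ rrxI G D f := Ideal.subset_span ⟨ι1, hι1⟩
  obtain ⟨x', Gd, p, hp, hpd, u, hhe⟩ := RrxG.change ⟨hDi, hxy, hnp⟩ Λ hΛi hΛ hΛ' d h (hd hhI) hh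
  have hx0 : (x' : K) ≠ 0 := Gd.x0
  have hp0 := Gd.ev_ne p hp
  have hu0 : ((u : D) : K) ≠ 0 := by
    intro hz
    exact u.ne_zero (Subtype.ext hz)
  have hui : ((u : D) : K) * ((↑u⁻¹ : D) : K) = 1 := by
    rw [← Subring.coe_mul, Units.mul_inv, Subring.coe_one]
  have hq : ∀ ι, ∃ q : Polynomial D, q.natDegree ≤ d ∧
      G.δ ι = f * x' ^ d * rrxEv D ((y : K) / x') q := by
    intro ι
    obtain ⟨a, ha⟩ := hG ι
    obtain ⟨q, hq, hqe⟩ := (Gd.mem_pow d a).1 (hd (Ideal.subset_span ⟨ι, ha⟩))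
    refine ⟨q, hq, ?_⟩
    rw [← ha, hqe]; ring
  have hd1 : G.δ ι1 ≠ 0 := by
    rw [← hι1, hhe]
    exact mul_ne_zero (mul_ne_zero (mul_ne_zero hu0 (pow_ne_zero _ hx0)) hp0) hf
  refine Gd.concl G p hp ι1 hd1 ?_ k ?_
  · intro ι
    obtain ⟨q, hqd, hqe⟩ := hq ι
    have h1 : G.δ ι / G.δ ι1 = ((↑u⁻¹ : D) : K) *
        (rrxEv D ((y : K) / x') q / rrxEv D ((y : K) / x') p) := by
      rw [hqe, ← hι1, hhe]
      have h2 : ((↑u⁻¹ : D) : K) = (((u : D) : K))⁻¹ := eq_inv_of_mul_eq_one_right hui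
      rw [h2]
      field_simp
    rw [h1]
    exact Subring.mul_mem _ (rrx_D_le_C D _ p (Subtype.property _))
      (rrx_div_mem_C D _ p q (by omega))
  · apply rrx_local_global
    intro 𝔫 _
    have hDD1 : D ≤ rrxD1 D ((y : K) / x') := rrx_D_le_D1 D _
    have hD1D' : rrxD1 D ((y : K) / x') ≤
      (LocalSubring.ofPrime (rrxD1 D ((y : K) / x')) 𝔫).toSubring := LocalSubring.le_ofPrime _ 𝔫
    have hD1mem : ∀ c ∈ (LocalSubring.ofPrime (rrxD1 D ((y : K) / x')) 𝔫).toSubring,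
        ∃ s : rrxD1 D ((y : K) / x'), s ∉ 𝔫 ∧ (s : K) * c ∈ rrxD1 D ((y : K) / x') :=
      fun c hc => rrx_mem_ofPrime _ 𝔫 c hc
    have hinv : ∀ s : rrxD1 D ((y : K) / x'), s ∉ 𝔫 →
        (s : K)⁻¹ ∈ (LocalSubring.ofPrime (rrxD1 D ((y : K) / x')) 𝔫).toSubring :=
      fun s hs => rrx_inv_ofPrime _ 𝔫 s hs
    have hDi' : ∀ z : K, IsIntegral (LocalSubring.ofPrime (rrxD1 D ((y : K) / x')) 𝔫).toSubring z →
        z ∈ (LocalSubring.ofPrime (rrxD1 D ((y : K) / x')) 𝔫).toSubring := by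
      intro z hz
      obtain ⟨_, ⟨s, hs, rfl⟩, h1⟩ := rrx_den (rrxD1 D ((y : K) / x'))
        (LocalSubring.ofPrime (rrxD1 D ((y : K) / x')) 𝔫).toSubring
        (𝔫.primeCompl.map (rrxD1 D ((y : K) / x')).subtype.toMonoidHom)
        (by rintro _ ⟨s, hs, rfl⟩; exact s.2)
        (fun c hc => by
          obtain ⟨s, hs, h1⟩ := hD1mem c hc
          exact ⟨s, ⟨s, hs, rfl⟩, h1⟩) hz
      have h2 := Gd.D1_int _ h1
      have h3 : (s : K) ≠ 0 := by
        intro h4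
        have : s = 0 := Subtype.ext h4
        rw [this] at hs
        exact hs 𝔫.zero_mem
      have h5 := Subring.mul_mem _ (hinv s hs) (hD1D' h2)
      change (s : K)⁻¹ * ((s : K) * z) ∈ _ at h5
      rwa [inv_mul_cancel_left₀ h3] at h5
    have hnoeth1 : IsNoetherianRing (rrxD1 D ((y : K) / x')) :=
      isNoetherianRing_range (rrxEv D ((y : K) / x'))
    have hnoeth : IsNoetherianRing (LocalSubring.ofPrime (rrxD1 D ((y : K) / x')) 𝔫).toSubring :=
      IsLocalization.isNoetherianRing 𝔫.primeCompl _ hnoeth1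
    have hloc : IsLocalRing (LocalSubring.ofPrime (rrxD1 D ((y : K) / x')) 𝔫).toSubring :=
      (LocalSubring.ofPrime (rrxD1 D ((y : K) / x')) 𝔫).isLocalRing
    have hmax : ∀ g, 𝔫 = Ideal.span {⟨x', hDD1 x'.2⟩, g} →
        Ideal.span {⟨(x' : K), hD1D' (hDD1 x'.2)⟩, ⟨(g : K), hD1D' g.2⟩} =
        maximalIdeal (LocalSubring.ofPrime (rrxD1 D ((y : K) / x')) 𝔫).toSubring := by
      intro g hg
      rw [← IsLocalization.AtPrime.map_eq_maximalIdeal 𝔫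
        (LocalSubring.ofPrime (rrxD1 D ((y : K) / x')) 𝔫).toSubring]
      have h1 := congrArg (Ideal.map (algebraMap (rrxD1 D ((y : K) / x'))
        (LocalSubring.ofPrime (rrxD1 D ((y : K) / x')) 𝔫).toSubring)) hg
      rw [h1, Ideal.map_span, Set.image_pair]
      rfl
    generalize (LocalSubring.ofPrime (rrxD1 D ((y : K) / x')) 𝔫).toSubring = D' at *
    have hDD' : D ≤ D' := hDD1.trans hD1D'
    have hf' : f * (x' : K) ^ d ≠ 0 := mul_ne_zero hf (pow_ne_zero _ hx0)
    have hG' : ∀ ι, ∃ a : D', (a : K) * (f * (x' : K) ^ d) = G.δ ι := by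
      intro ι
      obtain ⟨q, hqd, hqe⟩ := hq ι
      exact ⟨⟨_, hD1D' (rrxEv_mem _ _ q)⟩, by rw [hqe]; ring⟩
    by_cases hI' : rrxI G D' (f * (x' : K) ^ d) = ⊤
    · exact rrx_principal_case G D' hDi' _ hf' hG' ι0 h0 (by rw [hI']; exact ⟨1, by simp⟩) (k+1)
    -- the elements of I divided by x^d
    have hIdiv : ∀ a ∈ rrxI G D f, ∃ j ∈ rrxI G D' (f * (x' : K) ^ d), (a : K) = x' ^ d * (j : K) := by
      intro a ha
      refine Submodule.span_induction ?_ ?_ ?_ ?_ ha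
      · rintro a ⟨ι, ha⟩
        obtain ⟨j, hj⟩ := hG' ι
        refine ⟨j, Ideal.subset_span ⟨ι, hj⟩, ?_⟩
        apply mul_right_cancel₀ hf
        rw [ha, ← hj]; ring
      · exact ⟨0, Ideal.zero_mem _, by simp⟩
      · rintro a b _ _ ⟨j, hj, h1⟩ ⟨l, hl, h2⟩
        exact ⟨j + l, Ideal.add_mem _ hj hl, by
          rw [Subring.coe_add, h1, h2, Subring.coe_add, mul_add]⟩
      · rintro c a _ ⟨j, hj, h1⟩
        refine ⟨⟨c, hDD' c.2⟩ * j, Ideal.mul_mem_left _ _ hj, ?_⟩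
        rw [smul_eq_mul, Subring.coe_mul, h1, Subring.coe_mul]; ring
    -- x' ∈ 𝔫
    have hxn : (⟨x', hDD1 x'.2⟩ : rrxD1 D ((y : K) / x')) ∈ 𝔫 := by
      by_contra hxn
      obtain ⟨e, he⟩ := rrx_pow_mem _ lam hlam x' Gd.xm
      obtain ⟨j, hj, hje⟩ := hIdiv _ he
      apply hI'
      have hi : (x' : K)⁻¹ ∈ D' := hinv _ hxn
      have h1 := Ideal.mul_mem_left _ (⟨(x' : K)⁻¹, hi⟩ ^ e * ⟨x', hDD' x'.2⟩ ^ d : D') hj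
      rw [Ideal.eq_top_iff_one]
      convert h1 using 1
      apply Subtype.ext
      simp only [Subring.coe_mul, Subring.coe_pow, Subring.coe_one] at hje ⊢
      rw [mul_assoc, ← hje, inv_pow, inv_mul_cancel₀ (pow_ne_zero _ hx0)]
    obtain ⟨g, hg⟩ := Gd.two_gen 𝔫 hxn
    have hPhi : ∀ J : Ideal D', rrxI G D' (f * (x' : K) ^ d) ≤ J →
        rrxI G D f ≤ rrxPhi D D' hDD' x' d J := by
      intro J hJ a ha
      obtain ⟨j, hj, h1⟩ := hIdiv a ha
      exact ⟨hd ha, j, hJ hj, h1⟩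
    have hPhi2 : ∀ J : Ideal D', rrxI G D' (f * (x' : K) ^ d) ≤ J →
        0 < lam (rrxPhi D D' hDD' x' d J) := by
      intro J hJ
      refine lt_of_le_of_lt (Nat.zero_le (lam ⊤)) (hlam _ _ (hPhi J hJ) ?_)
      rw [lt_top_iff_ne_top, Ideal.ne_top_iff_one]
      rintro ⟨h1, -⟩
      have h2 := Ideal.pow_le_self (by omega) h1
      exact (Ideal.ne_top_iff_one _).1 (Ideal.IsPrime.ne_top inferInstance) h2
    have hpI : (⟨_, hD1D' (rrxEv_mem D ((y : K) / x') p)⟩ : D') ∈ rrxI G D' (f * (x' : K) ^ d) := by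
      obtain ⟨j, hj, h1⟩ := hIdiv h hhI
      have h2 := Ideal.mul_mem_left _ (⟨((↑u⁻¹ : D) : K), hDD' (Subtype.property _)⟩ : D') hj
      convert h2 using 1
      apply Subtype.ext
      rw [Subring.coe_mul]
      have h3 : (j : K) = u * rrxEv D ((y : K) / x') p := by
        apply mul_left_cancel₀ (pow_ne_zero d hx0)
        rw [← h1, hhe]; ring
      rw [h3]
      linear_combination -(rrxEv D ((y : K) / x') p) * hui
    have hlam' : ∀ J1 J2 : Ideal D', rrxI G D' (f * (x' : K) ^ d) ≤ J1 → J1 < J2 →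
        lam (rrxPhi D D' hDD' x' d J2) < lam (rrxPhi D D' hDD' x' d J1) := by
      intro J1 J2 hJ hJJ
      apply hlam _ _ (hPhi J1 hJ)
      rw [SetLike.lt_iff_le_and_exists]
      refine ⟨?_, ?_⟩
      · rintro c ⟨hc, j, hj, h1⟩
        exact ⟨hc, j, hJJ.le hj, h1⟩
      · obtain ⟨w, hw2, hw1⟩ := SetLike.exists_of_lt hJJ
        obtain ⟨s, hs, q, hqw⟩ := hD1mem w w.2
        have hs0 : (s : K) ≠ 0 := by
          intro h4
          have : s = 0 := Subtype.ext h4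
          rw [this] at hs
          exact hs 𝔫.zero_mem
        have hdm : q %ₘ p + p * (q /ₘ p) = q := Polynomial.modByMonic_add_div q p
        have htd : (q %ₘ p).natDegree ≤ d := hpd ▸ Polynomial.natDegree_modByMonic_le q hp
        set t : D' := ⟨rrxEv D ((y : K) / x') (q %ₘ p), hD1D' (rrxEv_mem _ _ _)⟩ with ht
        set p' : D' := ⟨_, hD1D' (rrxEv_mem D ((y : K) / x') p)⟩ with hp'
        set v' : D' := ⟨_, hD1D' (rrxEv_mem D ((y : K) / x') (q /ₘ p))⟩ with hv'
        set s' : D' := ⟨s, hD1D' s.2⟩ with hs'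
        have htw : t = s' * w - v' * p' := by
          apply Subtype.ext
          change rrxEv D ((y : K) / x') (q %ₘ p) = s * w - rrxEv D ((y : K) / x') (q /ₘ p) *
            rrxEv D ((y : K) / x') p
          have h1 := congrArg (rrxEv D ((y : K) / x')) hdm
          rw [map_add, map_mul] at h1
          rw [← hqw, ← h1]; ring
        have ht2 : t ∈ J2 := by
          rw [htw]
          exact Ideal.sub_mem _ (Ideal.mul_mem_left _ _ hw2)
            (Ideal.mul_mem_left _ _ (hJJ.le (hJ hpI)))
        have ht1 : t ∉ J1 := by
          intro ht1
          apply hw1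
          have h1 : s' * w ∈ J1 := by
            have : s' * w = t + v' * p' := by rw [htw]; ring
            rw [this]
            exact Ideal.add_mem _ ht1 (Ideal.mul_mem_left _ _ (hJ hpI))
          have h2 := Ideal.mul_mem_left _ (⟨(s : K)⁻¹, hinv s hs⟩ : D') h1
          convert h2 using 1
          apply Subtype.ext
          simp only [Subring.coe_mul, hs']
          rw [inv_mul_cancel_left₀ hs0]
        have hcD : (x' : K) ^ d * rrxEv D ((y : K) / x') (q %ₘ p) ∈ D := by
          rw [rrxEv_sum D _ _ (d+1) (by omega), Finset.mul_sum]
          refine Subring.sum_mem _ fun i hi => ?_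
          rw [Finset.mem_range] at hi
          obtain ⟨e, rfl⟩ : ∃ e, d = i + e := ⟨d - i, by omega⟩
          have : (x' : K) ^ (i + e) * (((q %ₘ p).coeff i : K) * ((y : K) / x') ^ i) =
            (q %ₘ p).coeff i * (x' : K) ^ e * (y : K) ^ i := by
            rw [div_pow, pow_add]; field_simp
          rw [this]
          exact D.mul_mem (D.mul_mem (Subtype.property _) (D.pow_mem x'.2 e)) (D.pow_mem y.2 i)
        refine ⟨⟨_, hcD⟩, ⟨(Gd.mem_pow d _).2 ⟨q %ₘ p, htd, rfl⟩, t, ht2, rfl⟩, ?_⟩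
        rintro ⟨-, j, hj, h1⟩
        apply ht1
        have : t = j := by
          apply Subtype.ext
          exact mul_left_cancel₀ (pow_ne_zero d hx0) h1
        rw [this]; exact hj
    refine ih D' hloc hnoeth hDi' (fun a ha => hDD' (hΛ a ha))
      (fun a ha b hb hab => hDD' (hΛ' a ha b hb hab)) _ _ (hmax g hg) _ hf' hG'
      (fun J => lam (rrxPhi D D' hDD' x' d J) - 1) ?_ ?_
    · intro J1 J2 hJ hJJ
      have h1 := hlam' J1 J2 hJ hJJ
      have h2 := hPhi2 J2 (hJ.trans hJJ.le)
      omega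
    · have h2 := hPhi2 _ le_rfl
      have h3 : lam (rrxPhi D D' hDD' x' d (rrxI G D' (f * (x' : K) ^ d))) ≤ lam (rrxI G D f) := by
        rcases eq_or_lt_of_le (hPhi _ le_rfl) with h | h
        · rw [← h]
        · exact (hlam _ _ le_rfl h).le
      omega
end main



section start
variable (A : Type) [CommRing A]

/-- base change of polynomial rings to the fraction field -/
noncomputable def rrxTh (r : ℕ) : MvPolynomial (Fin r) A →+* MvPolynomial (Fin r) (FractionRing A) :=
  MvPolynomial.map (algebraMap A (FractionRing A))

theorem rrx_Th_inj [IsDomain A] (r : ℕ) : Function.Injective (rrxTh A r) :=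
  MvPolynomial.map_injective _ (IsFractionRing.injective A (FractionRing A))

theorem rrx_Th_emb (r : ℕ) (v : Fin r → A) : rrxTh A r (emb A r v) =
    ∑ i, algebraMap A (FractionRing A) (v i) • X i := by
  rw [Fintype.linearCombination_apply, map_sum]
  refine Finset.sum_congr rfl fun i _ => ?_
  rw [MvPolynomial.smul_eq_C_mul, MvPolynomial.smul_eq_C_mul, map_mul, rrxTh, map_C, map_X]

/-- matrix of a tuple -/
noncomputable def rrxMat (r : ℕ) (w : Fin r → (Fin r → A)) : Matrix (Fin r) (Fin r) (FractionRing A) :=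
  fun k i => algebraMap A (FractionRing A) (w k i)

theorem rrx_Mat_det (r : ℕ) (w : Fin r → (Fin r → A)) : (rrxMat A r w).det =
    algebraMap A (FractionRing A) (Matrix.det (Matrix.of w)) := by
  rw [RingHom.map_det]; rfl

/-- starting data -/
noncomputable def rrxG [IsDomain A] (r : ℕ) (M : Submodule A (Fin r → A)) :
    RrxD (FractionRing A) (MvPolynomial (Fin r) (FractionRing A)) r M where
  m := fun v => rrxTh A r (emb A r v)
  δ := fun ι => (rrxMat A r (fun k => (ι k : Fin r → A))).det
  hC := by
    intro ι j
    have h := Matrix.mulVec_cramer (rrxMat A r (fun k => (ι k : Fin r → A))).transpose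
      (fun i => algebraMap A (FractionRing A) ((j : Fin r → A) i))
    have h2 : ∀ k, (rrxMat A r (fun l => ((Function.update ι k j) l : Fin r → A))) =
        (rrxMat A r (fun k => (ι k : Fin r → A))).updateRow k
          (fun i => algebraMap A (FractionRing A) ((j : Fin r → A) i)) := by
      intro k
      ext l i
      by_cases hl : l = k
      · subst hl; simp [rrxMat]
      · simp [rrxMat, Matrix.updateRow_apply, hl]
    simp only [rrx_Th_emb, h2, Finset.smul_sum, smul_smul]
    rw [Finset.sum_comm]
    refine Finset.sum_congr rfl fun i _ => ?_
    rw [← Finset.sum_smul]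
    congr 1
    have h3 := congrFun h i
    rw [Matrix.det_transpose] at h3
    simp only [Matrix.mulVec, dotProduct, Matrix.transpose_apply, Pi.smul_apply, smul_eq_mul,
      Matrix.cramer_transpose_apply] at h3
    rw [← h3]
    refine Finset.sum_congr rfl fun k _ => ?_
    rw [mul_comm]; rfl
  hI := by
    intro ι hι
    have hu : IsUnit (rrxMat A r (fun k => (ι k : Fin r → A))).det := isUnit_iff_ne_zero.2 hι
    set B := rrxMat A r (fun k => (ι k : Fin r → A)) with hB
    have hl : ∀ p, aeval (fun i => ∑ l, B⁻¹ i l • (X l : MvPolynomial (Fin r) (FractionRing A)))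
        (aeval ((fun v : M => rrxTh A r (emb A r v)) ∘ ι) p) = p := by
      intro p
      rw [← AlgHom.comp_apply]
      conv_rhs => rw [← AlgHom.id_apply (R := FractionRing A) p]
      congr 1
      ext1 k
      simp only [AlgHom.comp_apply, aeval_X, Function.comp_apply, rrx_Th_emb, map_sum, map_smul,
        AlgHom.id_apply, Finset.smul_sum, smul_smul]
      rw [Finset.sum_comm]
      simp only [← Finset.sum_smul]
      have h1 : ∀ l, ∑ i, (algebraMap A (FractionRing A)) ((ι k : Fin r → A) i) * B⁻¹ i l
          = (1 : Matrix (Fin r) (Fin r) (FractionRing A)) k l := by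
        intro l
        rw [← Matrix.mul_nonsing_inv B hu]; rfl
      simp only [h1, Matrix.one_apply, ite_smul, one_smul, zero_smul]
      simp
    exact Function.LeftInverse.injective hl
end start

/-- finite colength gives a length function -/
theorem rrx_lam {R : Type*} [CommRing R] [IsLocalRing R] [IsNoetherianRing R] (I : Ideal R) (N : ℕ)
    (h : maximalIdeal R ^ N ≤ I) :
    ∃ lam : Ideal R → ℕ, ∀ J1 J2, I ≤ J1 → J1 < J2 → lam J2 < lam J1 := by
  by_cases hI : I = ⊤
  · refine ⟨fun _ => 0, fun J1 J2 h1 h2 => ?_⟩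
    rw [hI, top_le_iff] at h1
    exact absurd h2 (by rw [h1]; exact not_top_lt)
  have hnt : Nontrivial (R ⧸ I) := Ideal.Quotient.nontrivial_iff.2 hI
  have hloc : IsLocalRing (R ⧸ I) :=
    IsLocalRing.of_surjective' (Ideal.Quotient.mk I) Ideal.Quotient.mk_surjective
  have hart : IsArtinianRing (R ⧸ I) := by
    rw [isArtinianRing_iff_isNilpotent_maximalIdeal]
    refine ⟨N, ?_⟩
    have h1 : maximalIdeal (R ⧸ I) ≤ (maximalIdeal R).map (Ideal.Quotient.mk I) := by
      intro z hz
      obtain ⟨a, rfl⟩ := Ideal.Quotient.mk_surjective z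
      apply Ideal.mem_map_of_mem
      rw [mem_maximalIdeal] at hz ⊢
      intro ha
      exact hz (ha.map _)
    rw [Ideal.zero_eq_bot, ← le_bot_iff]
    calc maximalIdeal (R ⧸ I) ^ N ≤ ((maximalIdeal R).map (Ideal.Quotient.mk I)) ^ N :=
          Ideal.pow_right_mono h1 N
      _ = ((maximalIdeal R)^N).map (Ideal.Quotient.mk I) := (Ideal.map_pow _ _ _).symm
      _ ≤ I.map (Ideal.Quotient.mk I) := Ideal.map_mono h
      _ = ⊥ := Ideal.map_quotient_self I
  have hartm : IsArtinian R (R ⧸ I) := by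
    exact isArtinian_of_surjective_algebraMap (Ideal.Quotient.mk_surjective (I := I))
  have hfin : Module.length R (R ⧸ I) ≠ ⊤ := by
    rw [Module.length_ne_top_iff, isFiniteLength_iff_isNoetherian_isArtinian]
    exact ⟨inferInstance, hartm⟩
  refine ⟨fun J => (Order.coheight J).toNat, fun J1 J2 h1 h2 => ?_⟩
  have hc : ∀ J, I ≤ J → Order.coheight J ≠ ⊤ := by
    intro J hJ hJt
    apply hfin
    rw [Module.length_quotient, ← top_le_iff, ← hJt]
    exact Order.coheight_anti hJ
  have h3 : Order.coheight J2 < Order.coheight J1 :=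
    Order.coheight_strictAnti h2 (lt_top_iff_ne_top.2 (hc J2 (h1.trans h2.le)))
  have e1 := ENat.natCast_toNat (hc J1 h1)
  have e2 := ENat.natCast_toNat (hc J2 (h1.trans h2.le))
  rw [← e1, ← e2] at h3
  exact_mod_cast h3



theorem rrx_colen (A : Type) [CommRing A] [IsLocalRing A] [IsNoetherianRing A] (r : ℕ)
    (M : Submodule A (Fin r → A))
    (hlen : ∃ n : ℕ, modLength A ((Fin r → A) ⧸ M) = (n : WithBot ℕ∞)) :
    ∃ k : ℕ, 0 < k ∧ ∀ a ∈ maximalIdeal A ^ k, ∀ v : Fin r → A, a • v ∈ M := by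
  obtain ⟨n, hn⟩ := hlen
  have hfin : Module.length A ((Fin r → A) ⧸ M) ≠ ⊤ := by
    intro h
    have h1 := Module.coe_length A ((Fin r → A) ⧸ M)
    rw [h] at h1
    rw [modLength, ← h1] at hn
    exact absurd (WithBot.coe_injective hn) (by simp)
  rw [Module.length_ne_top_iff, isFiniteLength_iff_isNoetherian_isArtinian] at hfin
  obtain ⟨_, hart⟩ := hfin
  let g : ℕ →o (Submodule A ((Fin r → A) ⧸ M))ᵒᵈ :=
    ⟨fun k => OrderDual.toDual ((maximalIdeal A ^ k) • (⊤ : Submodule A ((Fin r → A) ⧸ M))),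
      fun a b hab => by
        change (maximalIdeal A ^ b) • (⊤ : Submodule A ((Fin r → A) ⧸ M)) ≤
          (maximalIdeal A ^ a) • (⊤ : Submodule A ((Fin r → A) ⧸ M))
        exact Submodule.smul_mono_left (Ideal.pow_le_pow_right hab)⟩
  obtain ⟨k, hk⟩ := IsArtinian.monotone_stabilizes g
  have h1 : (maximalIdeal A ^ k) • (⊤ : Submodule A ((Fin r → A) ⧸ M)) =
      (maximalIdeal A ^ (k+1)) • (⊤ : Submodule A ((Fin r → A) ⧸ M)) := hk (k+1) (Nat.le_succ k)
  have h2 : (maximalIdeal A ^ k) • (⊤ : Submodule A ((Fin r → A) ⧸ M)) = ⊥ := by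
    refine Submodule.eq_bot_of_le_smul_of_le_jacobson_bot (maximalIdeal A) _
      (IsNoetherian.noetherian _) ?_ (IsLocalRing.maximalIdeal_le_jacobson ⊥)
    rw [← Submodule.mul_smul, ← pow_succ']
    exact h1.le
  refine ⟨k + 1, Nat.succ_pos k, fun a ha v => ?_⟩
  have ha' : a ∈ maximalIdeal A ^ k := Ideal.pow_le_pow_right (Nat.le_succ k) ha
  have h3 : a • (Submodule.Quotient.mk v : (Fin r → A) ⧸ M) ∈
      (maximalIdeal A ^ k) • (⊤ : Submodule A ((Fin r → A) ⧸ M)) :=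
    Submodule.smul_mem_smul ha' trivial
  rw [h2, Submodule.mem_bot, ← Submodule.Quotient.mk_smul, Submodule.Quotient.mk_eq_zero] at h3
  exact h3

section tr
variable (A : Type) [CommRing A]

/-- sealed copy of the polynomial ring over the fraction field -/
def rrxP (r : ℕ) : Type := MvPolynomial (Fin r) (FractionRing A)

noncomputable instance rrxP_commRing (r : ℕ) : CommRing (rrxP A r) :=
  inferInstanceAs (CommRing (MvPolynomial (Fin r) (FractionRing A)))

noncomputable instance rrxP_algebra (r : ℕ) : Algebra (FractionRing A) (rrxP A r) :=
  inferInstanceAs (Algebra (FractionRing A) (MvPolynomial (Fin r) (FractionRing A)))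

instance rrxP_isDomain [IsDomain A] (r : ℕ) : IsDomain (rrxP A r) :=
  inferInstanceAs (IsDomain (MvPolynomial (Fin r) (FractionRing A)))

/-- variables -/
noncomputable def rrxX (r : ℕ) : Fin r → rrxP A r :=
  (X : Fin r → MvPolynomial (Fin r) (FractionRing A))

/-- base change -/
noncomputable def rrxT (r : ℕ) : MvPolynomial (Fin r) A →+* rrxP A r := rrxTh A r

theorem rrx_T_inj [IsDomain A] (r : ℕ) : Function.Injective (rrxT A r) := rrx_Th_inj A r

theorem rrx_T_C (r : ℕ) (a : A) : rrxT A r (C a) =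
    algebraMap (FractionRing A) (rrxP A r) (algebraMap A (FractionRing A) a) := by
  change rrxTh A r (C a) = algebraMap (FractionRing A) (MvPolynomial (Fin r) (FractionRing A)) _
  rw [MvPolynomial.algebraMap_eq, rrxTh, map_C]

theorem rrx_T_X (r : ℕ) (i : Fin r) : rrxT A r (X i) = rrxX A r i := by
  change rrxTh A r (X i) = X i
  rw [rrxTh, map_X]

theorem rrx_T_emb (r : ℕ) (v : Fin r → A) : rrxT A r (emb A r v) =
    ∑ i, algebraMap A (FractionRing A) (v i) • rrxX A r i := rrx_Th_emb A r v

theorem rrx_X_ind (r : ℕ) : AlgebraicIndependent (FractionRing A) (rrxX A r) :=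
  MvPolynomial.algebraicIndependent_X (Fin r) (FractionRing A)

/-- starting data, sealed -/
noncomputable def rrxH [IsDomain A] (r : ℕ) (M : Submodule A (Fin r → A)) :
    RrxD (FractionRing A) (rrxP A r) r M := rrxG A r M

/-- the image of `A` in its fraction field -/
noncomputable def rrxA : Subring (FractionRing A) := (algebraMap A (FractionRing A)).range

theorem rrx_A_mem (a : A) : algebraMap A (FractionRing A) a ∈ rrxA A := ⟨a, rfl⟩

/-- `A` is isomorphic to its image -/
noncomputable def rrxAe [IsDomain A] : A ≃+* rrxA A :=
  RingEquiv.ofBijective (algebraMap A (FractionRing A)).rangeRestrict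
    ⟨fun _ _ h => IsFractionRing.injective A (FractionRing A) (congrArg Subtype.val h),
      RingHom.rangeRestrict_surjective _⟩

theorem rrx_Ae_val [IsDomain A] (a : A) : ((rrxAe A a : rrxA A) : FractionRing A) = algebraMap A _ a :=
  rfl

theorem rrx_A_int [IsDomain A] [IsIntegrallyClosed A] (z : FractionRing A)
    (hz : IsIntegral (rrxA A) z) : z ∈ rrxA A := by
  have h1 : IsIntegral A z := rrx_intElem_of_range_le (rrxA A).subtype
    (algebraMap A (FractionRing A)) (by rintro ⟨_, a, rfl⟩; exact ⟨a, rfl⟩) hz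
  obtain ⟨a, ha⟩ := IsIntegrallyClosed.isIntegral_iff.1 h1
  exact ⟨a, ha⟩

theorem rrx_H_m [IsDomain A] (r : ℕ) (M : Submodule A (Fin r → A)) (v : M) :
  (rrxH A r M).m v = rrxT A r (emb A r v) := rfl

theorem rrx_H_δ [IsDomain A] (r : ℕ) (M : Submodule A (Fin r → A)) (ι : Fin r → M) :
  (rrxH A r M).δ ι = algebraMap A (FractionRing A) (Matrix.det (Matrix.of fun k => (ι k : Fin r → A))) :=
  rrx_Mat_det A r _

/-- direction a -/
theorem rrx_free_le [IsDomain A] (r : ℕ) (M : Submodule A (Fin r → A)) (c : A) (hc : c ≠ 0)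
    (h : ∀ v : Fin r → A, c • v ∈ M) (n : ℕ) (w : MvPolynomial (Fin r) A) (hw : w ∈ freeSub A r ^ n) :
    rrxT A r w ∈ rrxLB (rrxP A r) (⊤ : Subring (FractionRing A)) *
      rrxM (rrxH A r M).m ^ n := by
  induction n generalizing w with
  | zero =>
    rw [pow_zero, Submodule.mem_one] at hw
    obtain ⟨a, rfl⟩ := hw
    rw [pow_zero, mul_one]
    refine ⟨algebraMap A _ a, trivial, ?_⟩
    exact (rrx_T_C A r a).symm
  | succ n ih =>
    rw [pow_succ] at hw
    refine Submodule.mul_induction_on hw ?_ ?_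
    · rintro p hp _ ⟨v, -, rfl⟩
      have e : rrxT A r (emb A r v) = algebraMap (FractionRing A) _ (algebraMap A (FractionRing A) c)⁻¹ *
          (rrxH A r M).m ⟨c • v, h v⟩ := by
        rw [rrx_H_m]
        rw [map_smul, MvPolynomial.smul_eq_C_mul, map_mul, ← mul_assoc]
        have : rrxT A r (C c) = algebraMap (FractionRing A) _ (algebraMap A (FractionRing A) c) := by
          exact rrx_T_C A r c
        rw [this, ← map_mul, inv_mul_cancel₀, map_one, one_mul]
        intro h0
        exact hc (IsFractionRing.injective A (FractionRing A) (by rw [h0, map_zero]))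
      rw [map_mul, e]
      have h1 := Submodule.mul_mem_mul (ih p hp) (Submodule.mul_mem_mul
        (rrx_LB_mem (P := rrxP A r) (B := ⊤)
          (b := (algebraMap A (FractionRing A) c)⁻¹) trivial)
        (rrx_m_mem (rrxH A r M).m ⟨c • v, h v⟩))
      have e2 : (rrxLB (rrxP A r) (⊤ : Subring (FractionRing A)) *
          rrxM (rrxH A r M).m ^ n) * (rrxLB (rrxP A r) (⊤ : Subring (FractionRing A)) *
            rrxM (rrxH A r M).m) = (rrxLB (rrxP A r) (⊤ : Subring (FractionRing A)) *
            rrxLB (rrxP A r) (⊤ : Subring (FractionRing A))) * rrxM (rrxH A r M).m ^ (n+1) := by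
        rw [pow_succ]; ring
      rw [e2, rrx_LB_mul_eq] at h1
      exact h1
    · intro p q hp hq
      rw [map_add]; exact add_mem hp hq

theorem rrx_reesRM [IsDomain A] (r : ℕ) (M : Submodule A (Fin r → A)) :
    rrxRM (rrxH A r M).m (rrxA A) = (reesAlg A r M).toSubring.map (rrxT A r) := by
  apply le_antisymm
  · rw [rrxRM, Subring.closure_le]
    rintro _ (⟨_, ⟨a, rfl⟩, rfl⟩ | ⟨v, rfl⟩)
    · refine ⟨C a, (reesAlg A r M).algebraMap_mem a, ?_⟩
      exact rrx_T_C A r a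
    · exact ⟨emb A r v, Algebra.subset_adjoin ⟨v, v.2, rfl⟩, rfl⟩
  · rw [Subring.map_le_iff_le_comap]
    intro w hw
    have hw' : w ∈ Algebra.adjoin A (sub1 A r M : Set (MvPolynomial (Fin r) A)) := hw
    clear hw
    induction hw' using Algebra.adjoin_induction with
    | mem w hw =>
      obtain ⟨v, hv, rfl⟩ := hw
      exact rrx_RM_m (rrxH A r M).m (rrxA A) ⟨v, hv⟩
    | algebraMap a =>
      change rrxT A r (C a) ∈ rrxRM (rrxH A r M).m (rrxA A)
      have := rrx_RM_alg (rrxH A r M).m (rrx_A_mem A a)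
      rw [← rrx_T_C] at this
      exact this
    | add p q _ _ hp hq => exact add_mem hp hq
    | mul p q _ _ hp hq => exact mul_mem hp hq

theorem rrx_int_iff [IsDomain A] (r : ℕ) (M : Submodule A (Fin r → A)) (w : MvPolynomial (Fin r) A) :
    w ∈ intClAlg A r M ↔ IsIntegral (rrxRM (rrxH A r M).m (rrxA A)) (rrxT A r w) := by
  rw [rrx_reesRM]
  constructor
  · intro h
    have h1 : IsIntegral (reesAlg A r M).toSubring w := h
    exact rrx_int_map _ _ h1
  · intro h
    have h1 : IsIntegral (reesAlg A r M).toSubring w := rrx_int_of_map _ (rrx_T_inj A r) _ h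
    exact h1

theorem rrx_X_mem_free (r : ℕ) (i : Fin r) : (X i : MvPolynomial (Fin r) A) ∈ freeSub A r := by
  refine ⟨Pi.single i 1, trivial, ?_⟩
  simp [Fintype.linearCombination_apply, Pi.single_apply, ite_smul]

theorem rrx_Cl_le [IsDomain A] [IsIntegrallyClosed A] (r : ℕ) (M : Submodule A (Fin r → A)) (n : ℕ)
    (z : rrxP A r) (hz : z ∈ rrxCl (rrxH A r M).m (rrxA A) n) :
    ∃ w ∈ barPow A r M n, rrxT A r w = z := by
  rw [rrx_mem_Cl] at hz
  have hmX : ∀ (B : Subring (FractionRing A)), rrxA A ≤ B → rrxM (rrxH A r M).m ≤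
      rrxLB (rrxP A r) B * rrxM (rrxX A r) := by
    intro B hB
    rw [rrxM, Submodule.span_le]
    rintro _ ⟨v, rfl⟩
    rw [rrx_H_m, rrx_T_emb]
    apply Submodule.sum_mem
    intro i _
    rw [Algebra.smul_def]
    exact Submodule.mul_mem_mul (rrx_LB_mem (hB (rrx_A_mem A _))) (rrx_m_mem _ i)
  have h1 : z ∈ rrxLB (rrxP A r) (⊤ : Subring (FractionRing A)) *
      rrxM (rrxX A r) ^ n := by
    have h2 := mul_le_mul_right (rrx_LB_pow (hmX ⊤ le_top) n) (rrxLB (rrxP A r) (⊤ : Subring (FractionRing A))) hz.1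
    rwa [← mul_assoc, rrx_LB_mul_eq] at h2
  have h2 : IsIntegral (rrxRM (rrxX A r) (rrxA A)) z := by
    refine rrx_int_mono ?_ hz.2
    rw [rrxRM, Subring.closure_le]
    rintro _ (⟨b, hb, rfl⟩ | ⟨v, rfl⟩)
    · exact rrx_RM_alg _ hb
    · exact rrx_subring_le _ (rrx_LB_le_RM (rrxX A r) (rrxA A)) (rrx_M_le_RM (rrxX A r) (rrxA A))
        (hmX _ le_rfl (rrx_m_mem _ v))
  have h3 := rrx_free_int (rrxX A r) (rrx_X_ind A r) (rrxA A) (rrx_A_int A) n z h1 h2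
  have key : ∃ w ∈ freeSub A r ^ n, rrxT A r w = z := by
    clear h1 h2 hz
    induction n generalizing z with
    | zero =>
      rw [pow_zero, mul_one] at h3
      obtain ⟨_, ⟨a, rfl⟩, rfl⟩ := h3
      refine ⟨C a, ?_, ?_⟩
      · rw [pow_zero, Submodule.mem_one]; exact ⟨a, rfl⟩
      · exact rrx_T_C A r a
    | succ n ih =>
      rw [pow_succ, ← mul_assoc] at h3
      refine Submodule.mul_induction_on h3 ?_ ?_
      · intro p hp q hq
        obtain ⟨p', hp', rfl⟩ := ih p hp
        have : ∃ q' ∈ freeSub A r, rrxT A r q' = q := by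
          rw [rrxM] at hq
          induction hq using Submodule.span_induction with
          | mem q hq =>
            obtain ⟨i, rfl⟩ := hq
            exact ⟨X i, rrx_X_mem_free A r i, rrx_T_X A r i⟩
          | zero => exact ⟨0, zero_mem _, map_zero _⟩
          | add a b _ _ ha hb =>
            obtain ⟨a', h1, rfl⟩ := ha
            obtain ⟨b', h2, rfl⟩ := hb
            exact ⟨a' + b', add_mem h1 h2, map_add _ _ _⟩
          | smul t a _ ha =>
            obtain ⟨a', h1, rfl⟩ := ha
            exact ⟨t • a', zsmul_mem h1 t, map_zsmul _ _ _⟩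
        obtain ⟨q', hq', rfl⟩ := this
        exact ⟨p' * q', by rw [pow_succ]; exact Submodule.mul_mem_mul hp' hq', map_mul _ _ _⟩
      · rintro p q ⟨p', hp', rfl⟩ ⟨q', hq', rfl⟩
        exact ⟨p' + q', add_mem hp' hq', map_add _ _ _⟩
  obtain ⟨w, hw, rfl⟩ := key
  exact ⟨w, ⟨hw, (rrx_int_iff A r M w).2 hz.2⟩, rfl⟩

theorem rrx_transfer [IsDomain A] [IsIntegrallyClosed A] (r : ℕ) (M : Submodule A (Fin r → A)) (c : A)
    (hc : c ≠ 0) (h : ∀ v : Fin r → A, c • v ∈ M) (n : ℕ)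
    (hcl : rrxCl (rrxH A r M).m (rrxA A) (n+1) ≤
      rrxM (rrxH A r M).m * rrxCl (rrxH A r M).m (rrxA A) n) :
    barPow A r M (n+1) ≤ sub1 A r M * barPow A r M n := by
  intro w hw
  have h1 : rrxT A r w ∈ rrxCl (rrxH A r M).m (rrxA A) (n+1) :=
    ⟨rrx_free_le A r M c hc h (n+1) w hw.1, (rrx_int_iff A r M w).1 hw.2⟩
  have h2 := hcl h1
  have key : ∀ z ∈ rrxM (rrxH A r M).m * rrxCl (rrxH A r M).m (rrxA A) n,
      ∃ w' ∈ sub1 A r M * barPow A r M n, rrxT A r w' = z := by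
    intro z hz
    refine Submodule.mul_induction_on hz ?_ ?_
    · intro p hp q hq
      obtain ⟨q', hq', rfl⟩ := rrx_Cl_le A r M n q hq
      have : ∃ p' ∈ sub1 A r M, rrxT A r p' = p := by
        rw [rrxM] at hp
        induction hp using Submodule.span_induction with
        | mem p hp =>
          obtain ⟨v, rfl⟩ := hp
          exact ⟨emb A r v, ⟨v, v.2, rfl⟩, rfl⟩
        | zero => exact ⟨0, zero_mem _, map_zero _⟩
        | add a b _ _ ha hb =>
          obtain ⟨a', h1, rfl⟩ := ha
          obtain ⟨b', h2, rfl⟩ := hb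
          exact ⟨a' + b', add_mem h1 h2, map_add _ _ _⟩
        | smul t a _ ha =>
          obtain ⟨a', h1, rfl⟩ := ha
          exact ⟨t • a', zsmul_mem h1 t, map_zsmul _ _ _⟩
      obtain ⟨p', hp', rfl⟩ := this
      exact ⟨p' * q', Submodule.mul_mem_mul hp' hq', map_mul _ _ _⟩
    · rintro p q ⟨p', hp', rfl⟩ ⟨q', hq', rfl⟩
      exact ⟨p' + q', add_mem hp' hq', map_add _ _ _⟩
  obtain ⟨w', hw', he⟩ := key _ h2
  rw [← rrx_T_inj A r he]
  exact hw'
end tr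



theorem rrx_K (A : Type) [CommRing A] [IsLocalRing A]
    [IsNoetherianRing A] [IsDomain A] [IsIntegrallyClosed A]
    (hreg : ∃ x y : A, Ideal.span {x, y} = maximalIdeal A)
    (hmax : maximalIdeal A ≠ ⊥)
    (hres : Infinite (ResidueField A))
    (r : ℕ) (M : Submodule A (Fin r → A))
    (k : ℕ) (hk : ∀ a ∈ maximalIdeal A ^ k, ∀ v : Fin r → A, a • v ∈ M) (n : ℕ) :
    barPow A r M (n+2) ≤ sub1 A r M * barPow A r M (n+1) := by
  classical
  have inj := IsFractionRing.injective A (FractionRing A)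
  obtain ⟨x, y, hxy⟩ := hreg
  obtain ⟨c0, hc0m, hc0⟩ := Submodule.exists_mem_ne_zero_of_ne_bot hmax
  have hc : c0 ^ k ≠ 0 := pow_ne_zero k hc0
  -- determinants
  have hdet : ∀ a ∈ maximalIdeal A, ∃ ι : Fin r → M,
      (rrxH A r M).δ ι = algebraMap A (FractionRing A) (a ^ (k * r)) := by
    intro a ha
    refine ⟨fun i => ⟨a ^ k • Pi.single i 1, hk _ (Ideal.pow_mem_pow ha k) _⟩, ?_⟩
    rw [rrx_H_δ]
    congr 1
    have : (Matrix.of fun i : Fin r => (a ^ k • Pi.single i 1 : Fin r → A)) =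
        a ^ k • (1 : Matrix (Fin r) (Fin r) A) := by
      ext i j
      simp [Matrix.one_apply, Pi.single_apply, eq_comm]
    rw [this, Matrix.det_smul, Matrix.det_one, mul_one, Fintype.card_fin, pow_mul]
  obtain ⟨ι0, hι0⟩ := hdet c0 hc0m
  have h0 : (rrxH A r M).δ ι0 ≠ 0 := by
    rw [hι0]
    intro h
    exact pow_ne_zero (k * r) hc0 (inj (by rw [h, map_zero]))
  -- local ring D
  have hDl : IsLocalRing (rrxA A) := (rrxAe A).isLocalRing
  have hDn : IsNoetherianRing (rrxA A) := isNoetherianRing_of_ringEquiv A (rrxAe A)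
  have hmD : maximalIdeal (rrxA A) = (maximalIdeal A).map (rrxAe A).toRingHom := by
    apply le_antisymm
    · intro z hz
      obtain ⟨a, rfl⟩ := (rrxAe A).surjective z
      refine Ideal.mem_map_of_mem (rrxAe A).toRingHom ?_
      rw [mem_maximalIdeal] at hz ⊢
      exact fun ha => hz (ha.map (rrxAe A))
    · rw [Ideal.map_le_iff_le_comap]
      intro a ha
      rw [Ideal.mem_comap, mem_maximalIdeal]
      rw [mem_maximalIdeal] at ha
      intro hu
      exact ha ((MulEquiv.isUnit_map (rrxAe A)).1 hu)
  have hxyD : Ideal.span {rrxAe A x, rrxAe A y} = maximalIdeal (rrxA A) := by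
    rw [hmD, ← hxy, Ideal.map_span, Set.image_pair]; rfl
  -- residue lifts
  let sec : ResidueField A → A := fun t => (IsLocalRing.residue_surjective t).choose
  have hsec : ∀ t, residue A (sec t) = t := fun t => (IsLocalRing.residue_surjective t).choose_spec
  let Λ : Set (FractionRing A) := Set.range (fun t => algebraMap A (FractionRing A) (sec t))
  have hΛi : Λ.Infinite := by
    apply Set.infinite_range_of_injective
    intro s t hst
    have := inj hst
    rw [← hsec s, ← hsec t, this]
  have hΛ : ∀ a ∈ Λ, a ∈ rrxA A := by
    rintro _ ⟨t, rfl⟩; exact rrx_A_mem A _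
  have hΛ' : ∀ a ∈ Λ, ∀ b ∈ Λ, a ≠ b → (a - b)⁻¹ ∈ rrxA A := by
    rintro _ ⟨s, rfl⟩ _ ⟨t, rfl⟩ hst
    have hu : IsUnit (sec s - sec t) := by
      rw [← IsLocalRing.residue_ne_zero_iff_isUnit, map_sub, hsec, hsec, sub_ne_zero]
      rintro rfl
      exact hst rfl
    obtain ⟨u, hu⟩ := hu
    have : ((algebraMap A (FractionRing A)) (sec s) - (algebraMap A (FractionRing A)) (sec t))⁻¹ =
        algebraMap A (FractionRing A) (↑u⁻¹ : A) := by
      rw [← map_sub, ← hu]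
      apply inv_eq_of_mul_eq_one_right
      rw [← map_mul, Units.mul_inv, map_one]
    change ((algebraMap A (FractionRing A)) (sec s) - (algebraMap A (FractionRing A)) (sec t))⁻¹ ∈ _
    rw [this]; exact rrx_A_mem A _
  have hG : ∀ ι, ∃ a : rrxA A, (a : FractionRing A) * 1 = (rrxH A r M).δ ι := by
    intro ι
    refine ⟨rrxAe A (Matrix.det (Matrix.of fun k => (ι k : Fin r → A))), ?_⟩
    rw [mul_one, rrx_H_δ]; rfl
  have hI : ∀ a ∈ maximalIdeal A, (rrxAe A a) ^ (k * r) ∈ rrxI (rrxH A r M) (rrxA A) 1 := by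
    intro a ha
    obtain ⟨ι, hι⟩ := hdet a ha
    apply Ideal.subset_span
    refine ⟨ι, ?_⟩
    rw [mul_one, hι, ← map_pow]; rfl
  have hxm : x ∈ maximalIdeal A := hxy ▸ Ideal.subset_span (by simp)
  have hym : y ∈ maximalIdeal A := hxy ▸ Ideal.subset_span (by simp)
  have hN : ∃ N, maximalIdeal (rrxA A) ^ N ≤ rrxI (rrxH A r M) (rrxA A) 1 := by
    apply Ideal.exists_pow_le_of_le_radical_of_fg
    · rw [← hxyD, Ideal.span_le]
      rintro z (rfl | rfl)
      · exact ⟨k * r, hI x hxm⟩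
      · exact ⟨k * r, hI y hym⟩
    · exact IsNoetherian.noetherian _
  obtain ⟨N, hN⟩ := hN
  obtain ⟨lam, hlam⟩ := rrx_lam _ N hN
  have main := rrx_main (rrxH A r M) ι0 h0 Λ hΛi n (lam (rrxI (rrxH A r M) (rrxA A) 1) + 1)
    (rrxA A) hDl hDn (rrx_A_int A) hΛ hΛ' _ _ hxyD 1 one_ne_zero hG lam hlam (Nat.lt_succ_self _)
  exact rrx_transfer A r M (c0 ^ k) hc (hk _ (Ideal.pow_mem_pow hc0m k)) (n+1) main



theorem rrx_normal_of {R L : Type*} [CommRing R] [IsDomain R] [Field L] (j : R →+* L)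
    (hj : Function.Injective j) (P : Ideal R) [P.IsPrime]
    (h : ∀ z : L, j.IsIntegralElem z → ∃ s : R, s ∉ P ∧ ∃ a : R, j s * z = j a) :
    IsIntegrallyClosed (Localization.AtPrime P) := by
  have hfr : IsFractionRing (Localization.AtPrime P) (FractionRing R) :=
    IsFractionRing.isFractionRing_of_isDomain_of_isLocalization P.primeCompl _ _
  rw [isIntegrallyClosed_iff (FractionRing R)]
  intro z hz
  obtain ⟨⟨t, ht⟩, hti⟩ := IsIntegral.exists_multiple_integral_of_isLocalization P.primeCompl z hz
  let φ : FractionRing R →+* L := IsFractionRing.lift hj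
  have hφ : ∀ a, φ (algebraMap R _ a) = j a := fun a => IsFractionRing.lift_algebraMap hj a
  have hφi : Function.Injective φ := φ.injective
  have h1 : j.IsIntegralElem (φ (t • z)) := by
    obtain ⟨p, hp, he⟩ := hti
    refine ⟨p, hp, ?_⟩
    have := congrArg φ he
    rw [map_zero, Polynomial.hom_eval₂] at this
    have e : φ.comp (algebraMap R (FractionRing R)) = j := RingHom.ext hφ
    rw [e] at this
    exact this
  obtain ⟨s, hs, a, ha⟩ := h _ h1
  have h2 : algebraMap R (FractionRing R) s * (t • z) = algebraMap R _ a := by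
    apply hφi
    rw [map_mul, hφ, hφ, ha]
  have hu : s * t ∈ P.primeCompl := P.primeCompl.mul_mem hs ht
  refine ⟨IsLocalization.mk' (Localization.AtPrime P) a ⟨s * t, hu⟩, ?_⟩
  have hst : algebraMap R (FractionRing R) (s * t) ≠ 0 := by
    intro h0
    have h00 : s * t = 0 := IsFractionRing.injective R (FractionRing R) (by rw [h0, map_zero])
    exact hu (h00 ▸ P.zero_mem)
  apply mul_left_cancel₀ hst
  have e := IsLocalization.mk'_spec (Localization.AtPrime P) a ⟨s * t, hu⟩
  have e2 := congrArg (algebraMap (Localization.AtPrime P) (FractionRing R)) e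
  rw [map_mul, ← IsScalarTower.algebraMap_apply, ← IsScalarTower.algebraMap_apply] at e2
  rw [mul_comm, e2, ← h2, map_mul, Algebra.smul_def, mul_assoc]

theorem rrx_of_normal {R L : Type*} [CommRing R] [IsDomain R] [Field L] (j : R →+* L)
    (hj : Function.Injective j) (P : Ideal R) [P.IsPrime]
    (h : IsIntegrallyClosed (Localization.AtPrime P)) (z : L) (hz : j.IsIntegralElem z)
    (c d : R) (hc : c ≠ 0) (hcd : j c * z = j d) : ∃ s : R, s ∉ P ∧ ∃ a : R, j s * z = j a := by
  have hfr : IsFractionRing (Localization.AtPrime P) (FractionRing R) :=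
    IsFractionRing.isFractionRing_of_isDomain_of_isLocalization P.primeCompl _ _
  let φ : FractionRing R →+* L := IsFractionRing.lift hj
  have hφ : ∀ a, φ (algebraMap R _ a) = j a := fun a => IsFractionRing.lift_algebraMap hj a
  have hφi : Function.Injective φ := φ.injective
  have hc' : j c ≠ 0 := fun h0 => hc (hj (by rw [h0, map_zero]))
  set y : FractionRing R := algebraMap R _ d / algebraMap R _ c with hy
  have hyz : φ y = z := by
    rw [hy, map_div₀, hφ, hφ, ← hcd]
    field_simp
  have hyi : IsIntegral R y := by
    obtain ⟨p, hp, he⟩ := hz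
    refine ⟨p, hp, hφi ?_⟩
    rw [map_zero, Polynomial.hom_eval₂, hyz]
    have e : φ.comp (algebraMap R (FractionRing R)) = j := RingHom.ext hφ
    rw [e]; exact he
  have hyi2 : IsIntegral (Localization.AtPrime P) y := hyi.tower_top
  obtain ⟨w, hw⟩ := (isIntegrallyClosed_iff (FractionRing R)).1 h hyi2
  obtain ⟨a, s, rfl⟩ := IsLocalization.exists_mk'_eq P.primeCompl w
  refine ⟨s, s.2, a, ?_⟩
  rw [← hyz, ← hφ, ← hφ, ← map_mul, ← hw]
  congr 1
  rw [IsScalarTower.algebraMap_apply R (Localization.AtPrime P) (FractionRing R) s, ← map_mul,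
    mul_comm, IsLocalization.mk'_spec, ← IsScalarTower.algebraMap_apply]

/-- The grading homomorphism. -/
noncomputable def rrxGr (A : Type) [CommRing A] (r : ℕ) :
    MvPolynomial (Fin r) A →ₐ[A] Polynomial (MvPolynomial (Fin r) A) :=
  aeval (fun i => Polynomial.C (X i) * Polynomial.X)

theorem rrx_Gr_coeff (A : Type) [CommRing A] (r : ℕ) (f : MvPolynomial (Fin r) A) (n : ℕ) :
    (rrxGr A r f).coeff n = homogeneousComponent n f := by
  induction f using MvPolynomial.induction_on' with
  | add p q hp hq => rw [map_add, map_add, Polynomial.coeff_add, hp, hq]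
  | monomial u a =>
    have h1 : rrxGr A r (monomial u a) = Polynomial.C (monomial u a) * Polynomial.X ^ (u.degree) := by
      rw [rrxGr, aeval_monomial, MvPolynomial.monomial_eq (s := u), Finsupp.prod, Finsupp.prod]
      simp only [mul_pow, Finset.prod_mul_distrib, map_mul, map_prod, map_pow]
      rw [Finset.prod_pow_eq_pow_sum, mul_assoc]
      rfl
    rw [h1, Polynomial.coeff_C_mul_X_pow,
      homogeneousComponent_of_mem (isHomogeneous_monomial a (n := u.degree) rfl)]

theorem rrx_free_pow (A : Type) [CommRing A] (r n : ℕ) :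
    freeSub A r ^ n = homogeneousSubmodule (Fin r) A n := by
  rw [← homogeneousSubmodule_one_pow]
  congr 1
  rw [homogeneousSubmodule_one_eq_span_X, freeSub, Submodule.map_top]
  exact Fintype.range_linearCombination A X

theorem rrx_sub_le_free (A : Type) [CommRing A] (r : ℕ) (M : Submodule A (Fin r → A)) :
    sub1 A r M ≤ freeSub A r := Submodule.map_mono le_top

theorem rrx_sub_pow_hom (A : Type) [CommRing A] (r : ℕ) (M : Submodule A (Fin r → A)) (n : ℕ) :
    sub1 A r M ^ n ≤ homogeneousSubmodule (Fin r) A n := by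
  rw [← rrx_free_pow]; exact pow_le_pow_left' (rrx_sub_le_free A r M) n

theorem rrx_sub_pow_le (A : Type) [CommRing A] (r : ℕ) (M : Submodule A (Fin r → A)) (n : ℕ) :
    sub1 A r M ^ n ≤ Subalgebra.toSubmodule (reesAlg A r M) := by
  induction n with
  | zero => rw [pow_zero, Submodule.one_le]; exact (reesAlg A r M).one_mem
  | succ n ih =>
    rw [pow_succ, Submodule.mul_le]
    intro a ha b hb
    exact (reesAlg A r M).mul_mem (ih ha) (Algebra.subset_adjoin hb)

theorem rrx_rees_comp (A : Type) [CommRing A] (r : ℕ) (M : Submodule A (Fin r → A))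
    (x : MvPolynomial (Fin r) A) (hx : x ∈ reesAlg A r M) (n : ℕ) :
    homogeneousComponent n x ∈ sub1 A r M ^ n := by
  rw [← rrx_Gr_coeff]
  induction hx using Algebra.adjoin_induction generalizing n with
  | mem x hx =>
    rw [rrx_Gr_coeff, homogeneousComponent_of_mem (m := n) (rrx_sub_pow_hom A r M 1 (by rwa [pow_one]))]
    split_ifs with h
    · subst h; rwa [pow_one]
    · exact zero_mem _
  | algebraMap a =>
    rw [rrx_Gr_coeff, MvPolynomial.algebraMap_eq, homogeneousComponent_of_mem (m := n) (n := 0) (isHomogeneous_C _ a)]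
    split_ifs with h
    · subst h; rw [pow_zero, Submodule.mem_one]; exact ⟨a, rfl⟩
    · exact zero_mem _
  | add p q _ _ hp hq => rw [map_add, Polynomial.coeff_add]; exact add_mem (hp n) (hq n)
  | mul p q _ _ hp hq =>
    rw [map_mul, Polynomial.coeff_mul]
    apply Submodule.sum_mem
    rintro ⟨i, k⟩ hik
    replace hik : i + k = n := by simpa using hik
    rw [← hik, pow_add]
    exact Submodule.mul_mem_mul (hp i) (hq k)

theorem rrx_rees_hom (A : Type) [CommRing A] (r : ℕ) (M : Submodule A (Fin r → A))
    (x : MvPolynomial (Fin r) A) (hx : x ∈ reesAlg A r M) (n : ℕ)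
    (hh : x ∈ freeSub A r ^ n) : x ∈ sub1 A r M ^ n := by
  have := rrx_rees_comp A r M x hx n
  rw [rrx_free_pow] at hh
  rwa [homogeneousComponent_of_mem hh, if_pos rfl] at this

theorem rrx_intCl_comp (A : Type) [CommRing A] (r : ℕ) (M : Submodule A (Fin r → A))
    (w : MvPolynomial (Fin r) A) (hw : w ∈ intClAlg A r M) (n : ℕ) :
    homogeneousComponent n w ∈ barPow A r M n := by
  refine ⟨?_, ?_⟩
  · rw [rrx_free_pow]; exact homogeneousComponent_isHomogeneous n w
  have hw' : (algebraMap (reesAlg A r M) (MvPolynomial (Fin r) A)).IsIntegralElem w := hw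
  have h1 : ((rrxGr A r).toRingHom.comp
      (algebraMap (reesAlg A r M) (MvPolynomial (Fin r) A))).IsIntegralElem (rrxGr A r w) := by
    obtain ⟨p, hp, he⟩ := hw'
    refine ⟨p, hp, ?_⟩
    have := congrArg (rrxGr A r).toRingHom he
    rw [map_zero, Polynomial.hom_eval₂] at this
    exact this
  let _ := Polynomial.algebra (reesAlg A r M) (MvPolynomial (Fin r) A)
  have h2 : IsIntegral (Polynomial (reesAlg A r M)) (rrxGr A r w) := by
    refine rrx_intElem_of_range_le _ _ ?_ h1
    intro a
    have hl : rrxGr A r a ∈ Polynomial.lifts (algebraMap (reesAlg A r M) (MvPolynomial (Fin r) A)) := by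
      rw [Polynomial.lifts_iff_coeff_lifts]
      intro k
      rw [rrx_Gr_coeff]
      exact ⟨⟨_, rrx_sub_pow_le A r M k (rrx_rees_comp A r M a a.2 k)⟩, rfl⟩
    obtain ⟨q, hq⟩ := hl
    exact ⟨q, hq⟩
  have h3 := Polynomial.isIntegral_iff_isIntegral_coeff.1 h2 n
  rw [rrx_Gr_coeff] at h3
  exact h3



theorem rrx_emb_inj (A : Type) [CommRing A] (r : ℕ) : Function.Injective (emb A r) := by
  intro v w h
  ext i
  have h1 := congrArg (coeff (Finsupp.single i 1)) h
  have h2 : ∀ v : Fin r → A, coeff (Finsupp.single i 1) (emb A r v) = v i := by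
    intro v
    rw [Fintype.linearCombination_apply, coeff_sum]
    simp only [coeff_smul, coeff_X, smul_eq_mul, mul_ite, mul_one, mul_zero,
      Finsupp.single_left_inj one_ne_zero]
    simp
  rwa [h2, h2] at h1

theorem rrx_rees_le_cl (A : Type) [CommRing A] (r : ℕ) (M : Submodule A (Fin r → A)) :
    reesAlg A r M ≤ intClAlg A r M := by
  intro x hx
  have := isIntegral_algebraMap (R := reesAlg A r M) (A := MvPolynomial (Fin r) A) (x := ⟨x, hx⟩)
  exact this

theorem rrx_pow_le_bar (A : Type) [CommRing A] (r : ℕ) (M : Submodule A (Fin r → A)) (n : ℕ) :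
    sub1 A r M ^ n ≤ barPow A r M n :=
  le_inf (pow_le_pow_left' (rrx_sub_le_free A r M) n)
    (fun _ hx => rrx_rees_le_cl A r M (rrx_sub_pow_le A r M n hx))

theorem rrx_bar_mul (A : Type) [CommRing A] (r : ℕ) (M : Submodule A (Fin r → A)) (a b : ℕ) :
    barPow A r M a * barPow A r M b ≤ barPow A r M (a + b) := by
  rw [Submodule.mul_le]
  intro x hx y hy
  exact ⟨by rw [pow_add]; exact Submodule.mul_mem_mul hx.1 hy.1, (intClAlg A r M).mul_mem hx.2 hy.2⟩

theorem rrx_sub_ne (A : Type) [CommRing A] [IsDomain A] (r : ℕ) (M : Submodule A (Fin r → A))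
    (hM : M ≠ ⊥) (n : ℕ) : ∃ f ∈ sub1 A r M ^ n, f ≠ 0 := by
  obtain ⟨v, hv, hv0⟩ := Submodule.exists_mem_ne_zero_of_ne_bot hM
  refine ⟨(emb A r v) ^ n, Submodule.pow_mem_pow _ (show emb A r v ∈ sub1 A r M from ⟨v, hv, rfl⟩) n, pow_ne_zero n ?_⟩
  intro h
  exact hv0 (rrx_emb_inj A r (by rw [h, map_zero]))

theorem rrx_sub_fg (A : Type) [CommRing A] [IsNoetherianRing A] (r : ℕ)
    (M : Submodule A (Fin r → A)) : (sub1 A r M).FG :=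
  Submodule.FG.map _ (IsNoetherian.noetherian M)

theorem rrx_tilde_le (A : Type) [CommRing A] [IsDomain A] [IsNoetherianRing A] (r : ℕ)
    (M : Submodule A (Fin r → A)) (hM : M ≠ ⊥) (n : ℕ) :
    ratliffRush A r (freeSub A r ^ n) (sub1 A r M ^ n) ≤ barPow A r M n := by
  rw [ratliffRush]
  refine iSup_le fun l => ?_
  rintro z ⟨hz1, hz2⟩
  refine ⟨hz1, ?_⟩
  change IsIntegral (reesAlg A r M) z
  replace hz2 := Submodule.mem_div_iff_forall_mul_mem.1 hz2
  set V := (sub1 A r M ^ n) ^ (l + 1) with hV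
  have hVfg : V.FG := ((rrx_sub_fg A r M).pow n).pow (l + 1)
  obtain ⟨t, ht⟩ := hVfg
  let W : Submodule (reesAlg A r M) (MvPolynomial (Fin r) A) := Submodule.span _ (t : Set _)
  have hVW : ∀ v ∈ V, v ∈ W := by
    intro v hv
    rw [← ht] at hv
    have h1 : Submodule.span A (t : Set (MvPolynomial (Fin r) A)) ≤ W.restrictScalars A :=
      Submodule.span_le.2 (fun x hx => Submodule.subset_span hx)
    exact h1 hv
  refine isIntegral_of_smul_mem_submodule W ?_ ⟨t, rfl⟩ z ?_
  · obtain ⟨f, hf, hf0⟩ := rrx_sub_ne A r M hM (n * (l+1))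
    rw [pow_mul] at hf
    intro h
    have := hVW f hf
    rw [h] at this
    exact hf0 this
  · intro w hw
    induction hw using Submodule.span_induction with
    | zero => simp
    | add a b _ _ ha hb => rw [smul_add]; exact add_mem ha hb
    | smul c a _ ha => rw [smul_comm]; exact W.smul_mem c ha
    | mem a ha =>
      have h1 := hz2 a (by rw [← ht]; exact Submodule.subset_span ha)
      rw [pow_succ' _ (l+1)] at h1
      rw [smul_eq_mul]
      refine Submodule.mul_induction_on h1 ?_ ?_
      · intro p hp q hq
        exact W.smul_mem (⟨p, rrx_sub_pow_le A r M n hp⟩ : reesAlg A r M) (hVW q hq)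
      · intro p q hp hq; exact add_mem hp hq

theorem rrx_mul_bar_pow (A : Type) [CommRing A] (r : ℕ) (M : Submodule A (Fin r → A))
    (hK : ∀ n, barPow A r M (n+2) ≤ sub1 A r M * barPow A r M (n+1)) (l n : ℕ) :
    barPow A r M (l + 1 + n) ≤ sub1 A r M ^ n * barPow A r M (l+1) := by
  induction n with
  | zero => rw [pow_zero, one_mul]
  | succ n ih =>
    calc barPow A r M (l + 1 + (n+1)) = barPow A r M ((l + n) + 2) := by congr 1; omega
      _ ≤ sub1 A r M * barPow A r M (l+n+1) := hK _
      _ = sub1 A r M * barPow A r M (l+1+n) := by congr 2; omega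
      _ ≤ sub1 A r M * (sub1 A r M ^ n * barPow A r M (l+1)) := mul_le_mul_right ih _
      _ = _ := by rw [← mul_assoc, pow_succ']

theorem rrx_3_4 (A : Type) [CommRing A] (r : ℕ) (M : Submodule A (Fin r → A))
    (hK : ∀ n, barPow A r M (n+2) ≤ sub1 A r M * barPow A r M (n+1))
    (h : ∃ ℓ : ℕ, 0 < ℓ ∧ barPow A r M ℓ = (sub1 A r M) ^ ℓ) :
    ∃ ℓ : ℕ, 0 < ℓ ∧ ∀ n : ℕ, ℓ ≤ n → barPow A r M n = (sub1 A r M) ^ n := by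
  obtain ⟨l, hl, he⟩ := h
  refine ⟨l, hl, fun n hn => le_antisymm ?_ (rrx_pow_le_bar A r M n)⟩
  obtain ⟨k, rfl⟩ := Nat.exists_eq_add_of_le hn
  obtain ⟨l, rfl⟩ := Nat.exists_eq_succ_of_ne_zero hl.ne'
  have := rrx_mul_bar_pow A r M hK l k
  rw [Nat.succ_eq_add_one] at *
  rw [he, ← pow_add, add_comm k] at this
  exact this

theorem rrx_1_4 (A : Type) [CommRing A] [IsNoetherianRing A] (r : ℕ) (M : Submodule A (Fin r → A))
    (hK : ∀ n, barPow A r M (n+2) ≤ sub1 A r M * barPow A r M (n+1))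
    (h : barPow A r M 1 ≤ ratliffRush A r (freeSub A r) (sub1 A r M)) :
    ∃ ℓ : ℕ, 0 < ℓ ∧ ∀ n : ℕ, ℓ ≤ n → barPow A r M n = (sub1 A r M) ^ n := by
  have hmono : Monotone (fun ℓ : ℕ => freeSub A r ⊓ ((sub1 A r M) ^ (ℓ + 2) / (sub1 A r M) ^ (ℓ + 1))) := by
    refine monotone_nat_of_le_succ fun l => inf_le_inf_left _ ?_
    rw [Submodule.le_div_iff_mul_le, pow_succ _ (l+1), ← mul_assoc, pow_succ _ (l+1+1)]
    exact mul_le_mul_left (Submodule.le_div_iff_mul_le.1 le_rfl) _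
  have hfg : (barPow A r M 1).FG := by
    have h1 : (freeSub A r).FG := Submodule.FG.map _ (IsNoetherian.noetherian _)
    have h2 : IsNoetherian A (freeSub A r) := isNoetherian_of_fg_of_noetherian _ h1
    have h3 : barPow A r M 1 ≤ freeSub A r := by
      rw [barPow, pow_one]; exact inf_le_left
    exact (isNoetherian_of_le h3).noetherian ⊤ |> fun h => (Submodule.fg_top _).1 h
  obtain ⟨t, ht⟩ := hfg
  have hex : ∃ l, ∀ g ∈ t, g ∈ freeSub A r ⊓ ((sub1 A r M) ^ (l + 2) / (sub1 A r M) ^ (l + 1)) := by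
    have h1 : ∀ g ∈ t, ∃ l, g ∈ freeSub A r ⊓ ((sub1 A r M) ^ (l + 2) / (sub1 A r M) ^ (l + 1)) := by
      intro g hg
      have h2 : g ∈ barPow A r M 1 := by rw [← ht]; exact Submodule.subset_span hg
      have h3 := h h2
      rw [ratliffRush, Submodule.mem_iSup_of_directed _ hmono.directed_le] at h3
      exact h3
    choose! l hl using h1
    exact ⟨t.sup l, fun g hg => hmono (Finset.le_sup hg) (hl g hg)⟩
  obtain ⟨l, hl⟩ := hex
  have h4 : barPow A r M 1 * sub1 A r M ^ (l+1) ≤ sub1 A r M ^ (l+2) := by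
    rw [← Submodule.le_div_iff_mul_le, ← ht, Submodule.span_le]
    intro g hg
    exact (hl g hg).2
  refine ⟨l + 2, by omega, fun n hn => le_antisymm ?_ (rrx_pow_le_bar A r M n)⟩
  obtain ⟨k, rfl⟩ := Nat.exists_eq_add_of_le hn
  have h5 := rrx_mul_bar_pow A r M hK 0 (l + 1 + k)
  calc barPow A r M (l + 2 + k) = barPow A r M (0 + 1 + (l + 1 + k)) := by congr 1; omega
    _ ≤ _ := h5
    _ = sub1 A r M ^ k * (barPow A r M 1 * sub1 A r M ^ (l+1)) := by rw [pow_add]; ring_nf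
    _ ≤ sub1 A r M ^ k * sub1 A r M ^ (l+2) := mul_le_mul_right h4 _
    _ = _ := by rw [← pow_add, add_comm]

theorem rrx_4_2 (A : Type) [CommRing A] (r : ℕ) (M : Submodule A (Fin r → A))
    (h : ∃ ℓ : ℕ, 0 < ℓ ∧ ∀ n : ℕ, ℓ ≤ n → barPow A r M n = (sub1 A r M) ^ n) (n : ℕ) (hn : 0 < n) :
    barPow A r M n ≤ ratliffRush A r ((freeSub A r) ^ n) ((sub1 A r M) ^ n) := by
  obtain ⟨l, hl, he⟩ := h
  intro z hz
  refine Submodule.mem_iSup_of_mem l ⟨hz.1, ?_⟩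
  refine Submodule.mem_div_iff_forall_mul_mem.2 fun y hy => ?_
  rw [← pow_mul] at hy ⊢
  have h1 := rrx_bar_mul A r M _ _ (Submodule.mul_mem_mul hz (rrx_pow_le_bar A r M _ hy))
  have e : n + n * (l + 1) = n * (l + 2) := by ring
  rw [e, he] at h1
  · exact h1
  · nlinarith



theorem rrx_intElem_of_comp {R S T : Type*} [CommRing R] [CommRing S] [CommRing T] (f : R →+* S)
    (g : S →+* T) (hg : Function.Injective g) {w : S} (h : (g.comp f).IsIntegralElem (g w)) :
    f.IsIntegralElem w := by
  obtain ⟨p, hp, he⟩ := h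
  refine ⟨p, hp, hg ?_⟩
  rw [map_zero, Polynomial.hom_eval₂]; exact he

/-- the embedding of the polynomial ring in a big field -/
noncomputable def rrxJ (A : Type) [CommRing A] [IsDomain A] (r : ℕ) :
    MvPolynomial (Fin r) A →+* FractionRing (rrxP A r) :=
  (algebraMap (rrxP A r) (FractionRing (rrxP A r))).comp (rrxT A r)

theorem rrx_J_inj (A : Type) [CommRing A] [IsDomain A] (r : ℕ) : Function.Injective (rrxJ A r) := by
  intro a b h
  exact rrx_T_inj A r (IsFractionRing.injective (rrxP A r) (FractionRing (rrxP A r)) h)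

theorem rrx_P_intcl (A : Type) [CommRing A] [IsDomain A] (r : ℕ) : IsIntegrallyClosed (rrxP A r) :=
  inferInstanceAs (IsIntegrallyClosed (MvPolynomial (Fin r) (FractionRing A)))

theorem rrx_T_int' (A : Type) [CommRing A] [IsDomain A] [IsIntegrallyClosed A] (r : ℕ)
    (p : MvPolynomial (Fin r) (FractionRing A))
    (h : (MvPolynomial.map (σ := Fin r) (algebraMap A (FractionRing A))).IsIntegralElem p) :
    ∃ w, MvPolynomial.map (σ := Fin r) (algebraMap A (FractionRing A)) w = p := by
  let _ := MvPolynomial.algebraMvPolynomial (R := A) (S := FractionRing A) (σ := Fin r)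
  have h1 : IsIntegral (MvPolynomial (Fin r) A) p := h
  rw [MvPolynomial.isIntegral_iff_isIntegral_coeff] at h1
  have h2 : p ∈ Set.range (MvPolynomial.map (σ := Fin r) (algebraMap A (FractionRing A))) := by
    rw [MvPolynomial.mem_range_map_iff_coeffs_subset]
    intro c hc
    rw [Finset.mem_coe, MvPolynomial.mem_coeffs_iff] at hc
    obtain ⟨n, _, rfl⟩ := hc
    obtain ⟨a, ha⟩ := IsIntegrallyClosed.isIntegral_iff.1 (h1 n)
    exact ⟨a, ha⟩
  exact h2

theorem rrx_T_int (A : Type) [CommRing A] [IsDomain A] [IsIntegrallyClosed A] (r : ℕ) (p : rrxP A r)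
    (h : (rrxT A r).IsIntegralElem p) : ∃ w, rrxT A r w = p :=
  rrx_T_int' A r p h

theorem rrx_J_int (A : Type) [CommRing A] [IsDomain A] [IsIntegrallyClosed A] (r : ℕ)
    (M : Submodule A (Fin r → A)) (z : FractionRing (rrxP A r))
    (hz : ((rrxJ A r).comp (algebraMap (reesAlg A r M) _)).IsIntegralElem z) :
    ∃ w ∈ intClAlg A r M, rrxJ A r w = z := by
  have h1 : IsIntegral (rrxP A r) z :=
    rrx_intElem_of_range_le ((rrxJ A r).comp (algebraMap (reesAlg A r M) _))
      (algebraMap (rrxP A r) (FractionRing (rrxP A r))) (fun a => ⟨rrxT A r a, rfl⟩) hz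
  have _ := rrx_P_intcl A r
  obtain ⟨p, rfl⟩ := IsIntegrallyClosed.isIntegral_iff.1 h1
  have h2 : ((rrxT A r).comp (algebraMap (reesAlg A r M) _)).IsIntegralElem p :=
    rrx_intElem_of_comp ((rrxT A r).comp (algebraMap (reesAlg A r M) _)) (algebraMap (rrxP A r) (FractionRing (rrxP A r)))
      (IsFractionRing.injective (rrxP A r) (FractionRing (rrxP A r))) hz
  obtain ⟨w, rfl⟩ := rrx_T_int A r p (rrx_intElem_of_range_le ((rrxT A r).comp (algebraMap (reesAlg A r M) _)) (rrxT A r) (fun a => ⟨(a : MvPolynomial (Fin r) A), rfl⟩) h2)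
  exact ⟨w, rrx_intElem_of_comp _ _ (rrx_T_inj A r) h2, rfl⟩

theorem rrx_loc_normal (A : Type) [CommRing A] [IsDomain A] [IsIntegrallyClosed A] (r : ℕ)
    (M : Submodule A (Fin r → A)) (P : Ideal (reesAlg A r M)) [P.IsPrime]
    (h : ∀ w ∈ intClAlg A r M, ∃ s : reesAlg A r M, s ∉ P ∧ (s : MvPolynomial (Fin r) A) * w ∈ reesAlg A r M) :
    IsIntegrallyClosed (Localization.AtPrime P) := by
  refine rrx_normal_of ((rrxJ A r).comp (algebraMap (reesAlg A r M) _))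
    ((rrx_J_inj A r).comp Subtype.val_injective) P ?_
  intro z hz
  obtain ⟨w, hw, rfl⟩ := rrx_J_int A r M z hz
  obtain ⟨s, hs, hsw⟩ := h w hw
  refine ⟨s, hs, ⟨_, hsw⟩, ?_⟩
  exact (map_mul (rrxJ A r) _ _).symm

theorem rrx_normal_loc (A : Type) [CommRing A] [IsDomain A] (r : ℕ)
    (M : Submodule A (Fin r → A)) (P : Ideal (reesAlg A r M)) [P.IsPrime]
    (h : IsIntegrallyClosed (Localization.AtPrime P)) (w : MvPolynomial (Fin r) A)
    (hw : w ∈ intClAlg A r M) (c : reesAlg A r M) (hc : c ≠ 0)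
    (hcw : (c : MvPolynomial (Fin r) A) * w ∈ reesAlg A r M) :
    ∃ s : reesAlg A r M, s ∉ P ∧ (s : MvPolynomial (Fin r) A) * w ∈ reesAlg A r M := by
  have hwi : ((rrxJ A r).comp (algebraMap (reesAlg A r M) _)).IsIntegralElem (rrxJ A r w) := by
    have hw' : (algebraMap (reesAlg A r M) (MvPolynomial (Fin r) A)).IsIntegralElem w := hw
    obtain ⟨p, hp, he⟩ := hw'
    refine ⟨p, hp, ?_⟩
    rw [← Polynomial.hom_eval₂, he, map_zero]
  obtain ⟨s, hs, a, ha⟩ := rrx_of_normal ((rrxJ A r).comp (algebraMap (reesAlg A r M) _))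
    ((rrx_J_inj A r).comp Subtype.val_injective) P h (rrxJ A r w) hwi c ⟨_, hcw⟩ hc
    (map_mul (rrxJ A r) _ _).symm
  refine ⟨s, hs, ?_⟩
  have e : (s : MvPolynomial (Fin r) A) * w = a := by
    apply rrx_J_inj A r
    rw [map_mul]; exact ha
  rw [e]; exact a.2

theorem rrx_6_5 (A : Type) [CommRing A] [IsLocalRing A] (r : ℕ) (M : Submodule A (Fin r → A)) :
    posPart A r (reesAlg A r M) ≤ gradedMax A r M := by
  intro x hx
  have h1 : ((MvPolynomial.constantCoeff).comp (reesAlg A r M).val.toRingHom) x = 0 := hx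
  rw [Ideal.mem_comap, h1]
  exact zero_mem _

theorem rrx_free_mul (A : Type) [CommRing A] (r : ℕ) (M : Submodule A (Fin r → A)) (c : A)
    (h : ∀ v : Fin r → A, c • v ∈ M) (n : ℕ) (w : MvPolynomial (Fin r) A) (hw : w ∈ freeSub A r ^ n) :
    C (c ^ n) * w ∈ sub1 A r M ^ n := by
  induction n generalizing w with
  | zero => simpa using hw
  | succ n ih =>
    rw [pow_succ] at hw
    refine Submodule.mul_induction_on hw ?_ ?_
    · rintro p hp _ ⟨v, -, rfl⟩
      have e : C (c ^ (n+1)) * (p * emb A r v) = (C (c ^ n) * p) * emb A r (c • v) := by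
        rw [map_smul, MvPolynomial.smul_eq_C_mul, pow_succ, map_mul]; ring
      rw [e, pow_succ]
      exact Submodule.mul_mem_mul (ih p hp) ⟨_, h v, rfl⟩
    · intro p q hp hq
      rw [mul_add]; exact add_mem hp hq

theorem rrx_4_6 (A : Type) [CommRing A] [IsLocalRing A] [IsDomain A] [IsIntegrallyClosed A] (r : ℕ)
    (M : Submodule A (Fin r → A))
    (k : ℕ) (hk : ∀ a ∈ maximalIdeal A ^ k, ∀ v : Fin r → A, a • v ∈ M)
    (h : ∃ ℓ : ℕ, 0 < ℓ ∧ ∀ n : ℕ, ℓ ≤ n → barPow A r M n = (sub1 A r M) ^ n)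
    (P : Ideal (reesAlg A r M)) [hP : P.IsPrime] (hne : P ≠ gradedMax A r M) :
    IsIntegrallyClosed (Localization.AtPrime P) := by
  obtain ⟨l, hl, he⟩ := h
  apply rrx_loc_normal
  intro w hw
  by_cases hf : ∃ f : reesAlg A r M, (f : MvPolynomial (Fin r) A) ∈ sub1 A r M ∧ f ∉ P
  · obtain ⟨f, hf1, hfP⟩ := hf
    refine ⟨f ^ l, fun h => hfP (hP.mem_of_pow_mem l h), ?_⟩
    rw [← sum_homogeneousComponent w, Finset.mul_sum]
    refine sum_mem fun n _ => ?_
    apply rrx_sub_pow_le A r M (l + n)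
    rw [← he _ (Nat.le_add_right l n)]
    refine rrx_bar_mul A r M _ _ (Submodule.mul_mem_mul (rrx_pow_le_bar A r M l ?_)
      (rrx_intCl_comp A r M w hw n))
    exact Submodule.pow_mem_pow _ hf1 l
  push Not at hf
  have hc : ∃ c ∈ maximalIdeal A, algebraMap A (reesAlg A r M) c ∉ P := by
    by_contra hcon
    push Not at hcon
    apply hne
    have hpow : ∀ n, ∀ x ∈ sub1 A r M ^ (n+1), ∃ hx : x ∈ reesAlg A r M, (⟨x, hx⟩ : reesAlg A r M) ∈ P := by
      intro n x hx
      rw [pow_succ] at hx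
      refine Submodule.mul_induction_on hx ?_ ?_
      · intro p hp q hq
        have h1 := hf ⟨q, Algebra.subset_adjoin hq⟩ hq
        exact ⟨_, P.mul_mem_left ⟨p, rrx_sub_pow_le A r M n hp⟩ h1⟩
      · rintro p q ⟨_, hp⟩ ⟨_, hq⟩
        exact ⟨_, P.add_mem hp hq⟩
    have hle : gradedMax A r M ≤ P := by
      intro x hx
      have hx0 : constantCoeff (x : MvPolynomial (Fin r) A) ∈ maximalIdeal A := hx
      have hm : (x : MvPolynomial (Fin r) A) ∈
          P.toAddSubgroup.map (reesAlg A r M).val.toRingHom.toAddMonoidHom := by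
        rw [← sum_homogeneousComponent (x : MvPolynomial (Fin r) A)]
        refine sum_mem fun n _ => ?_
        rcases n with _ | n
        · refine ⟨algebraMap A _ (constantCoeff (x : MvPolynomial (Fin r) A)), hcon _ hx0, ?_⟩
          rw [homogeneousComponent_zero]; rfl
        · obtain ⟨h1, h2⟩ := hpow n _ (rrx_rees_comp A r M x x.2 (n+1))
          exact ⟨_, h2, rfl⟩
      obtain ⟨y, hy, hyx⟩ := hm
      have : y = x := Subtype.ext hyx
      rw [← this]; exact hy
    have hmax : (gradedMax A r M).IsMaximal := by
      apply Ideal.comap_isMaximal_of_surjective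
      intro a
      exact ⟨algebraMap A _ a, by
        change constantCoeff (C a : MvPolynomial (Fin r) A) = a
        rw [constantCoeff_C]⟩
    exact (hmax.eq_of_le hP.ne_top hle).symm
  obtain ⟨c, hcm, hcP⟩ := hc
  obtain ⟨D, hD⟩ : ∃ D, D = w.totalDegree := ⟨_, rfl⟩
  refine ⟨(algebraMap A (reesAlg A r M) c) ^ (k * D), fun h => hcP (hP.mem_of_pow_mem _ h), ?_⟩
  have e : (((algebraMap A (reesAlg A r M) c) ^ (k * D) : reesAlg A r M) :
    MvPolynomial (Fin r) A) = C (c ^ (k * D)) := by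
    rw [map_pow]; rfl
  rw [e]
  rw [← sum_homogeneousComponent w, Finset.mul_sum, ← hD]
  refine sum_mem fun n hn => ?_
  rw [Finset.mem_range] at hn
  obtain ⟨d, hd⟩ := Nat.exists_eq_add_of_le (Nat.lt_succ_iff.1 hn)
  have e2 : C (c ^ (k * D)) * homogeneousComponent n w =
      C (c ^ (k * d)) * (C ((c ^ k) ^ n) * homogeneousComponent n w) := by
    rw [hd, ← mul_assoc, ← map_mul, ← pow_mul, ← pow_add]; congr 3; ring
  rw [e2]
  refine (reesAlg A r M).mul_mem ((reesAlg A r M).algebraMap_mem _) (rrx_sub_pow_le A r M n ?_)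
  refine rrx_free_mul A r M (c ^ k) (hk _ (Ideal.pow_mem_pow hcm k)) n _ ?_
  rw [rrx_free_pow]; exact homogeneousComponent_isHomogeneous n w



theorem rrx_phi (A : Type) [CommRing A] (r : ℕ) (M : Submodule A (Fin r → A)) :
    ∃ φ : reesAlg A r M →+* Polynomial (reesAlg A r M), ∀ x n,
      (((φ x).coeff n : reesAlg A r M) : MvPolynomial (Fin r) A) =
        homogeneousComponent n (x : MvPolynomial (Fin r) A) := by
  have hinj : Function.Injective (Polynomial.map (reesAlg A r M).val.toRingHom) :=
    Polynomial.map_injective _ Subtype.val_injective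
  have hex : ∀ x : reesAlg A r M, ∃ q : Polynomial (reesAlg A r M),
      q.map (reesAlg A r M).val.toRingHom = rrxGr A r x := by
    intro x
    have : rrxGr A r x ∈ Polynomial.lifts (reesAlg A r M).val.toRingHom := by
      rw [Polynomial.lifts_iff_coeff_lifts]
      intro n
      rw [rrx_Gr_coeff]
      exact ⟨⟨_, rrx_sub_pow_le A r M n (rrx_rees_comp A r M x x.2 n)⟩, rfl⟩
    exact (Polynomial.mem_lifts _).1 this
  choose φ hφ using hex
  refine ⟨{ toFun := φ, map_one' := ?_, map_mul' := ?_, map_zero' := ?_, map_add' := ?_ }, ?_⟩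
  · apply hinj; rw [hφ, Polynomial.map_one]; exact map_one _
  · intro a b; apply hinj; rw [hφ, Polynomial.map_mul, hφ, hφ]; exact map_mul _ _ _
  · apply hinj; rw [hφ, Polynomial.map_zero]; exact map_zero _
  · intro a b; apply hinj; rw [hφ, Polynomial.map_add, hφ, hφ]; exact map_add _ _ _
  · intro x n
    have h1 := congrArg (fun p => Polynomial.coeff p n) (hφ x)
    rw [← rrx_Gr_coeff]
    refine Eq.trans ?_ h1
    exact (Polynomial.coeff_map (p := φ x) (reesAlg A r M).val.toRingHom n).symm

/-- the conductor ideal of `z` -/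
noncomputable def rrxCond (A : Type) [CommRing A] (r : ℕ) (M : Submodule A (Fin r → A))
    (z : MvPolynomial (Fin r) A) : Ideal (reesAlg A r M) where
  carrier := {s | (s : MvPolynomial (Fin r) A) * z ∈ reesAlg A r M}
  zero_mem' := by
    change (0 : MvPolynomial (Fin r) A) * z ∈ reesAlg A r M
    rw [zero_mul]; exact zero_mem _
  add_mem' := by
    intro a b ha hb
    change ((a : MvPolynomial (Fin r) A) + b) * z ∈ reesAlg A r M
    rw [add_mul]; exact add_mem ha hb
  smul_mem' := by
    intro a b hb
    change ((a : MvPolynomial (Fin r) A) * b) * z ∈ reesAlg A r M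
    rw [mul_assoc]; exact mul_mem a.2 hb

theorem rrx_hc_mul (A : Type) [CommRing A] (r : ℕ) (s z : MvPolynomial (Fin r) A)
    (hz : z ∈ homogeneousSubmodule (Fin r) A 1) (n : ℕ) :
    homogeneousComponent (n+1) (s * z) = homogeneousComponent n s * z := by
  have h : rrxGr A r z = Polynomial.C z * Polynomial.X := by
    ext1 n
    rw [rrx_Gr_coeff, homogeneousComponent_of_mem hz, Polynomial.coeff_C_mul, Polynomial.coeff_X]
    by_cases hn : n = 1
    · subst hn; simp
    · rw [if_neg hn, if_neg (fun h => hn h.symm), mul_zero]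
  rw [← rrx_Gr_coeff, map_mul, h, ← mul_assoc, Polynomial.coeff_mul_X, Polynomial.coeff_mul_C,
    rrx_Gr_coeff]

theorem rrx_hc_hc (A : Type) [CommRing A] (r : ℕ) (s : MvPolynomial (Fin r) A) (m n : ℕ) :
    homogeneousComponent m (homogeneousComponent n s) =
      if m = n then homogeneousComponent n s else 0 :=
  homogeneousComponent_of_mem (homogeneousComponent_isHomogeneous n s)

theorem rrx_cond_rad (A : Type) [CommRing A] [IsDomain A] (r : ℕ)
    (M : Submodule A (Fin r → A)) (c : A) (hc0 : c ≠ 0) (hc : ∀ v : Fin r → A, c • v ∈ M)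
    (h5 : ∀ (P : Ideal ↥(reesAlg A r M)) [P.IsPrime],
        IsGradedIdeal A r (reesAlg A r M) P → ¬ (posPart A r (reesAlg A r M) ≤ P) →
        IsIntegrallyClosed (Localization.AtPrime P))
    (z : MvPolynomial (Fin r) A) (hz : z ∈ barPow A r M 1) (f : reesAlg A r M)
    (hf : (f : MvPolynomial (Fin r) A) ∈ sub1 A r M) : f ∈ (rrxCond A r M z).radical := by
  by_contra hcon
  have hdis : Disjoint (rrxCond A r M z : Set (reesAlg A r M)) (Submonoid.powers f) := by
    rw [Set.disjoint_left]
    rintro x hx ⟨n, rfl⟩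
    exact hcon ⟨n, hx⟩
  obtain ⟨Q, hQ, hcQ, hQd⟩ := Ideal.exists_le_prime_disjoint _ _ hdis
  have hfQ : f ∉ Q := fun h => Set.disjoint_left.1 hQd h ⟨1, pow_one f⟩
  obtain ⟨φ, hφ⟩ := rrx_phi A r M
  have hz1 : z ∈ homogeneousSubmodule (Fin r) A 1 := by
    rw [← rrx_free_pow]; exact hz.1
  have hf1 : (f : MvPolynomial (Fin r) A) ∈ homogeneousSubmodule (Fin r) A 1 :=
    rrx_sub_pow_hom A r M 1 (by rwa [pow_one])
  have hprime : (Q.map (Polynomial.C)).IsPrime := Ideal.isPrime_map_C_of_isPrime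
  obtain ⟨P, hPdef⟩ : ∃ P, P = (Q.map (Polynomial.C)).comap φ := ⟨_, rfl⟩
  have hPp : P.IsPrime := by rw [hPdef]; exact Ideal.comap_isPrime _ _
  have hmem : ∀ x, x ∈ P ↔ ∀ n, (φ x).coeff n ∈ Q := by
    intro x
    rw [hPdef, Ideal.mem_comap, Ideal.mem_map_C_iff]
  have hgr : IsGradedIdeal A r (reesAlg A r M) P := by
    intro x hx n hn
    rw [hmem] at hx ⊢
    intro m
    by_cases hmn : m = n
    · subst hmn
      have : (φ ⟨_, hn⟩).coeff m = (φ x).coeff m := by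
        apply Subtype.ext
        rw [hφ, hφ, rrx_hc_hc, if_pos rfl]
      rw [this]; exact hx m
    · have : (φ ⟨_, hn⟩).coeff m = 0 := by
        apply Subtype.ext
        rw [hφ, rrx_hc_hc, if_neg hmn]; rfl
      rw [this]; exact zero_mem _
  have hcP : rrxCond A r M z ≤ P := by
    intro s hs
    rw [hmem]
    intro n
    apply hcQ
    change (((φ s).coeff n : reesAlg A r M) : MvPolynomial (Fin r) A) * z ∈ reesAlg A r M
    rw [hφ, ← rrx_hc_mul A r _ z hz1]
    exact rrx_sub_pow_le A r M (n+1) (rrx_rees_comp A r M _ hs (n+1))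
  have hfP : f ∉ P := by
    intro h
    rw [hmem] at h
    have h1 := h 1
    have : (φ f).coeff 1 = f := by
      apply Subtype.ext
      rw [hφ, homogeneousComponent_of_mem hf1, if_pos rfl]
    rw [this] at h1
    exact hfQ h1
  have hfpos : f ∈ posPart A r (reesAlg A r M) := by
    change constantCoeff (f : MvPolynomial (Fin r) A) = 0
    rw [constantCoeff_eq]
    by_contra hne
    have := hf1 hne
    simp at this
  have hn := h5 P hgr (fun h => hfP (h hfpos))
  obtain ⟨s, hs, hsz⟩ := rrx_normal_loc A r M P hn z hz.2 (algebraMap A _ c)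
    (fun h0 => hc0 (MvPolynomial.C_injective (Fin r) A (by
      rw [map_zero]; exact congrArg Subtype.val h0)))
    (by
      have := rrx_free_mul A r M c hc 1 z hz.1
      have h2 := rrx_sub_pow_le A r M 1 this
      rw [pow_one] at h2
      exact h2)
  exact hs (hcP hsz)

theorem rrx_5_1 (A : Type) [CommRing A] [IsDomain A] [IsNoetherianRing A] (r : ℕ)
    (M : Submodule A (Fin r → A)) (c : A) (hc0 : c ≠ 0) (hc : ∀ v : Fin r → A, c • v ∈ M)
    (h5 : ∀ (P : Ideal ↥(reesAlg A r M)) [P.IsPrime],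
        IsGradedIdeal A r (reesAlg A r M) P → ¬ (posPart A r (reesAlg A r M) ≤ P) →
        IsIntegrallyClosed (Localization.AtPrime P)) :
    barPow A r M 1 ≤ ratliffRush A r (freeSub A r) (sub1 A r M) := by
  intro z hz
  obtain ⟨T, hT⟩ := rrx_sub_fg A r M
  have hTm : ∀ t ∈ T, t ∈ sub1 A r M := fun t ht => hT ▸ Submodule.subset_span ht
  have hle : ∀ t ∈ sub1 A r M, t ∈ reesAlg A r M := fun t ht => Algebra.subset_adjoin ht
  let g : T → reesAlg A r M := fun t => ⟨t, hle _ (hTm _ t.2)⟩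
  obtain ⟨J, hJ⟩ : ∃ J : Ideal (reesAlg A r M), J = Ideal.span (Set.range g) := ⟨_, rfl⟩
  have hJfg : J.FG := hJ ▸ Submodule.fg_span (Set.finite_range g)
  have hJr : J ≤ (rrxCond A r M z).radical := by
    rw [hJ, Ideal.span_le]
    rintro _ ⟨t, rfl⟩
    exact rrx_cond_rad A r M c hc0 hc h5 z hz _ (hTm _ t.2)
  obtain ⟨n, hn⟩ := Ideal.exists_pow_le_of_le_radical_of_fg hJr hJfg
  have hJ1 : ∀ t (ht : t ∈ sub1 A r M), (⟨t, hle t ht⟩ : reesAlg A r M) ∈ J := by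
    have : ∀ t ∈ Submodule.span A (T : Set (MvPolynomial (Fin r) A)),
        ∃ h : t ∈ reesAlg A r M, (⟨t, h⟩ : reesAlg A r M) ∈ J := by
      intro t ht
      induction ht using Submodule.span_induction with
      | mem x hx => exact ⟨hle _ (hTm _ hx), hJ ▸ Ideal.subset_span ⟨⟨x, hx⟩, rfl⟩⟩
      | zero => exact ⟨zero_mem _, J.zero_mem⟩
      | add x y _ _ hx hy =>
        obtain ⟨_, hx⟩ := hx
        obtain ⟨_, hy⟩ := hy
        exact ⟨_, J.add_mem hx hy⟩
      | smul a x _ hx =>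
        obtain ⟨h1, hx⟩ := hx
        refine ⟨(reesAlg A r M).smul_mem h1 a, ?_⟩
        have := J.mul_mem_left (algebraMap A _ a) hx
        rwa [← Algebra.smul_def] at this
    intro t ht
    rw [← hT] at ht
    exact (this t ht).2
  have hJn : ∀ m, ∀ t ∈ sub1 A r M ^ m, ∃ h : t ∈ reesAlg A r M, (⟨t, h⟩ : reesAlg A r M) ∈ J ^ m := by
    intro m
    induction m with
    | zero =>
      intro t ht
      exact ⟨rrx_sub_pow_le A r M 0 ht, by rw [pow_zero, Ideal.one_eq_top]; trivial⟩
    | succ m ih =>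
      intro t ht
      rw [pow_succ] at ht
      refine Submodule.mul_induction_on (C := fun t => ∃ h : t ∈ reesAlg A r M,
        (⟨t, h⟩ : reesAlg A r M) ∈ J ^ (m+1)) ht ?_ ?_
      · intro p hp q hq
        obtain ⟨h1, h2⟩ := ih p hp
        have h3 : (⟨p, h1⟩ : reesAlg A r M) * ⟨q, hle q hq⟩ ∈ J ^ m * J :=
          Ideal.mul_mem_mul h2 (hJ1 q hq)
        rw [← pow_succ] at h3
        exact ⟨mul_mem h1 (hle q hq), h3⟩
      · rintro p q ⟨h1, hp⟩ ⟨h2, hq⟩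
        have h3 : (⟨p, h1⟩ : reesAlg A r M) + ⟨q, h2⟩ ∈ J ^ (m+1) := add_mem hp hq
        exact ⟨add_mem h1 h2, h3⟩
  refine Submodule.mem_iSup_of_mem n ⟨by simpa using hz.1, ?_⟩
  change z ∈ sub1 A r M ^ (n+2) / sub1 A r M ^ (n+1)
  rw [Submodule.mem_div_iff_forall_mul_mem]
  intro y hy
  obtain ⟨h1, h2⟩ := hJn (n+1) y hy
  have h3 : y * z ∈ reesAlg A r M := hn (Ideal.pow_le_pow_right (Nat.le_succ n) h2)
  rw [mul_comm z y]
  refine rrx_rees_hom A r M _ h3 (n+2) ?_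
  have e : freeSub A r ^ (n+2) = freeSub A r ^ (n+1) * freeSub A r ^ 1 := by
    rw [← pow_add]
  rw [e]
  exact Submodule.mul_mem_mul (pow_le_pow_left' (rrx_sub_le_free A r M) (n+1) hy) hz.1

/-- Theorem 1.2, equivalences. Let `(A, 𝔪)` be a two-dimensional
regular local ring (`dim A = 2` and `𝔪` generated by two elements) with infinite residue
field, `M ≠ (0)` a finitely generated torsion-free `A`-module, and `F = M**` a free
module of rank `r > 0` containing `M` via the biduality map (equivalently, `M ⊆ A^r` is a
nonzero submodule with `ℓ_A(F/M) < ∞`). Then the following are equivalent: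
(1) `widetilde{M} = overline{M}`;
(2) `widetilde{M^n} = overline{M^n}` for every `n > 0`;
(3) `overline{M^ℓ} = M^ℓ` for some `ℓ > 0`;
(4) there exists `ℓ > 0` with `overline{M^n} = M^n` for every `n ≥ ℓ`;
(5) `Proj R(M)` is a normal scheme, i.e. `R(M)_P` is normal for every graded prime
`P ⊉ R(M)₊`;
(6) `R(M)_P` is normal for every `P ∈ Spec R(M) \ {𝔐}`, where `𝔐 = 𝔪R(M) + R(M)₊`. -/
theorem ratliffRush_statement_15 (A : Type) [CommRing A] [IsLocalRing A]
    [IsNoetherianRing A]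
    (hdim : ringKrullDim A = 2)
    (hreg : ∃ x y : A, Ideal.span {x, y} = maximalIdeal A)
    (hres : Infinite (ResidueField A))
    (r : ℕ) (hr : 0 < r) (M : Submodule A (Fin r → A)) (hM0 : M ≠ ⊥)
    (hlen : ∃ n : ℕ, modLength A ((Fin r → A) ⧸ M) = (n : WithBot ℕ∞)) :
    List.TFAE [
      ratliffRush A r (freeSub A r) (sub1 A r M) = barPow A r M 1,
      ∀ n : ℕ, 0 < n →
        ratliffRush A r ((freeSub A r) ^ n) ((sub1 A r M) ^ n) = barPow A r M n,
      ∃ ℓ : ℕ, 0 < ℓ ∧ barPow A r M ℓ = (sub1 A r M) ^ ℓ,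
      ∃ ℓ : ℕ, 0 < ℓ ∧ ∀ n : ℕ, ℓ ≤ n → barPow A r M n = (sub1 A r M) ^ n,
      ∀ (P : Ideal ↥(reesAlg A r M)) [P.IsPrime],
        IsGradedIdeal A r (reesAlg A r M) P → ¬ (posPart A r (reesAlg A r M) ≤ P) →
        IsIntegrallyClosed (Localization.AtPrime P),
      ∀ (P : Ideal ↥(reesAlg A r M)) [P.IsPrime],
        P ≠ gradedMax A r M → IsIntegrallyClosed (Localization.AtPrime P)] := by
  obtain ⟨hdom, hic, hnp⟩ := rrx_regular hdim hreg
  have hmax : maximalIdeal A ≠ ⊥ := by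
    intro h
    apply hnp
    rw [h]
    exact ⟨⟨0, by simp⟩⟩
  obtain ⟨k, hk0, hk⟩ := rrx_colen A r M hlen
  have hK := rrx_K A hreg hmax hres r M k hk
  obtain ⟨c, hcm, hc0⟩ := Submodule.exists_mem_ne_zero_of_ne_bot hmax
  have htl : ratliffRush A r (freeSub A r) (sub1 A r M) ≤ barPow A r M 1 := by
    have := rrx_tilde_le A r M hM0 1
    rwa [pow_one, pow_one] at this
  tfae_have 1 → 4 := fun h => rrx_1_4 A r M hK h.ge
  tfae_have 4 → 2 := fun h n hn => le_antisymm (rrx_tilde_le A r M hM0 n) (rrx_4_2 A r M h n hn)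
  tfae_have 2 → 1 := fun h => by
    have := h 1 one_pos
    rwa [pow_one, pow_one] at this
  tfae_have 3 → 4 := fun h => rrx_3_4 A r M hK h
  tfae_have 4 → 3 := by
    rintro ⟨l, hl, h⟩
    exact ⟨l, hl, h l le_rfl⟩
  tfae_have 4 → 6 := by
    intro h P hP hne
    exact rrx_4_6 A r M k hk h P hne
  tfae_have 6 → 5 := by
    intro h P hP _ hpos
    refine h P ?_
    rintro rfl
    exact hpos (rrx_6_5 A r M)
  tfae_have 5 → 1 := by
    intro h
    exact le_antisymm htl (rrx_5_1 A r M (c ^ k) (pow_ne_zero k hc0)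
      (hk _ (Ideal.pow_mem_pow hcm k)) h)
  tfae_finish
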